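/- Let Ω ⊂ ℝ² be a bounded open set whose boundary is piecewise smooth, the smooth part of ∂Ω consisting of finitely many disjoint open C¹ arcs C₁,…,C_n each of which is convex (Ω is locally convex along each Cᵢ), the rest of ∂Ω being a finite set of vertices. Let f₁,…,f_n be bounded continuous functions on C₁,…,C_n respectively. Then there exists a unique function u, C² in Ω and continuous on Ω ∪ C₁ ∪ … ∪ C_n, which is a solution of the minimal surfaces equation in Ω and satisfies u = fᵢ on Cᵢ for each i. -/

import Mathlib

open Real Filter Set Topology MeasureTheory

/-- Partial derivative in the first (x) variable. -/
noncomputable def pd1 (u : ℝ × ℝ → ℝ) (z : ℝ × ℝ) : ℝ := deriv (fun t => u (t, z.2)) z.1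

/-- Partial derivative in the second (y) variable. -/
noncomputable def pd2 (u : ℝ × ℝ → ℝ) (z : ℝ × ℝ) : ℝ := deriv (fun t => u (z.1, t)) z.2

/-- `W = √(1 + p² + q²)` for the function `u`. -/
noncomputable def Wg (u : ℝ × ℝ → ℝ) (z : ℝ × ℝ) : ℝ :=
  Real.sqrt (1 + pd1 u z ^ 2 + pd2 u z ^ 2)

/-- `u` is a C² solution of the minimal surfaces equation
`(1+q²)r − 2pq·s + (1+p²)t = 0` on `Ω`. -/
def IsMSE (u : ℝ × ℝ → ℝ) (Ω : Set (ℝ × ℝ)) : Prop :=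
  ContDiffOn ℝ 2 u Ω ∧ ∀ z ∈ Ω,
    (1 + pd2 u z ^ 2) * pd1 (pd1 u) z
      - 2 * pd1 u z * pd2 u z * pd2 (pd1 u) z
      + (1 + pd1 u z ^ 2) * pd2 (pd2 u) z = 0

/-- Euclidean length of a planar vector. -/
noncomputable def len (v : ℝ × ℝ) : ℝ := Real.sqrt (v.1 ^ 2 + v.2 ^ 2)

/-- Euclidean open disk in the plane. -/
def eball (P : ℝ × ℝ) (ρ : ℝ) : Set (ℝ × ℝ) := {z | len (z - P) < ρ}

/-- `C` is an open regular C¹ arc in the plane. -/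
def IsC1Arc (C : Set (ℝ × ℝ)) : Prop :=
  ∃ γ : ℝ → ℝ × ℝ, ContDiff ℝ 1 γ ∧ InjOn γ (Icc 0 1) ∧
    (∀ t ∈ Icc (0:ℝ) 1, deriv γ t ≠ 0) ∧ C = γ '' Ioo 0 1

/-- `Ω` is locally convex along the boundary arc `C`
(`Ω` lies on the concave side of `C`). -/
def LocallyConvexAlong (Ω C : Set (ℝ × ℝ)) : Prop :=
  ∀ z ∈ C, ∃ ε > 0, Convex ℝ (Ω ∩ eball z ε)


/-! ### Basic calculus of partial derivatives -/

lemma pd1_eq {u : ℝ × ℝ → ℝ} {z : ℝ × ℝ} (h : DifferentiableAt ℝ u z) :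
    pd1 u z = fderiv ℝ u z (1, 0) := by
  have h1 : HasDerivAt (fun t : ℝ => ((t, z.2) : ℝ × ℝ)) (1, 0) z.1 :=
    (hasDerivAt_id z.1).prodMk (hasDerivAt_const z.1 z.2)
  have h2 : HasFDerivAt u (fderiv ℝ u z) ((fun t : ℝ => ((t, z.2) : ℝ × ℝ)) z.1) := h.hasFDerivAt
  exact (h2.comp_hasDerivAt z.1 h1).deriv

lemma pd2_eq {u : ℝ × ℝ → ℝ} {z : ℝ × ℝ} (h : DifferentiableAt ℝ u z) :
    pd2 u z = fderiv ℝ u z (0, 1) := by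
  have h1 : HasDerivAt (fun t : ℝ => ((z.1, t) : ℝ × ℝ)) (0, 1) z.2 :=
    (hasDerivAt_const z.2 z.1).prodMk (hasDerivAt_id z.2)
  have h2 : HasFDerivAt u (fderiv ℝ u z) ((fun t : ℝ => ((z.1, t) : ℝ × ℝ)) z.2) := h.hasFDerivAt
  exact (h2.comp_hasDerivAt z.2 h1).deriv

lemma clm_prod_apply (L : ℝ × ℝ →L[ℝ] ℝ) (v : ℝ × ℝ) :
    L v = L (1, 0) * v.1 + L (0, 1) * v.2 := by
  have : v = v.1 • ((1, 0) : ℝ × ℝ) + v.2 • ((0, 1) : ℝ × ℝ) := by ext <;> simp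
  conv_lhs => rw [this]
  rw [map_add, map_smul, map_smul]
  simp only [smul_eq_mul]; ring

lemma fderiv_eq_pd {u : ℝ × ℝ → ℝ} {z : ℝ × ℝ} (h : DifferentiableAt ℝ u z) (v : ℝ × ℝ) :
    fderiv ℝ u z v = pd1 u z * v.1 + pd2 u z * v.2 := by
  rw [pd1_eq h, pd2_eq h]; exact clm_prod_apply _ _

lemma pd1_eventuallyEq {u : ℝ × ℝ → ℝ} {z : ℝ × ℝ} (h : ContDiffAt ℝ 1 u z) :
    pd1 u =ᶠ[𝓝 z] fun w => fderiv ℝ u w (1, 0) := by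
  filter_upwards [h.eventually (by simp)] with w hw
  exact pd1_eq (hw.differentiableAt (by simp))

lemma pd2_eventuallyEq {u : ℝ × ℝ → ℝ} {z : ℝ × ℝ} (h : ContDiffAt ℝ 1 u z) :
    pd2 u =ᶠ[𝓝 z] fun w => fderiv ℝ u w (0, 1) := by
  filter_upwards [h.eventually (by simp)] with w hw
  exact pd2_eq (hw.differentiableAt (by simp))

lemma contDiffAt_pd1 {u : ℝ × ℝ → ℝ} {z : ℝ × ℝ} (h : ContDiffAt ℝ 2 u z) :
    ContDiffAt ℝ 1 (pd1 u) z := by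
  have h1 : ContDiffAt ℝ 1 (fderiv ℝ u) z := h.fderiv_right (by norm_num)
  exact (h1.clm_apply contDiffAt_const).congr_of_eventuallyEq
    (pd1_eventuallyEq (h.of_le (by norm_num)))

lemma contDiffAt_pd2 {u : ℝ × ℝ → ℝ} {z : ℝ × ℝ} (h : ContDiffAt ℝ 2 u z) :
    ContDiffAt ℝ 1 (pd2 u) z := by
  have h1 : ContDiffAt ℝ 1 (fderiv ℝ u) z := h.fderiv_right (by norm_num)
  exact (h1.clm_apply contDiffAt_const).congr_of_eventuallyEq
    (pd2_eventuallyEq (h.of_le (by norm_num)))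

lemma pd_symm {u : ℝ × ℝ → ℝ} {z : ℝ × ℝ} (h : ContDiffAt ℝ 2 u z) :
    pd1 (pd2 u) z = pd2 (pd1 u) z := by
  have hs : IsSymmSndFDerivAt ℝ u z := h.isSymmSndFDerivAt (by simp)
  have h1 : DifferentiableAt ℝ (fderiv ℝ u) z :=
    (h.fderiv_right (m := 1) (by norm_num)).differentiableAt (by simp)
  rw [pd1_eq ((contDiffAt_pd2 h).differentiableAt (by simp)),
    pd2_eq ((contDiffAt_pd1 h).differentiableAt (by simp)),
    (pd1_eventuallyEq (h.of_le (by norm_num))).fderiv_eq,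
    (pd2_eventuallyEq (h.of_le (by norm_num))).fderiv_eq]
  have e1 := fun v : ℝ × ℝ => (h1.hasFDerivAt.clm_apply (hasFDerivAt_const v z)).fderiv
  rw [e1, e1]
  simpa using hs (1, 0) (0, 1)

/-- the left-hand side of the minimal surfaces equation. -/
noncomputable def mseExpr (u : ℝ × ℝ → ℝ) (z : ℝ × ℝ) : ℝ :=
  (1 + pd2 u z ^ 2) * pd1 (pd1 u) z
      - 2 * pd1 u z * pd2 u z * pd2 (pd1 u) z
      + (1 + pd1 u z ^ 2) * pd2 (pd2 u) z

lemma pd1_congr {u v : ℝ × ℝ → ℝ} {z : ℝ × ℝ} (h : u =ᶠ[𝓝 z] v) : pd1 u =ᶠ[𝓝 z] pd1 v := by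
  filter_upwards [h.eventuallyEq_nhds] with w hw
  have hc : Tendsto (fun t : ℝ => ((t, w.2) : ℝ × ℝ)) (𝓝 w.1) (𝓝 w) :=
    Continuous.tendsto' (by fun_prop) _ _ rfl
  exact Filter.EventuallyEq.deriv_eq (hc.eventually hw)

lemma pd2_congr {u v : ℝ × ℝ → ℝ} {z : ℝ × ℝ} (h : u =ᶠ[𝓝 z] v) : pd2 u =ᶠ[𝓝 z] pd2 v := by
  filter_upwards [h.eventuallyEq_nhds] with w hw
  have hc : Tendsto (fun t : ℝ => ((w.1, t) : ℝ × ℝ)) (𝓝 w.2) (𝓝 w) :=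
    Continuous.tendsto' (by fun_prop) _ _ rfl
  exact Filter.EventuallyEq.deriv_eq (hc.eventually hw)

lemma mseExpr_congr {u v : ℝ × ℝ → ℝ} {z : ℝ × ℝ} (h : u =ᶠ[𝓝 z] v) :
    mseExpr u z = mseExpr v z := by
  unfold mseExpr
  rw [(pd1_congr h).eq_of_nhds, (pd2_congr h).eq_of_nhds,
    (pd1_congr (pd1_congr h)).eq_of_nhds, (pd2_congr (pd1_congr h)).eq_of_nhds,
    (pd2_congr (pd2_congr h)).eq_of_nhds]

lemma isMSE_iff {u : ℝ × ℝ → ℝ} {Ω : Set (ℝ × ℝ)} (ho : IsOpen Ω) :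
    IsMSE u Ω ↔ ∀ z ∈ Ω, ContDiffAt ℝ 2 u z ∧ mseExpr u z = 0 := by
  constructor
  · rintro ⟨h1, h2⟩ z hz
    exact ⟨h1.contDiffAt (ho.mem_nhds hz), h2 z hz⟩
  · intro h
    exact ⟨fun z hz => (h z hz).1.contDiffWithinAt, fun z hz => (h z hz).2⟩

lemma IsMSE.mono {u : ℝ × ℝ → ℝ} {Ω Ω' : Set (ℝ × ℝ)} (h : IsMSE u Ω) (hs : Ω' ⊆ Ω) :
    IsMSE u Ω' := ⟨h.1.mono hs, fun z hz => h.2 z (hs hz)⟩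

lemma IsMSE.congr {u v : ℝ × ℝ → ℝ} {Ω : Set (ℝ × ℝ)} (h : IsMSE u Ω) (ho : IsOpen Ω)
    (he : EqOn v u Ω) : IsMSE v Ω := by
  rw [isMSE_iff ho] at h ⊢
  intro z hz
  have : v =ᶠ[𝓝 z] u := he.eventuallyEq_of_mem (ho.mem_nhds hz)
  exact ⟨(h z hz).1.congr_of_eventuallyEq this, by rw [mseExpr_congr this]; exact (h z hz).2⟩

/-- A function is determined near a point by an invertible parametrization. -/
lemma exists_equiv_of_injective {E F : Type*} [NormedAddCommGroup E] [NormedSpace ℝ E]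
    [FiniteDimensional ℝ E]
    [NormedAddCommGroup F] [NormedSpace ℝ F] [FiniteDimensional ℝ F]
    (hr : Module.finrank ℝ E = Module.finrank ℝ F)
    (L : E →L[ℝ] F) (hi : ∀ v, L v = 0 → v = 0) :
    ∃ e : E ≃L[ℝ] F, (e : E →L[ℝ] F) = L := by
  have hinj : Function.Injective (L : E →ₗ[ℝ] F) := by
    rw [← LinearMap.ker_eq_bot, LinearMap.ker_eq_bot']
    exact hi
  refine ⟨(LinearEquiv.ofInjectiveOfFinrankEq (L : E →ₗ[ℝ] F) hinj hr).toContinuousLinearEquiv, ?_⟩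
  ext v
  simp [LinearEquiv.ofInjectiveOfFinrankEq]

lemma hasFDerivAt_re_of_hasDerivAt {A : ℂ → ℂ} {a ζ : ℂ} (h : HasDerivAt A a ζ) :
    HasFDerivAt (fun w => (A w).re) (Complex.reCLM.comp
      ((ContinuousLinearMap.toSpanSingleton ℂ a).restrictScalars ℝ)) ζ := by
  have := h.hasFDerivAt.restrictScalars ℝ
  exact Complex.reCLM.hasFDerivAt.comp ζ this

theorem mse_of_param {A B G : ℂ → ℂ} {ζ₀ : ℂ} {U : ℝ × ℝ → ℝ}
    (hA : AnalyticAt ℂ A ζ₀) (hB : AnalyticAt ℂ B ζ₀) (hG : AnalyticAt ℂ G ζ₀)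
    (hconf : deriv A ζ₀ ^ 2 + deriv B ζ₀ ^ 2 + deriv G ζ₀ ^ 2 = 0)
    (hJ : (starRingEnd ℂ (deriv A ζ₀) * deriv B ζ₀).im ≠ 0)
    (hU : ∀ᶠ ζ in 𝓝 ζ₀, U ((A ζ).re, (B ζ).re) = (G ζ).re) :
    ContDiffAt ℝ 2 U ((A ζ₀).re, (B ζ₀).re) ∧ mseExpr U ((A ζ₀).re, (B ζ₀).re) = 0 := by
  set P : ℂ → ℝ × ℝ := fun ζ => ((A ζ).re, (B ζ).re) with hP
  have cA : ContDiffAt ℝ 2 (fun ζ => (A ζ).re) ζ₀ :=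
    Complex.reCLM.contDiff.contDiffAt.comp ζ₀ (hA.contDiffAt.restrict_scalars ℝ)
  have cB : ContDiffAt ℝ 2 (fun ζ => (B ζ).re) ζ₀ :=
    Complex.reCLM.contDiff.contDiffAt.comp ζ₀ (hB.contDiffAt.restrict_scalars ℝ)
  have cG : ContDiffAt ℝ 2 (fun ζ => (G ζ).re) ζ₀ :=
    Complex.reCLM.contDiff.contDiffAt.comp ζ₀ (hG.contDiffAt.restrict_scalars ℝ)
  have cP : ContDiffAt ℝ 2 P ζ₀ := cA.prodMk cB
  have dP : ∀ ζ, DifferentiableAt ℂ A ζ → DifferentiableAt ℂ B ζ → HasFDerivAt P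
      ((Complex.reCLM.comp ((ContinuousLinearMap.toSpanSingleton ℂ (deriv A ζ)).restrictScalars ℝ)).prod
       (Complex.reCLM.comp ((ContinuousLinearMap.toSpanSingleton ℂ (deriv B ζ)).restrictScalars ℝ)))
      ζ := fun ζ h1 h2 => (hasFDerivAt_re_of_hasDerivAt h1.hasDerivAt).prodMk
        (hasFDerivAt_re_of_hasDerivAt h2.hasDerivAt)
  obtain ⟨e, he⟩ := exists_equiv_of_injective (by simp)
    ((Complex.reCLM.comp ((ContinuousLinearMap.toSpanSingleton ℂ (deriv A ζ₀)).restrictScalars ℝ)).prod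
     (Complex.reCLM.comp ((ContinuousLinearMap.toSpanSingleton ℂ (deriv B ζ₀)).restrictScalars ℝ)))
    (by
      intro v hv
      simp only [ContinuousLinearMap.prod_apply, Prod.mk_eq_zero] at hv
      obtain ⟨h1, h2⟩ := hv
      simp at h1 h2
      simp at hJ
      have e1 : v.re * ((deriv A ζ₀).re * (deriv B ζ₀).im + -((deriv A ζ₀).im * (deriv B ζ₀).re)) = 0 := by
        linear_combination (deriv B ζ₀).im * h1 - (deriv A ζ₀).im * h2
      have e2 : v.im * ((deriv A ζ₀).re * (deriv B ζ₀).im + -((deriv A ζ₀).im * (deriv B ζ₀).re)) = 0 := by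
        linear_combination (deriv B ζ₀).re * h1 - (deriv A ζ₀).re * h2
      apply Complex.ext
      · exact (mul_eq_zero.1 e1).resolve_right hJ
      · exact (mul_eq_zero.1 e2).resolve_right hJ)
  have hPe : HasFDerivAt P (e : ℂ →L[ℝ] ℝ × ℝ) ζ₀ := by
    rw [he]; exact dP ζ₀ hA.differentiableAt hB.differentiableAt
  have hst := cP.hasStrictFDerivAt' hPe (by simp)
  have hinv := cP.to_localInverse hPe (by simp)
  have hUeq : U =ᶠ[𝓝 (P ζ₀)] (fun ζ => (G ζ).re) ∘ (cP.localInverse hPe (by simp)) := by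
    have t : Tendsto (cP.localInverse hPe (by simp)) (𝓝 (P ζ₀)) (𝓝 ζ₀) := by
      have := hinv.continuousAt
      rwa [ContinuousAt, cP.localInverse_apply_image hPe (by simp)] at this
    filter_upwards [hst.eventually_right_inverse, t.eventually hU] with y hy1 hy2
    rw [Function.comp, ← hy2]
    exact congrArg U hy1.symm
  have cU : ContDiffAt ℝ 2 U (P ζ₀) := by
    refine ContDiffAt.congr_of_eventuallyEq ?_ hUeq
    refine ContDiffAt.comp _ ?_ hinv
    rw [cP.localInverse_apply_image hPe (by simp)]
    exact cG
  refine ⟨cU, ?_⟩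
  -- first order identity
  have hgrad : ∀ᶠ ζ in 𝓝 ζ₀, deriv G ζ = (pd1 U (P ζ) : ℂ) * deriv A ζ + (pd2 U (P ζ) : ℂ) * deriv B ζ := by
    have cU1 : ∀ᶠ ζ in 𝓝 ζ₀, ContDiffAt ℝ 2 U (P ζ) :=
      cP.continuousAt.tendsto.eventually (cU.eventually (by simp))
    filter_upwards [hU.eventually_nhds, cU1, hA.eventually_analyticAt, hB.eventually_analyticAt,
      hG.eventually_analyticAt] with ζ h1 h2 h3 h4 h5
    have d1 : HasFDerivAt (fun ζ => U (P ζ)) _ ζ :=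
      (h2.differentiableAt (by simp)).hasFDerivAt.comp ζ
        (dP ζ h3.differentiableAt h4.differentiableAt)
    have d2 := hasFDerivAt_re_of_hasDerivAt h5.differentiableAt.hasDerivAt
    have d3 := d1.unique (d2.congr_of_eventuallyEq h1)
    have key : ∀ v : ℂ, pd1 U (P ζ) * (v * deriv A ζ).re + pd2 U (P ζ) * (v * deriv B ζ).re
        = (v * deriv G ζ).re := by
      intro v
      have := congrArg (fun L => L v) d3
      simp only [ContinuousLinearMap.comp_apply] at this
      rw [fderiv_eq_pd (h2.differentiableAt (by simp))] at this
      simpa using this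
    have k1 := key 1
    have k2 := key Complex.I
    simp at k1 k2
    apply Complex.ext
    · simp; linarith
    · simp; linarith
  have hg0 := hgrad.self_of_nhds
  -- second order identity
  have dp : HasFDerivAt (fun ζ => pd1 U (P ζ)) _ ζ₀ :=
    ((contDiffAt_pd1 cU).differentiableAt (by simp)).hasFDerivAt.comp ζ₀
      (dP ζ₀ hA.differentiableAt hB.differentiableAt)
  have dq : HasFDerivAt (fun ζ => pd2 U (P ζ)) _ ζ₀ :=
    ((contDiffAt_pd2 cU).differentiableAt (by simp)).hasFDerivAt.comp ζ₀
      (dP ζ₀ hA.differentiableAt hB.differentiableAt)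
  have dA := hA.deriv.differentiableAt.hasDerivAt.hasFDerivAt.restrictScalars ℝ
  have dB := hB.deriv.differentiableAt.hasDerivAt.hasFDerivAt.restrictScalars ℝ
  have dG := hG.deriv.differentiableAt.hasDerivAt.hasFDerivAt.restrictScalars ℝ
  have dpc : HasFDerivAt (fun ζ => (pd1 U (P ζ) : ℂ)) _ ζ₀ := Complex.ofRealCLM.hasFDerivAt.comp ζ₀ dp
  have dqc : HasFDerivAt (fun ζ => (pd2 U (P ζ) : ℂ)) _ ζ₀ := Complex.ofRealCLM.hasFDerivAt.comp ζ₀ dq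
  have dR := ((dpc.mul dA).add (dqc.mul dB)).unique (dG.congr_of_eventuallyEq
    (by filter_upwards [hgrad] with ζ hζ; exact hζ.symm))
  have s1 := congrArg (fun L => L 1) dR
  have s2 := congrArg (fun L => L Complex.I) dR
  simp [fderiv_eq_pd ((contDiffAt_pd1 cU).differentiableAt (by simp)),
    fderiv_eq_pd ((contDiffAt_pd2 cU).differentiableAt (by simp))] at s1 s2
  rw [pd_symm cU] at s1 s2
  change mseExpr U (P ζ₀) = 0
  unfold mseExpr
  generalize pd1 (pd1 U) (P ζ₀) = r at *
  generalize pd2 (pd1 U) (P ζ₀) = s at *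
  generalize pd2 (pd2 U) (P ζ₀) = t at *
  generalize pd1 U (P ζ₀) = p at *
  generalize pd2 U (P ζ₀) = q at *
  rw [hg0] at hconf
  generalize deriv A ζ₀ = a at *
  generalize deriv B ζ₀ = b at *
  have hlin : r * (a.re ^ 2 + a.im ^ 2) + 2 * s * (a.re * b.re + a.im * b.im)
      + t * (b.re ^ 2 + b.im ^ 2) = 0 := by
    have := congrArg₂ (fun x y => x + Complex.I * y) s1 s2
    have h3 := congrArg Complex.re this
    simp at h3
    linarith
  have q1 := congrArg Complex.re hconf
  have q2 := congrArg Complex.im hconf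
  simp [pow_two] at q1 q2
  simp at hJ
  set j := a.re * b.im + -(a.im * b.re) with hj
  have hj2 : j ^ 2 ≠ 0 := pow_ne_zero 2 hJ
  have c1 : j * ((1 + p ^ 2) * (a.re * b.re + a.im * b.im)
      + p * q * (b.re ^ 2 + b.im ^ 2)) = 0 := by
    rw [hj]
    linear_combination (b.re * b.im) * q1 - (b.re ^ 2 - b.im ^ 2) / 2 * q2
  have c2 : j * ((1 + p ^ 2) * (a.re ^ 2 + a.im ^ 2)
      - (1 + q ^ 2) * (b.re ^ 2 + b.im ^ 2)) = 0 := by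
    rw [hj]
    linear_combination (a.re * b.im + a.im * b.re) * q1 - (a.re * b.re - a.im * b.im) * q2
  have c1' := (mul_eq_zero.1 c1).resolve_left hJ
  have c2' := (mul_eq_zero.1 c2).resolve_left hJ
  have hb : b.re ^ 2 + b.im ^ 2 ≠ 0 := by
    intro h0
    have h1 : b.re = 0 := by nlinarith [sq_nonneg b.re, sq_nonneg b.im]
    have h2 : b.im = 0 := by nlinarith [sq_nonneg b.re, sq_nonneg b.im]
    apply hJ; rw [hj, h1, h2]; ring
  have : (b.re ^ 2 + b.im ^ 2) * ((1 + q ^ 2) * r - 2 * p * q * s + (1 + p ^ 2) * t) = 0 := by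
    linear_combination (1 + p ^ 2) * hlin - r * c2' - 2 * s * c1'
  exact (mul_eq_zero.1 this).resolve_left hb

/-! ### The plane as `ℂ` -/

/-- identification of the plane with `ℂ`. -/
noncomputable def toC (z : ℝ × ℝ) : ℂ := ⟨z.1, z.2⟩

/-- identification of `ℂ` with the plane. -/
def toR (z : ℂ) : ℝ × ℝ := (z.re, z.im)

@[simp] lemma toC_re (z : ℝ × ℝ) : (toC z).re = z.1 := rfl
@[simp] lemma toC_im (z : ℝ × ℝ) : (toC z).im = z.2 := rfl
@[simp] lemma toR_fst (z : ℂ) : (toR z).1 = z.re := rfl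
@[simp] lemma toR_snd (z : ℂ) : (toR z).2 = z.im := rfl
@[simp] lemma toC_toR (z : ℂ) : toC (toR z) = z := by apply Complex.ext <;> simp
@[simp] lemma toR_toC (z : ℝ × ℝ) : toR (toC z) = z := by ext <;> simp
lemma toC_sub (z w : ℝ × ℝ) : toC (z - w) = toC z - toC w := by apply Complex.ext <;> simp
lemma toC_add (z w : ℝ × ℝ) : toC (z + w) = toC z + toC w := by apply Complex.ext <;> simp
lemma toC_smul (c : ℝ) (z : ℝ × ℝ) : toC (c • z) = c • toC z := by apply Complex.ext <;> simp
lemma continuous_toC : Continuous toC := Complex.equivRealProdCLM.symm.continuous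
lemma continuous_toR : Continuous toR := Complex.equivRealProdCLM.continuous

lemma len_eq (v : ℝ × ℝ) : len v = ‖toC v‖ := by
  rw [len, Complex.norm_def, Complex.normSq_apply]; simp [pow_two]

lemma len_toR (v : ℂ) : len (toR v) = ‖v‖ := by rw [len_eq, toC_toR]

lemma mem_eball {z P : ℝ × ℝ} {ρ : ℝ} : z ∈ eball P ρ ↔ ‖toC z - toC P‖ < ρ := by
  rw [eball, mem_ofPred_eq, len_eq, toC_sub]

lemma eball_eq (P : ℝ × ℝ) (ρ : ℝ) : eball P ρ = toC ⁻¹' Metric.ball (toC P) ρ := by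
  ext z; rw [mem_eball, mem_preimage, Metric.mem_ball, dist_eq_norm]

lemma isOpen_eball (P : ℝ × ℝ) (ρ : ℝ) : IsOpen (eball P ρ) := by
  rw [eball_eq]; exact Metric.isOpen_ball.preimage continuous_toC

lemma mem_eball_self {P : ℝ × ℝ} {ρ : ℝ} (h : 0 < ρ) : P ∈ eball P ρ := by
  rw [mem_eball]; simpa using h

lemma convex_edisk (P : ℝ × ℝ) (ρ : ℝ) : Convex ℝ (eball P ρ) := by
  rw [eball_eq]
  exact (convex_ball (toC P) ρ).is_linear_preimage
    (f := toC) ⟨toC_add, toC_smul⟩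

lemma eball_mono {P : ℝ × ℝ} {ρ ρ' : ℝ} (h : ρ ≤ ρ') : eball P ρ ⊆ eball P ρ' :=
  fun _ hz => lt_of_lt_of_le hz h

lemma eball_subset {P Q : ℝ × ℝ} {ρ ρ' : ℝ} (h : ‖toC P - toC Q‖ + ρ ≤ ρ') :
    eball P ρ ⊆ eball Q ρ' := by
  intro z hz
  rw [mem_eball] at *
  calc ‖toC z - toC Q‖ = ‖(toC z - toC P) + (toC P - toC Q)‖ := by congr 1; ring
    _ ≤ _ := norm_add_le _ _
    _ < ρ' := by linarith

lemma exists_eball_subset {Ω : Set (ℝ × ℝ)} {z : ℝ × ℝ} (h : Ω ∈ 𝓝 z) :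
    ∃ ρ > 0, eball z ρ ⊆ Ω := by
  have h1 : toR ⁻¹' Ω ∈ 𝓝 (toC z) := by
    apply continuous_toR.continuousAt.preimage_mem_nhds; rwa [toR_toC]
  obtain ⟨ρ, h0, hρ⟩ := Metric.mem_nhds_iff.1 h1
  refine ⟨ρ, h0, fun w hw => ?_⟩
  rw [eball_eq] at hw
  have := hρ hw
  simpa using this

/-! ### Primitives of closed forms -/

lemma exists_primitive {D : Set (ℝ × ℝ)} (hD : IsOpen D) (hc : Convex ℝ D) {a b : ℝ × ℝ → ℝ}
    (ha : ∀ z ∈ D, DifferentiableAt ℝ a z) (hb : ∀ z ∈ D, DifferentiableAt ℝ b z)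
    (hab : ∀ z ∈ D, pd2 a z = pd1 b z) :
    ∃ f : ℝ × ℝ → ℝ, ∀ z ∈ D, HasFDerivAt f
      (a z • ContinuousLinearMap.fst ℝ ℝ ℝ + b z • ContinuousLinearMap.snd ℝ ℝ ℝ) z := by
  have hd : ∀ z ∈ D, HasFDerivAt (fun z => a z • ContinuousLinearMap.fst ℝ ℝ ℝ
      + b z • ContinuousLinearMap.snd ℝ ℝ ℝ) _ z := fun z hz =>
    (((ha z hz).hasFDerivAt).smul_const (ContinuousLinearMap.fst ℝ ℝ ℝ)).add
    (((hb z hz).hasFDerivAt).smul_const (ContinuousLinearMap.snd ℝ ℝ ℝ))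
  apply hc.exists_forall_hasFDerivAt_of_fderiv_symmetric hD
  · exact fun z hz => (hd z hz).differentiableAt.differentiableWithinAt
  · intro z hz x y
    rw [(hd z hz).fderiv]
    simp [fderiv_eq_pd (ha z hz), fderiv_eq_pd (hb z hz), hab z hz]
    ring

lemma hasDerivAt_of_real {f : ℂ → ℂ} {L : ℂ →L[ℝ] ℂ} {ζ c : ℂ} (h : HasFDerivAt f L ζ)
    (hL : ∀ v, L v = c * v) : HasDerivAt f c ζ := by
  have := hasFDerivAt_of_restrictScalars ℝ h
    (f' := ContinuousLinearMap.toSpanSingleton ℂ c) (by ext; simp [hL, mul_comm])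
  exact this

lemma hasDerivAt_pd1 {u : ℝ × ℝ → ℝ} {z : ℝ × ℝ} (h : DifferentiableAt ℝ u z) :
    HasDerivAt (fun t => u (t, z.2)) (pd1 u z) z.1 := by
  have h1 : HasDerivAt (fun t : ℝ => ((t, z.2) : ℝ × ℝ)) (1, 0) z.1 :=
    (hasDerivAt_id z.1).prodMk (hasDerivAt_const z.1 z.2)
  have h2 : HasFDerivAt u (fderiv ℝ u z) ((fun t : ℝ => ((t, z.2) : ℝ × ℝ)) z.1) := h.hasFDerivAt
  exact (h2.comp_hasDerivAt z.1 h1).differentiableAt.hasDerivAt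

lemma hasDerivAt_pd2 {u : ℝ × ℝ → ℝ} {z : ℝ × ℝ} (h : DifferentiableAt ℝ u z) :
    HasDerivAt (fun t => u (z.1, t)) (pd2 u z) z.2 := by
  have h1 : HasDerivAt (fun t : ℝ => ((z.1, t) : ℝ × ℝ)) (0, 1) z.2 :=
    (hasDerivAt_const z.2 z.1).prodMk (hasDerivAt_id z.2)
  have h2 : HasFDerivAt u (fderiv ℝ u z) ((fun t : ℝ => ((z.1, t) : ℝ × ℝ)) z.2) := h.hasFDerivAt
  exact (h2.comp_hasDerivAt z.2 h1).differentiableAt.hasDerivAt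

lemma Wg_sq (u : ℝ × ℝ → ℝ) (z : ℝ × ℝ) : Wg u z ^ 2 = 1 + pd1 u z ^ 2 + pd2 u z ^ 2 :=
  Real.sq_sqrt (by positivity)

lemma one_le_Wg (u : ℝ × ℝ → ℝ) (z : ℝ × ℝ) : 1 ≤ Wg u z := by
  rw [Wg]; apply Real.one_le_sqrt.2; nlinarith [sq_nonneg (pd1 u z), sq_nonneg (pd2 u z)]

lemma contDiffAt_Wg {u : ℝ × ℝ → ℝ} {z : ℝ × ℝ} (h : ContDiffAt ℝ 2 u z) :
    ContDiffAt ℝ 1 (Wg u) z := by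
  have h1 := contDiffAt_pd1 h
  have h2 := contDiffAt_pd2 h
  unfold Wg
  refine ContDiffAt.sqrt (by fun_prop) (by positivity)

section
variable {u : ℝ × ℝ → ℝ} {z : ℝ × ℝ}

lemma hasDerivAt_Wg1 (h : ContDiffAt ℝ 2 u z) : HasDerivAt (fun t => Wg u (t, z.2))
    ((pd1 u z * pd1 (pd1 u) z + pd2 u z * pd2 (pd1 u) z) / Wg u z) z.1 := by
  have h1 := hasDerivAt_pd1 ((contDiffAt_pd1 h).differentiableAt (by simp))
  have h2 := hasDerivAt_pd1 ((contDiffAt_pd2 h).differentiableAt (by simp))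
  rw [pd_symm h] at h2
  have h3 := (((h1.pow 2).const_add 1).add (h2.pow 2)).sqrt (by simp; positivity)
  refine h3.congr_deriv ?_
  have := one_le_Wg u z
  have e : Wg u z = √(1 + pd1 u z ^ 2 + pd2 u z ^ 2) := rfl
  simp
  rw [← e]; field_simp

lemma hasDerivAt_Wg2 (h : ContDiffAt ℝ 2 u z) : HasDerivAt (fun t => Wg u (z.1, t))
    ((pd1 u z * pd2 (pd1 u) z + pd2 u z * pd2 (pd2 u) z) / Wg u z) z.2 := by
  have h1 := hasDerivAt_pd2 ((contDiffAt_pd1 h).differentiableAt (by simp))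
  have h2 := hasDerivAt_pd2 ((contDiffAt_pd2 h).differentiableAt (by simp))
  have h3 := (((h1.pow 2).const_add 1).add (h2.pow 2)).sqrt (by simp; positivity)
  refine h3.congr_deriv ?_
  have := one_le_Wg u z
  have e : Wg u z = √(1 + pd1 u z ^ 2 + pd2 u z ^ 2) := rfl
  simp
  rw [← e]; field_simp

lemma closed_form1 (h : ContDiffAt ℝ 2 u z) (hm : mseExpr u z = 0) :
    pd2 (fun z => (1 + pd1 u z ^ 2) / Wg u z) z = pd1 (fun z => pd1 u z * pd2 u z / Wg u z) z := by
  have W1 := one_le_Wg u z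
  have W0 : Wg u z ≠ 0 := by positivity
  have hp1 := hasDerivAt_pd1 ((contDiffAt_pd1 h).differentiableAt (by simp))
  have hq1 := hasDerivAt_pd1 ((contDiffAt_pd2 h).differentiableAt (by simp))
  have hp2 := hasDerivAt_pd2 ((contDiffAt_pd1 h).differentiableAt (by simp))
  rw [pd_symm h] at hq1
  have e1 := (((hp2.pow 2).const_add 1).div (hasDerivAt_Wg2 h) W0).deriv
  have e2 := ((hp1.mul hq1).div (hasDerivAt_Wg1 h) W0).deriv
  refine (e1.trans ?_).trans e2.symm
  unfold mseExpr at hm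
  have := Wg_sq u z
  simp
  field_simp
  rw [this]
  linear_combination (-pd2 u z) * hm

lemma closed_form2 (h : ContDiffAt ℝ 2 u z) (hm : mseExpr u z = 0) :
    pd2 (fun z => pd1 u z * pd2 u z / Wg u z) z = pd1 (fun z => (1 + pd2 u z ^ 2) / Wg u z) z := by
  have W1 := one_le_Wg u z
  have W0 : Wg u z ≠ 0 := by positivity
  have hq1 := hasDerivAt_pd1 ((contDiffAt_pd2 h).differentiableAt (by simp))
  have hp2 := hasDerivAt_pd2 ((contDiffAt_pd1 h).differentiableAt (by simp))
  have hq2 := hasDerivAt_pd2 ((contDiffAt_pd2 h).differentiableAt (by simp))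
  rw [pd_symm h] at hq1
  have e1 := ((hp2.mul hq2).div (hasDerivAt_Wg2 h) W0).deriv
  have e2 := (((hq1.pow 2).const_add 1).div (hasDerivAt_Wg1 h) W0).deriv
  refine (e1.trans ?_).trans e2.symm
  unfold mseExpr at hm
  have := Wg_sq u z
  simp
  field_simp
  rw [this]
  linear_combination (pd1 u z) * hm

lemma div_form (h : ContDiffAt ℝ 2 u z) :
    pd1 (fun z => pd1 u z / Wg u z) z + pd2 (fun z => pd2 u z / Wg u z) z
      = mseExpr u z / Wg u z ^ 3 := by
  have W1 := one_le_Wg u z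
  have W0 : Wg u z ≠ 0 := by positivity
  have hp1 := hasDerivAt_pd1 ((contDiffAt_pd1 h).differentiableAt (by simp))
  have hq2 := hasDerivAt_pd2 ((contDiffAt_pd2 h).differentiableAt (by simp))
  have e1 := (hp1.div (hasDerivAt_Wg1 h) W0).deriv
  have e2 := (hq2.div (hasDerivAt_Wg2 h) W0).deriv
  have e3 : pd1 (fun z => pd1 u z / Wg u z) z = _ := e1
  have e4 : pd2 (fun z => pd2 u z / Wg u z) z = _ := e2
  rw [e3, e4]
  unfold mseExpr
  have := Wg_sq u z
  simp
  field_simp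
  rw [this]
  ring

lemma closed_form3 (h : ContDiffAt ℝ 2 u z) (hm : mseExpr u z = 0) :
    pd2 (fun z => -(pd2 u z / Wg u z)) z = pd1 (fun z => pd1 u z / Wg u z) z := by
  have := div_form h
  rw [hm, zero_div] at this
  have e : pd2 (fun z => -(pd2 u z / Wg u z)) z = - pd2 (fun z => (pd2 u z / Wg u z)) z := by
    unfold pd2; rw [← deriv.fun_neg]
  rw [e]; linarith

end

/-! ### The Jörgens map -/

/-- the complex gradient `(p - iq)/(1+W)`. -/
noncomputable def cgrad (u : ℝ × ℝ → ℝ) (z : ℝ × ℝ) : ℂ :=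
  ⟨pd1 u z / (1 + Wg u z), -pd2 u z / (1 + Wg u z)⟩

/-- the point with Jörgens parameter `ζ`. -/
noncomputable def jpt (z0 : ℝ × ℝ) (F : ℂ → ℂ) (ζ : ℂ) : ℝ × ℝ :=
  (z0.1 + ((ζ + F ζ) / 2).re, z0.2 + ((ζ - F ζ) / 2).im)

lemma jorgens_mono {D : Set (ℝ × ℝ)} (hc : Convex ℝ D) {u ξ η : ℝ × ℝ → ℝ}
    (hξ : ∀ z ∈ D, HasFDerivAt ξ (((1 + pd1 u z ^ 2) / Wg u z) • ContinuousLinearMap.fst ℝ ℝ ℝ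
      + (pd1 u z * pd2 u z / Wg u z) • ContinuousLinearMap.snd ℝ ℝ ℝ) z)
    (hη : ∀ z ∈ D, HasFDerivAt η ((pd1 u z * pd2 u z / Wg u z) • ContinuousLinearMap.fst ℝ ℝ ℝ
      + ((1 + pd2 u z ^ 2) / Wg u z) • ContinuousLinearMap.snd ℝ ℝ ℝ) z)
    {z w : ℝ × ℝ} (hz : z ∈ D) (hw : w ∈ D) :
    0 ≤ (ξ z - ξ w) * (z.1 - w.1) + (η z - η w) * (z.2 - w.2) := by
  set d := z - w with hd
  have hseg : ∀ τ ∈ Icc (0:ℝ) 1, w + τ • d ∈ D := by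
    intro τ hτ
    have := hc hw hz (a := 1 - τ) (b := τ) (by linarith [hτ.2]) hτ.1 (by ring)
    convert this using 1
    rw [hd]; module
  have hder : ∀ τ ∈ Icc (0:ℝ) 1, HasDerivAt (fun τ : ℝ => ξ (w + τ • d) * d.1 + η (w + τ • d) * d.2)
      (((1 + pd1 u (w + τ • d) ^ 2) * d.1 ^ 2 + 2 * (pd1 u (w + τ • d) * pd2 u (w + τ • d)) * d.1 * d.2
        + (1 + pd2 u (w + τ • d) ^ 2) * d.2 ^ 2) / Wg u (w + τ • d)) τ := by
    intro τ hτ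
    have hl : HasDerivAt (fun τ : ℝ => w + τ • d) d τ := by
      simpa using ((hasDerivAt_id τ).smul_const d).const_add w
    have h1 := ((hξ _ (hseg τ hτ)).comp_hasDerivAt τ hl).mul_const d.1
    have h2 := ((hη _ (hseg τ hτ)).comp_hasDerivAt τ hl).mul_const d.2
    refine (h1.add h2).congr_deriv ?_
    have := one_le_Wg u (w + τ • d)
    simp
    field_simp
    ring
  have hm : MonotoneOn (fun τ : ℝ => ξ (w + τ • d) * d.1 + η (w + τ • d) * d.2) (Icc 0 1) := by
    apply monotoneOn_of_deriv_nonneg (convex_Icc 0 1)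
    · exact fun τ hτ => (hder τ hτ).continuousAt.continuousWithinAt
    · rw [interior_Icc]
      exact fun τ hτ => (hder τ ⟨hτ.1.le, hτ.2.le⟩).differentiableAt.differentiableWithinAt
    · rw [interior_Icc]
      intro τ hτ
      rw [(hder τ ⟨hτ.1.le, hτ.2.le⟩).deriv]
      have := one_le_Wg u (w + τ • d)
      apply div_nonneg _ (by linarith)
      nlinarith [sq_nonneg (pd1 u (w + τ • d) * d.1 + pd2 u (w + τ • d) * d.2), sq_nonneg d.1,
        sq_nonneg d.2]
  have := hm (left_mem_Icc.2 zero_le_one) (right_mem_Icc.2 zero_le_one) zero_le_one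
  simp [hd] at this
  linarith

theorem jorgens {u : ℝ × ℝ → ℝ} {z0 : ℝ × ℝ} {R : ℝ} (hR : 0 < R) (hu : IsMSE u (eball z0 R)) :
    ∃ F G : ℂ → ℂ, F 0 = 0 ∧ ∀ ζ ∈ Metric.ball (0:ℂ) R,
      jpt z0 F ζ ∈ eball z0 R ∧ u (jpt z0 F ζ) = (G ζ).re ∧
      HasDerivAt F (-(cgrad u (jpt z0 F ζ)) ^ 2) ζ ∧ HasDerivAt G (cgrad u (jpt z0 F ζ)) ζ := by
  have ho := isOpen_eball z0 R
  have hcv := convex_edisk z0 R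
  set D := eball z0 R with hD
  rw [isMSE_iff ho] at hu
  have cp : ∀ z ∈ D, ContDiffAt ℝ 1 (pd1 u) z := fun z hz => contDiffAt_pd1 (hu z hz).1
  have cq : ∀ z ∈ D, ContDiffAt ℝ 1 (pd2 u) z := fun z hz => contDiffAt_pd2 (hu z hz).1
  have cW : ∀ z ∈ D, ContDiffAt ℝ 1 (Wg u) z := fun z hz => contDiffAt_Wg (hu z hz).1
  have W0 : ∀ z, Wg u z ≠ 0 := fun z => by have := one_le_Wg u z; positivity
  obtain ⟨ξ, hξ⟩ := exists_primitive ho hcv (a := fun z => (1 + pd1 u z ^ 2) / Wg u z)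
    (b := fun z => pd1 u z * pd2 u z / Wg u z)
    (fun z hz => ((contDiffAt_const.add ((cp z hz).pow 2)).div (cW z hz) (W0 z)).differentiableAt (by simp))
    (fun z hz => (((cp z hz).mul (cq z hz)).div (cW z hz) (W0 z)).differentiableAt (by simp))
    (fun z hz => closed_form1 (hu z hz).1 (hu z hz).2)
  obtain ⟨η, hη⟩ := exists_primitive ho hcv (b := fun z => (1 + pd2 u z ^ 2) / Wg u z)
    (a := fun z => pd1 u z * pd2 u z / Wg u z)
    (fun z hz => (((cp z hz).mul (cq z hz)).div (cW z hz) (W0 z)).differentiableAt (by simp))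
    (fun z hz => ((contDiffAt_const.add ((cq z hz).pow 2)).div (cW z hz) (W0 z)).differentiableAt (by simp))
    (fun z hz => closed_form2 (hu z hz).1 (hu z hz).2)
  obtain ⟨θ, hθ⟩ := exists_primitive ho hcv (b := fun z => pd1 u z / Wg u z)
    (a := fun z => -(pd2 u z / Wg u z))
    (fun z hz => (((cq z hz).div (cW z hz) (W0 z)).neg).differentiableAt (by simp))
    (fun z hz => ((cp z hz).div (cW z hz) (W0 z)).differentiableAt (by simp))
    (fun z hz => closed_form3 (hu z hz).1 (hu z hz).2)
  set Φ : ℝ × ℝ → ℂ := fun z => ((z.1 - z0.1 + (ξ z - ξ z0) : ℝ) : ℂ)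
    + ((z.2 - z0.2 + (η z - η z0) : ℝ) : ℂ) * Complex.I with hΦ
  have Φre : ∀ z, (Φ z).re = z.1 - z0.1 + (ξ z - ξ z0) := fun z => by simp [hΦ]
  have Φim : ∀ z, (Φ z).im = z.2 - z0.2 + (η z - η z0) := fun z => by simp [hΦ]
  -- expanding
  have hexp : ∀ z ∈ D, ∀ w ∈ D, ‖toC z - toC w‖ ≤ ‖Φ z - Φ w‖ := by
    intro z hz w hw
    have h1 := jorgens_mono hcv hξ hη hz hw
    have h2 : ‖toC z - toC w‖ ^ 2 ≤ ‖Φ z - Φ w‖ ^ 2 := by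
      rw [← Complex.normSq_eq_norm_sq, ← Complex.normSq_eq_norm_sq, Complex.normSq_apply,
        Complex.normSq_apply]
      simp only [Complex.sub_re, Complex.sub_im, Φre, Φim, toC_re, toC_im]
      nlinarith [sq_nonneg (ξ z - ξ w), sq_nonneg (η z - η w)]
    exact (pow_le_pow_iff_left₀ (norm_nonneg _) (norm_nonneg _) two_ne_zero).1 h2
  set Lf : ℝ × ℝ → (ℝ × ℝ →L[ℝ] ℂ) := fun z =>
    Complex.ofRealCLM.comp (ContinuousLinearMap.fst ℝ ℝ ℝ +
      (((1 + pd1 u z ^ 2) / Wg u z) • ContinuousLinearMap.fst ℝ ℝ ℝ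
      + (pd1 u z * pd2 u z / Wg u z) • ContinuousLinearMap.snd ℝ ℝ ℝ))
    + Complex.I • Complex.ofRealCLM.comp (ContinuousLinearMap.snd ℝ ℝ ℝ +
      ((pd1 u z * pd2 u z / Wg u z) • ContinuousLinearMap.fst ℝ ℝ ℝ
      + ((1 + pd2 u z ^ 2) / Wg u z) • ContinuousLinearMap.snd ℝ ℝ ℝ)) with hLf
  have hLv : ∀ z v, (Lf z v).re
        = v.1 + ((1 + pd1 u z ^ 2) * v.1 + pd1 u z * pd2 u z * v.2) / Wg u z ∧
      (Lf z v).im = v.2 + (pd1 u z * pd2 u z * v.1 + (1 + pd2 u z ^ 2) * v.2) / Wg u z := by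
    intro z v
    have e0 : Lf z v = ((v.1 + ((1 + pd1 u z ^ 2) / Wg u z * v.1 +
        pd1 u z * pd2 u z / Wg u z * v.2) : ℝ) : ℂ) + Complex.I * ((v.2 +
        (pd1 u z * pd2 u z / Wg u z * v.1 + (1 + pd2 u z ^ 2) / Wg u z * v.2) : ℝ) : ℂ) := rfl
    rw [e0]
    constructor
    · rw [Complex.add_re, Complex.ofReal_re, Complex.I_mul_re, Complex.ofReal_im]; ring
    · rw [Complex.add_im, Complex.ofReal_im, Complex.I_mul_im, Complex.ofReal_re]; ring
  have hLd : ∀ z ∈ D, HasFDerivAt Φ (Lf z) z := by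
    intro z hz
    have hA := Complex.ofRealCLM.hasFDerivAt.comp z
      ((hasFDerivAt_fst (𝕜 := ℝ) (p := z)).sub_const z0.1 |>.add ((hξ z hz).sub_const (ξ z0)))
    have hB := Complex.ofRealCLM.hasFDerivAt.comp z
      ((hasFDerivAt_snd (𝕜 := ℝ) (p := z)).sub_const z0.2 |>.add ((hη z hz).sub_const (η z0)))
    exact hA.add (hB.mul_const Complex.I)
  have dΦ : ∀ z ∈ D, ∃ e : (ℝ × ℝ) ≃L[ℝ] ℂ, HasStrictFDerivAt Φ (e : ℝ × ℝ →L[ℝ] ℂ) z ∧ ∀ v,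
      (e v).re = v.1 + ((1 + pd1 u z ^ 2) * v.1 + pd1 u z * pd2 u z * v.2) / Wg u z ∧
      (e v).im = v.2 + (pd1 u z * pd2 u z * v.1 + (1 + pd2 u z ^ 2) * v.2) / Wg u z := by
    intro z hz
    have hinj : ∀ v, Lf z v = 0 → v = 0 := by
      intro v hv
      obtain ⟨h1, h2⟩ := hLv z v
      rw [hv] at h1 h2
      simp only [Complex.zero_re, Complex.zero_im] at h1 h2
      have W1 := one_le_Wg u z
      have h3 : v.1 ^ 2 + v.2 ^ 2 + (v.1 ^ 2 + v.2 ^ 2 + (pd1 u z * v.1 + pd2 u z * v.2) ^ 2) / Wg u z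
          = 0 := by
        linear_combination (-v.1) * h1 - v.2 * h2
      have h4 : 0 ≤ (v.1 ^ 2 + v.2 ^ 2 + (pd1 u z * v.1 + pd2 u z * v.2) ^ 2) / Wg u z := by
        apply div_nonneg (by positivity) (by linarith)
      ext
      · simp; nlinarith [sq_nonneg v.1, sq_nonneg v.2]
      · simp; nlinarith [sq_nonneg v.1, sq_nonneg v.2]
    obtain ⟨e, he⟩ := exists_equiv_of_injective (by simp) (Lf z) hinj
    refine ⟨e, ?_, fun v => ?_⟩
    · rw [he]
      apply hasStrictFDerivAt_of_hasFDerivAt_of_continuousAt (f' := Lf)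
      · filter_upwards [ho.mem_nhds hz] with w hw using hLd w hw
      · have a1 := (cp z hz).continuousAt
        have a2 := (cq z hz).continuousAt
        have a3 := (cW z hz).continuousAt
        have a4 := W0 z
        have b1 : ContinuousAt (fun z => (1 + pd1 u z ^ 2) / Wg u z) z := by fun_prop (disch := exact a4)
        have b2 : ContinuousAt (fun z => pd1 u z * pd2 u z / Wg u z) z := by fun_prop (disch := exact a4)
        have b3 : ContinuousAt (fun z => (1 + pd2 u z ^ 2) / Wg u z) z := by fun_prop (disch := exact a4)
        rw [hLf]
        fun_prop
    · have : e v = Lf z v := by rw [← he]; rfl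
      rw [this]; exact hLv z v
  have Φz0 : Φ z0 = 0 := by simp [hΦ]
  have hz0 : z0 ∈ D := mem_eball_self hR
  -- image
  have himo : IsOpen (Φ '' D) := by
    rw [isOpen_iff_mem_nhds]
    rintro _ ⟨z, hz, rfl⟩
    obtain ⟨e, he, hev⟩ := dΦ z hz
    rw [← he.map_nhds_eq_of_equiv]
    exact image_mem_map (ho.mem_nhds hz)
  have him : Metric.ball (0:ℂ) R ⊆ Φ '' D := by
    apply (convex_ball (0:ℂ) R).isPreconnected.subset_of_closure_inter_subset himo
    · exact ⟨0, Metric.mem_ball_self hR, z0, hz0, Φz0⟩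
    · rintro ζ ⟨h1, h2⟩
      obtain ⟨x, hx1, hx2⟩ := mem_closure_iff_seq_limit.1 h1
      choose y hy1 hy2 using hx1
      have hcau : CauchySeq (fun n => toC (y n)) := by
        have := hx2.cauchySeq
        rw [Metric.cauchySeq_iff] at this ⊢
        intro ε hε
        obtain ⟨N, hN⟩ := this ε hε
        refine ⟨N, fun m hm n hn => ?_⟩
        rw [dist_eq_norm]
        refine (hexp _ (hy1 m) _ (hy1 n)).trans_lt ?_
        rw [hy2, hy2, ← dist_eq_norm]
        exact hN m hm n hn
      obtain ⟨l, hl⟩ := cauchySeq_tendsto_of_complete hcau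
      have hy : Tendsto y atTop (𝓝 (toR l)) := by
        have := (continuous_toR.tendsto l).comp hl
        simpa [Function.comp_def] using this
      have hlD : toR l ∈ D := by
        rw [mem_eball, toC_toR]
        have a1 : Tendsto (fun n => ‖toC (y n) - toC z0‖) atTop (𝓝 ‖l - toC z0‖) :=
          (hl.sub_const _).norm
        have a2 : Tendsto (fun n => ‖x n‖) atTop (𝓝 ‖ζ‖) := hx2.norm
        have := le_of_tendsto_of_tendsto' a1 a2 (fun n => by
          have := hexp _ (hy1 n) _ hz0
          rwa [hy2, Φz0, sub_zero] at this)
        rw [Metric.mem_ball, dist_zero_right] at h2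
        linarith
      refine ⟨toR l, hlD, ?_⟩
      obtain ⟨e, he, -⟩ := dΦ _ hlD
      have := he.continuousAt.tendsto.comp hy
      have h3 : (Φ ∘ y) = x := funext hy2
      rw [h3] at this
      exact tendsto_nhds_unique this hx2
  have him2 : ∀ ζ : ℂ, ζ ∈ Metric.ball (0:ℂ) R → ∃ z, z ∈ D ∧ Φ z = ζ := fun ζ hζ => him hζ
  choose! Ψ hΨ1 hΨ2 using him2
  have hΨc : ∀ ζ ∈ Metric.ball (0:ℂ) R, ContinuousAt Ψ ζ := by
    intro ζ hζ
    have h1 : ContinuousAt (fun ζ => toC (Ψ ζ)) ζ := by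
      rw [Metric.continuousAt_iff]
      intro ε hε
      obtain ⟨δ, hδ, hb⟩ := Metric.isOpen_iff.1 Metric.isOpen_ball ζ hζ
      refine ⟨min δ ε, lt_min hδ hε, fun {w} hw => ?_⟩
      have hw2 : w ∈ Metric.ball (0:ℂ) R := hb (lt_of_lt_of_le hw (min_le_left _ _))
      rw [dist_eq_norm]
      refine (hexp _ (hΨ1 _ hw2) _ (hΨ1 _ hζ)).trans_lt ?_
      rw [hΨ2 _ hw2, hΨ2 _ hζ, ← dist_eq_norm]
      exact lt_of_lt_of_le hw (min_le_right _ _)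
    have := continuous_toR.continuousAt.comp h1
    simpa [Function.comp_def] using this
  -- derivative of the inverse
  have dΨ : ∀ ζ ∈ Metric.ball (0:ℂ) R, ∃ L : ℂ →L[ℝ] ℝ × ℝ, HasFDerivAt Ψ L ζ ∧ ∀ v,
      (L v) = toR ((v - starRingEnd ℂ (cgrad u (Ψ ζ) ^ 2 * v)) / 2) := by
    intro ζ hζ
    obtain ⟨e, he, hev⟩ := dΦ _ (hΨ1 _ hζ)
    refine ⟨_, HasFDerivAt.of_local_left_inverse (hΨc ζ hζ) he.hasFDerivAt
      (by filter_upwards [Metric.isOpen_ball.mem_nhds hζ] with w hw using hΨ2 _ hw), fun v => ?_⟩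
    have W1 := one_le_Wg u (Ψ ζ)
    have W2 := Wg_sq u (Ψ ζ)
    have W3 : 1 + Wg u (Ψ ζ) ≠ 0 := by positivity
    have W4 := W0 (Ψ ζ)
    change e.symm v = _
    rw [ContinuousLinearEquiv.symm_apply_eq]
    apply Complex.ext
    · rw [(hev _).1]
      simp [cgrad, pow_two]
      generalize pd1 u (Ψ ζ) = p at *
      generalize pd2 u (Ψ ζ) = q at *
      generalize Wg u (Ψ ζ) = W at *
      field_simp
      grind
    · rw [(hev _).2]
      simp [cgrad, pow_two]
      generalize pd1 u (Ψ ζ) = p at *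
      generalize pd2 u (Ψ ζ) = q at *
      generalize Wg u (Ψ ζ) = W at *
      field_simp
      grind
  set F : ℂ → ℂ := fun ζ => starRingEnd ℂ (2 * (toC (Ψ ζ) - toC z0) - ζ) with hF
  have hjpt : ∀ ζ, jpt z0 F ζ = Ψ ζ := by
    intro ζ
    ext
    · simp [jpt, hF]
    · simp [jpt, hF]
      ring
  refine ⟨F, fun ζ => (u (Ψ ζ) : ℂ) + (θ (Ψ ζ) : ℂ) * Complex.I, ?_, fun ζ hζ => ?_⟩
  · have h0 : (0:ℂ) ∈ Metric.ball (0:ℂ) R := Metric.mem_ball_self hR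
    have := hexp _ (hΨ1 _ h0) _ hz0
    rw [hΨ2 _ h0, Φz0, sub_zero, norm_zero, norm_le_zero_iff] at this
    simp only [hF, this]
    simp
  obtain ⟨L, hL1, hL2⟩ := dΨ ζ hζ
  have W1 := one_le_Wg u (Ψ ζ)
  have W2 := Wg_sq u (Ψ ζ)
  have W3 : 1 + Wg u (Ψ ζ) ≠ 0 := by positivity
  have W4 := W0 (Ψ ζ)
  rw [hjpt]
  refine ⟨hΨ1 _ hζ, by simp, ?_, ?_⟩
  · have h1 : HasFDerivAt (fun ζ => toC (Ψ ζ)) _ ζ :=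
      (Complex.equivRealProdCLM.symm : ℝ × ℝ →L[ℝ] ℂ).hasFDerivAt.comp ζ hL1
    have h2 : HasFDerivAt F _ ζ := (Complex.conjCLE : ℂ →L[ℝ] ℂ).hasFDerivAt.comp ζ
      (((h1.sub_const (toC z0)).const_smul (2:ℝ)).sub (hasFDerivAt_id ζ)) |>.congr_of_eventuallyEq
      (Eventually.of_forall fun w => by simp [hF])
    refine hasDerivAt_of_real h2 fun v => ?_
    change starRingEnd ℂ ((2:ℝ) • toC (L v) - v) = _
    rw [hL2, toC_toR]
    have h4 : ((2:ℝ) • ((v - (starRingEnd ℂ) (cgrad u (Ψ ζ) ^ 2 * v)) / 2) - v)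
        = - (starRingEnd ℂ) (cgrad u (Ψ ζ) ^ 2 * v) := by
      rw [Complex.real_smul]; push_cast; ring
    rw [h4, map_neg, Complex.conj_conj]
    ring
  · have h1 := Complex.ofRealCLM.hasFDerivAt.comp ζ
      (((hu _ (hΨ1 _ hζ)).1.differentiableAt (by simp)).hasFDerivAt.comp ζ hL1)
    have h2 := Complex.ofRealCLM.hasFDerivAt.comp ζ ((hθ _ (hΨ1 _ hζ)).comp ζ hL1)
    have h3 := h1.add (h2.mul_const Complex.I)
    refine hasDerivAt_of_real h3 fun v => ?_
    have h5 : fderiv ℝ u (Ψ ζ) (L v) = pd1 u (Ψ ζ) * (L v).1 + pd2 u (Ψ ζ) * (L v).2 :=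
      fderiv_eq_pd ((hu _ (hΨ1 _ hζ)).1.differentiableAt (by simp)) _
    have l1 := congrArg Prod.fst (hL2 v)
    have l2 := congrArg Prod.snd (hL2 v)
    simp [cgrad, pow_two] at l1 l2
    change ((fderiv ℝ u (Ψ ζ) (L v) : ℝ) : ℂ) + Complex.I *
      ((-(pd2 u (Ψ ζ) / Wg u (Ψ ζ)) * (L v).1 + pd1 u (Ψ ζ) / Wg u (Ψ ζ) * (L v).2 : ℝ) : ℂ) = _
    rw [h5, l1, l2]
    unfold cgrad
    generalize pd1 u (Ψ ζ) = p at *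
    generalize pd2 u (Ψ ζ) = q at *
    generalize Wg u (Ψ ζ) = W at *
    apply Complex.ext
    · rw [Complex.add_re, Complex.ofReal_re, Complex.I_mul_re, Complex.ofReal_im, Complex.mul_re]
      field_simp
      grind
    · rw [Complex.add_im, Complex.ofReal_im, Complex.I_mul_im, Complex.ofReal_re, Complex.mul_im]
      field_simp
      grind

/-! ### Interior gradient bound -/

lemma norm_cgrad_lt (u : ℝ × ℝ → ℝ) (z : ℝ × ℝ) : ‖cgrad u z‖ < 1 := by
  have W1 := one_le_Wg u z
  have W2 := Wg_sq u z
  rw [← sq_lt_one_iff₀ (norm_nonneg _), ← Complex.normSq_eq_norm_sq, Complex.normSq_apply]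
  simp only [cgrad]
  have : pd1 u z / (1 + Wg u z) * (pd1 u z / (1 + Wg u z)) + -pd2 u z / (1 + Wg u z) *
      (-pd2 u z / (1 + Wg u z)) = (Wg u z ^ 2 - 1) / (1 + Wg u z) ^ 2 := by
    rw [W2]; field_simp; ring
  rw [this, div_lt_one (by positivity)]
  nlinarith

lemma grad_step {u : ℝ × ℝ → ℝ} {z0 : ℝ × ℝ} {r δ : ℝ} (hr : 0 < r) (hu : IsMSE u (eball z0 r))
    (hδ : 1 - ‖cgrad u z0‖ ≤ δ) (hδ1 : δ ≤ 1 / 6) :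
    ∃ z1 ∈ eball z0 r, ‖toC z1 - toC z0‖ ≤ 3 * δ * (r / 2) ∧ u z0 + r / 4 ≤ u z1 ∧
      1 - ‖cgrad u z1‖ ≤ 3 * δ := by
  obtain ⟨F, G, hF0, hFG⟩ := jorgens hr hu
  have h00 : (0:ℂ) ∈ Metric.ball (0:ℂ) r := Metric.mem_ball_self hr
  have hj0 : jpt z0 F 0 = z0 := by ext <;> simp [jpt, hF0]
  set g : ℂ → ℂ := fun ζ => cgrad u (jpt z0 F ζ) with hg
  set c := cgrad u z0 with hc
  have hg0 : g 0 = c := by simp only [hg, hj0, hc]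
  have hc1 : ‖c‖ < 1 := norm_cgrad_lt u z0
  have hδ0 : 0 < δ := by linarith
  have hcp : 0 < ‖c‖ := by linarith
  have hcn : (‖c‖ : ℂ) ≠ 0 := by exact_mod_cast hcp.ne'
  set e : ℂ := starRingEnd ℂ c / ‖c‖ with he
  have hen : ‖e‖ = 1 := by rw [he, norm_div, RCLike.norm_conj]; simp [hcp.ne']
  have hec : e * c = ‖c‖ := by
    rw [he, div_mul_eq_mul_div, Complex.conj_mul']; field_simp
  have hee : starRingEnd ℂ e * e = 1 := by rw [Complex.conj_mul', hen]; simp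
  have hce : c = ‖c‖ * starRingEnd ℂ e := by
    calc c = (starRingEnd ℂ e * e) * c := by rw [hee, one_mul]
      _ = starRingEnd ℂ e * (e * c) := by ring
      _ = _ := by rw [hec]; ring
  have hGd : DifferentiableOn ℂ G (Metric.ball 0 r) :=
    fun ζ hζ => (hFG ζ hζ).2.2.2.differentiableAt.differentiableWithinAt
  have hgd : DifferentiableOn ℂ g (Metric.ball 0 r) :=
    (hGd.deriv Metric.isOpen_ball).congr fun ζ hζ => (hFG ζ hζ).2.2.2.deriv.symm
  -- Borel-Caratheodory
  have hBC : ∀ ζ ∈ Metric.closedBall (0:ℂ) (r / 2), ‖g ζ - c‖ ≤ 2 * δ := by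
    intro ζ hζ
    have hζ' : ‖ζ‖ ≤ r / 2 := by simpa using hζ
    have hζr : ζ ∈ Metric.ball (0:ℂ) r := by simp; linarith
    have := Complex.borelCaratheodory_zero (f := fun ζ => e * (g ζ - c)) (M := δ) hδ0
      ((hgd.sub_const c).const_mul e)
      (by
        intro w hw
        simp only [mem_ofPred_eq]
        rw [mul_sub, Complex.sub_re, hec, Complex.ofReal_re]
        have : (e * g w).re ≤ ‖e * g w‖ := Complex.re_le_norm _
        rw [norm_mul, hen, one_mul] at this
        have h2 : ‖g w‖ < 1 := norm_cgrad_lt _ _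
        linarith) hr hζr (by simp [hg0])
    rw [norm_mul, hen, one_mul] at this
    refine this.trans ?_
    rw [div_le_iff₀ (by linarith)]
    nlinarith
  have hsub : Metric.closedBall (0:ℂ) (r/2) ⊆ Metric.ball 0 r :=
    Metric.closedBall_subset_ball (by linarith)
  have hge : ∀ ζ ∈ Metric.closedBall (0:ℂ) (r / 2), ‖g ζ - starRingEnd ℂ e‖ ≤ 3 * δ := by
    intro ζ hζ
    have h1 := hBC ζ hζ
    have h2 : ‖c - starRingEnd ℂ e‖ ≤ δ := by
      have : c - starRingEnd ℂ e = ((‖c‖ - 1 : ℝ) : ℂ) * starRingEnd ℂ e := by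
        conv_lhs => rw [hce]
        push_cast; ring
      rw [this, norm_mul, RCLike.norm_conj, hen, mul_one, Complex.norm_real, Real.norm_eq_abs,
        abs_of_neg (by linarith)]
      linarith
    calc _ = ‖(g ζ - c) + (c - starRingEnd ℂ e)‖ := by congr 1; ring
      _ ≤ _ := norm_add_le _ _
      _ ≤ _ := by linarith
  set ζ1 : ℂ := (r / 2 : ℝ) * e with hζ1
  have hζ1n : ‖ζ1‖ = r / 2 := by
    rw [hζ1, norm_mul, hen, Complex.norm_real, Real.norm_eq_abs, abs_of_pos (by linarith), mul_one]
  have hζ1m : ζ1 ∈ Metric.closedBall (0:ℂ) (r/2) := by simp [hζ1n]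
  have h0m : (0:ℂ) ∈ Metric.closedBall (0:ℂ) (r/2) := by simp; linarith
  have eG := (convex_closedBall (0:ℂ) (r/2)).norm_image_sub_le_of_norm_hasDerivWithin_le
    (f := fun ζ => G ζ - starRingEnd ℂ e * ζ) (f' := fun ζ => g ζ - starRingEnd ℂ e) (C := 3 * δ)
    (fun ζ hζ => ((hFG ζ (hsub hζ)).2.2.2.sub
      (((hasDerivAt_id ζ).const_mul (starRingEnd ℂ e)).congr_deriv (by simp))).hasDerivWithinAt)
    hge h0m hζ1m
  have eF := (convex_closedBall (0:ℂ) (r/2)).norm_image_sub_le_of_norm_hasDerivWithin_le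
    (f := fun ζ => F ζ + starRingEnd ℂ e ^ 2 * ζ)
    (f' := fun ζ => -(g ζ) ^ 2 + starRingEnd ℂ e ^ 2) (C := 6 * δ)
    (fun ζ hζ => ((hFG ζ (hsub hζ)).2.2.1.add
      (((hasDerivAt_id ζ).const_mul (starRingEnd ℂ e ^ 2)).congr_deriv (by simp))).hasDerivWithinAt)
    (fun ζ hζ => by
      have : -(g ζ) ^ 2 + starRingEnd ℂ e ^ 2 = -((g ζ - starRingEnd ℂ e) * (g ζ + starRingEnd ℂ e)) := by
        ring
      rw [this, norm_neg, norm_mul]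
      have h1 := hge ζ hζ
      have h2 : ‖g ζ + starRingEnd ℂ e‖ ≤ 2 := by
        refine (norm_add_le _ _).trans ?_
        rw [RCLike.norm_conj, hen]
        have : ‖g ζ‖ < 1 := norm_cgrad_lt _ _
        linarith
      nlinarith [norm_nonneg (g ζ - starRingEnd ℂ e)]) h0m hζ1m
  simp only [mul_zero, sub_zero, add_zero, hζ1n, hF0] at eG eF
  have hcζ : starRingEnd ℂ e * ζ1 = (r / 2 : ℝ) := by
    rw [hζ1, mul_left_comm, hee, mul_one]
  obtain ⟨m1, m2, m3, m4⟩ := hFG ζ1 (hsub hζ1m)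
  refine ⟨jpt z0 F ζ1, m1, ?_, ?_, ?_⟩
  · have e1 : toC (jpt z0 F ζ1) - toC z0 = starRingEnd ℂ (F ζ1 + starRingEnd ℂ e ^ 2 * ζ1) / 2 := by
      have : starRingEnd ℂ e ^ 2 * ζ1 = starRingEnd ℂ ζ1 := by
        rw [pow_two, mul_assoc, hcζ, hζ1, map_mul, Complex.conj_ofReal]; ring
      rw [this]
      apply Complex.ext
      · simp [jpt]; ring
      · simp [jpt]; ring
    rw [e1, norm_div, RCLike.norm_conj]
    simp
    linarith
  · rw [m2]
    have m0 := (hFG 0 h00).2.1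
    rw [hj0] at m0
    rw [m0]
    rw [hcζ] at eG
    have := (abs_le.1 ((Complex.abs_re_le_norm _).trans eG)).1
    simp only [Complex.sub_re, Complex.ofReal_re] at this
    nlinarith
  · have h1 := hBC ζ1 hζ1m
    have h2 := norm_sub_norm_le c (g ζ1)
    rw [norm_sub_rev] at h2
    change 1 - ‖g ζ1‖ ≤ _
    linarith

theorem grad_bound (M R : ℝ) (hR : 0 < R) : ∃ k < (1:ℝ), ∀ (u : ℝ × ℝ → ℝ) (z0 : ℝ × ℝ),
    IsMSE u (eball z0 R) → (∀ z ∈ eball z0 R, |u z| ≤ M) → ‖cgrad u z0‖ ≤ k := by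
  obtain ⟨N, hN⟩ := exists_nat_gt (16 * M / R)
  refine ⟨1 - (1 / 3) ^ (N + 1) / 2, by simp, fun u z0 hu hM => ?_⟩
  by_contra hcon
  push Not at hcon
  set δ := 1 - ‖cgrad u z0‖ with hδ
  have hδ0 : 0 ≤ δ := by have := norm_cgrad_lt u z0; rw [hδ]; linarith
  have hsmall : (3:ℝ) ^ (N + 1) * δ ≤ 1 / 2 := by
    have h1 : δ ≤ (1 / 3) ^ (N + 1) / 2 := by rw [hδ]; linarith
    calc (3:ℝ) ^ (N + 1) * δ ≤ 3 ^ (N + 1) * ((1 / 3) ^ (N + 1) / 2) := by gcongr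
      _ = (3 * (1 / 3)) ^ (N + 1) / 2 := by rw [mul_pow]; ring
      _ = 1 / 2 := by norm_num
  have key : ∀ k ≤ N, ∃ z ∈ eball z0 R, ‖toC z - toC z0‖ ≤ 3 ^ (k + 1) * δ * (R / 2) ∧
      u z0 + k * (R / 8) ≤ u z ∧ 1 - ‖cgrad u z‖ ≤ 3 ^ k * δ := by
    intro k
    induction k with
    | zero => intro _; exact ⟨z0, mem_eball_self hR, by simp; positivity, by simp, by simp [hδ]⟩
    | succ k ih =>
      intro hk
      obtain ⟨z, hz, h1, h2, h3⟩ := ih (by omega)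
      have hp : (3:ℝ) ^ (k + 1) * δ ≤ 1 / 2 := by
        refine le_trans ?_ hsmall
        gcongr
        · norm_num
        · omega
      have hss : eball z (R / 2) ⊆ eball z0 R := by
        apply eball_subset; nlinarith
      obtain ⟨z1, hz1, a1, a2, a3⟩ := grad_step (δ := 3 ^ k * δ) (r := R / 2) (by linarith)
        (hu.mono hss) h3 (by rw [pow_succ] at hp; linarith)
      refine ⟨z1, hss hz1, ?_, ?_, ?_⟩
      · calc ‖toC z1 - toC z0‖ = ‖(toC z1 - toC z) + (toC z - toC z0)‖ := by congr 1; ring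
          _ ≤ _ := norm_add_le _ _
          _ ≤ 3 * (3 ^ k * δ) * (R / 2 / 2) + 3 ^ (k + 1) * δ * (R / 2) := by gcongr
          _ ≤ _ := by
            have : 0 ≤ (3:ℝ) ^ k * δ * R := by positivity
            rw [show (3:ℝ) ^ (k + 1 + 1) = 3 ^ k * 9 by ring, show (3:ℝ) ^ (k + 1) = 3 ^ k * 3 by ring]
            nlinarith
      · push_cast; linarith
      · rw [pow_succ]; linarith
  obtain ⟨z, hz, -, h2, -⟩ := key N le_rfl
  have b1 := (abs_le.1 (hM z hz)).2
  have b2 := (abs_le.1 (hM z0 (mem_eball_self hR))).1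
  rw [div_lt_iff₀ hR] at hN
  linarith

/-! ### Compactness -/

lemma norm_cgrad_sq (u : ℝ × ℝ → ℝ) (z : ℝ × ℝ) :
    ‖cgrad u z‖ ^ 2 * (Wg u z + 1) = Wg u z - 1 := by
  have W1 := one_le_Wg u z
  have W2 := Wg_sq u z
  rw [← Complex.normSq_eq_norm_sq, Complex.normSq_apply]
  simp only [cgrad]
  have : pd1 u z / (1 + Wg u z) * (pd1 u z / (1 + Wg u z)) + -pd2 u z / (1 + Wg u z) *
      (-pd2 u z / (1 + Wg u z)) = (Wg u z ^ 2 - 1) / (1 + Wg u z) ^ 2 := by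
    rw [W2]; field_simp; ring
  rw [this]; field_simp; ring

lemma abs_pd_le_Wg (u : ℝ × ℝ → ℝ) (z : ℝ × ℝ) : |pd1 u z| ≤ Wg u z ∧ |pd2 u z| ≤ Wg u z := by
  have W1 := one_le_Wg u z
  have W2 := Wg_sq u z
  constructor <;> apply abs_le_of_sq_le_sq _ (by linarith) <;> nlinarith [sq_nonneg (pd1 u z), sq_nonneg (pd2 u z)]

lemma lip_bound (M R : ℝ) (hR : 0 < R) : ∃ L : ℝ, 0 ≤ L ∧ ∀ (u : ℝ × ℝ → ℝ) (z0 : ℝ × ℝ),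
    IsMSE u (eball z0 (2 * R)) → (∀ z ∈ eball z0 (2 * R), |u z| ≤ M) →
    ∀ z ∈ eball z0 R, ∀ w ∈ eball z0 R, |u w - u z| ≤ L * ‖w - z‖ := by
  obtain ⟨k, hk, hb⟩ := grad_bound M R hR
  by_cases hk0 : 0 ≤ k
  swap
  · refine ⟨0, le_rfl, fun u z0 hu hM z hz => ?_⟩
    have hs : eball z R ⊆ eball z0 (2 * R) := eball_subset (by linarith [mem_eball.1 hz])
    have := hb u z (hu.mono hs) (fun w hw => hM w (hs hw))
    linarith [norm_nonneg (cgrad u z)]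
  have hk2 : 0 < 1 - k ^ 2 := by nlinarith
  refine ⟨2 * (2 / (1 - k ^ 2)), by positivity, fun u z0 hu hM z hz w hw => ?_⟩
  have hd : ∀ x ∈ eball z0 R, ContDiffAt ℝ 2 u x := fun x hx =>
    (((isMSE_iff (isOpen_eball _ _)).1 hu) x (eball_mono (by linarith) hx)).1
  have := Convex.norm_image_sub_le_of_norm_fderiv_le (𝕜 := ℝ) (f := u) (s := eball z0 R)
    (C := 2 * (2 / (1 - k ^ 2))) (x := z) (y := w)
    (fun x hx => (hd x hx).differentiableAt (by norm_num)) ?_ (convex_edisk _ _) hz hw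
  · simpa using this
  intro x hx
  have hs : eball x R ⊆ eball z0 (2 * R) := eball_subset (by linarith [mem_eball.1 hx])
  have h1 := hb u x (hu.mono hs) (fun w hw => hM w (hs hw))
  have h2 := norm_cgrad_sq u x
  have W1 := one_le_Wg u x
  have h3 : ‖cgrad u x‖ ^ 2 ≤ k ^ 2 := by gcongr
  have h4 : Wg u x ≤ 2 / (1 - k ^ 2) := by
    rw [le_div_iff₀ hk2]; nlinarith
  refine ContinuousLinearMap.opNorm_le_bound _ (by positivity) fun v => ?_
  rw [fderiv_eq_pd ((hd x hx).differentiableAt (by norm_num))]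
  have a1 := (abs_pd_le_Wg u x).1
  have a2 := (abs_pd_le_Wg u x).2
  have b1 : |v.1| ≤ ‖v‖ := norm_fst_le v
  have b2 : |v.2| ≤ ‖v‖ := norm_snd_le v
  calc ‖pd1 u x * v.1 + pd2 u x * v.2‖ ≤ |pd1 u x * v.1| + |pd2 u x * v.2| := abs_add_le _ _
    _ = |pd1 u x| * |v.1| + |pd2 u x| * |v.2| := by rw [abs_mul, abs_mul]
    _ ≤ (2 / (1 - k ^ 2)) * ‖v‖ + (2 / (1 - k ^ 2)) * ‖v‖ := by
      have := a1.trans h4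
      have := a2.trans h4
      gcongr
    _ = _ := by ring

/-- Ultralimits of equi-Lipschitz bounded holomorphic functions. -/
lemma holo_limit {ι : Type*} (l : Ultrafilter ι) {R B : ℝ} {F : ι → ℂ → ℂ} {f' : ι → ℂ → ℂ}
    (hd : ∀ i, ∀ ζ ∈ Metric.ball (0:ℂ) R, HasDerivAt (F i) (f' i ζ) ζ)
    (h1 : ∀ i, ∀ ζ ∈ Metric.ball (0:ℂ) R, ‖f' i ζ‖ ≤ 1) (hR : 0 < R)
    (h0 : ∀ i, ‖F i 0‖ ≤ B) :
    ∃ f : ℂ → ℂ, DifferentiableOn ℂ f (Metric.ball 0 R) ∧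
      (∀ ζ ∈ Metric.ball (0:ℂ) R, Tendsto (fun i => F i ζ) l (𝓝 (f ζ))) ∧
      (∀ ζ ∈ Metric.ball (0:ℂ) R, Tendsto (fun i => f' i ζ) l (𝓝 (deriv f ζ))) ∧
      (∀ ζ ∈ Metric.ball (0:ℂ) R, ‖f ζ - f 0‖ ≤ ‖ζ‖) := by
  have hlip : ∀ i, ∀ x ∈ Metric.ball (0:ℂ) R, ∀ y ∈ Metric.ball (0:ℂ) R,
      ‖F i y - F i x‖ ≤ ‖y - x‖ := by
    intro i x hx y hy
    have := Convex.norm_image_sub_le_of_norm_hasDerivWithin_le (f := F i) (f' := f' i)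
      (s := Metric.ball (0:ℂ) R) (C := 1) (x := x) (y := y)
      (fun ζ hζ => (hd i ζ hζ).hasDerivWithinAt) (h1 i) (convex_ball _ _) hx hy
    simpa using this
  have h0m : (0:ℂ) ∈ Metric.ball (0:ℂ) R := Metric.mem_ball_self hR
  have hex : ∀ ζ : ℂ, ζ ∈ Metric.ball (0:ℂ) R → ∃ w, Tendsto (fun i => F i ζ) l (𝓝 w) := by
    intro ζ hζ
    have hc := isCompact_closedBall (0:ℂ) (B + R)
    obtain ⟨w, -, hw⟩ := hc.ultrafilter_le_nhds (l.map fun i => F i ζ) (by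
      rw [le_principal_iff]
      refine Filter.mem_map.2 (univ_mem' fun i => ?_)
      have := hlip i 0 h0m ζ hζ
      have h2 : ‖ζ‖ < R := by simpa using hζ
      have h3 := norm_add_le (F i ζ - F i 0) (F i 0)
      rw [sub_add_cancel] at h3
      rw [sub_zero] at this
      simp only [mem_preimage, mem_closedBall_zero_iff]
      linarith [h0 i])
    exact ⟨w, hw⟩
  choose! f hf using hex
  have hfl : ∀ x ∈ Metric.ball (0:ℂ) R, ∀ y ∈ Metric.ball (0:ℂ) R, ‖f y - f x‖ ≤ ‖y - x‖ := by
    intro x hx y hy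
    exact le_of_tendsto ((hf y hy).sub (hf x hx)).norm (Eventually.of_forall fun i => hlip i x hx y hy)
  have hloc : TendstoLocallyUniformlyOn F f l (Metric.ball 0 R) := by
    rw [Metric.tendstoLocallyUniformlyOn_iff]
    intro ε hε x hx
    refine ⟨Metric.ball x (ε / 3) ∩ Metric.ball 0 R, inter_mem (mem_nhdsWithin_of_mem_nhds
      (Metric.ball_mem_nhds _ (by positivity))) self_mem_nhdsWithin, ?_⟩
    filter_upwards [(Metric.tendsto_nhds.1 (hf x hx)) (ε / 3) (by positivity)] with i hi y hy
    have e1 := hlip i x hx y hy.2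
    have e2 := hfl x hx y hy.2
    have e3 : ‖y - x‖ < ε / 3 := by simpa [dist_eq_norm] using hy.1
    rw [dist_eq_norm] at hi ⊢
    calc ‖f y - F i y‖ = ‖(f y - f x) + (-(F i x - f x)) + (-(F i y - F i x))‖ := by congr 1; ring
      _ ≤ ‖f y - f x‖ + ‖F i x - f x‖ + ‖F i y - F i x‖ := by
        refine (norm_add₃_le).trans ?_
        rw [norm_neg, norm_neg]
      _ < ε := by linarith
  have hdiff : ∀ᶠ i in (l : Filter ι), DifferentiableOn ℂ (F i) (Metric.ball 0 R) :=
    Eventually.of_forall fun i ζ hζ => (hd i ζ hζ).differentiableAt.differentiableWithinAt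
  refine ⟨f, hloc.differentiableOn hdiff Metric.isOpen_ball, hf, ?_, ?_⟩
  · intro ζ hζ
    have := (hloc.deriv hdiff Metric.isOpen_ball).tendsto_at hζ
    refine this.congr fun i => ?_
    exact (hd i ζ hζ).deriv
  · intro ζ hζ
    simpa using hfl 0 h0m ζ hζ

theorem mse_limit {ι : Type*} (l : Ultrafilter ι) {V : ι → ℝ × ℝ → ℝ} {U : ℝ × ℝ → ℝ}
    {Ω : Set (ℝ × ℝ)} (ho : IsOpen Ω) {M : ℝ} (hV : ∀ i, IsMSE (V i) Ω)
    (hb : ∀ i, ∀ z ∈ Ω, |V i z| ≤ M)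
    (hl : ∀ z ∈ Ω, Tendsto (fun i => V i z) l (𝓝 (U z))) : IsMSE U Ω := by
  rw [isMSE_iff ho]
  intro z0 hz0
  obtain ⟨r, hr, hrs⟩ := exists_eball_subset (ho.mem_nhds hz0)
  set R := r / 2 with hRd
  have hR : 0 < R := by positivity
  have hs2 : eball z0 (2 * R) ⊆ Ω := by rw [hRd]; convert hrs using 2; ring
  have hs1 : eball z0 R ⊆ Ω := (eball_mono (by linarith)).trans hs2
  obtain ⟨L, hL0, hL⟩ := lip_bound M R hR
  obtain ⟨k, hk, hkb⟩ := grad_bound M R hR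
  choose F G hF0 hFG using fun i => jorgens hR ((hV i).mono hs1)
  have h0m : (0:ℂ) ∈ Metric.ball (0:ℂ) R := Metric.mem_ball_self hR
  have hj0 : ∀ i, jpt z0 (F i) 0 = z0 := fun i => by ext <;> simp [jpt, hF0]
  obtain ⟨f, hfd, hf1, hf2, hf3⟩ := holo_limit l (F := F) (B := 0)
    (fun i ζ hζ => (hFG i ζ hζ).2.2.1)
    (fun i ζ hζ => by
      rw [norm_neg, norm_pow]
      have := norm_cgrad_lt (V i) (jpt z0 (F i) ζ)
      have h0 := norm_nonneg (cgrad (V i) (jpt z0 (F i) ζ))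
      nlinarith) hR (fun i => by simp [hF0])
  obtain ⟨g, hgd, hg1, hg2, hg3⟩ := holo_limit l (F := fun i ζ => G i ζ - Complex.I * (G i 0).im)
    (B := M)
    (fun i ζ hζ => (hFG i ζ hζ).2.2.2.sub_const _)
    (fun i ζ hζ => (norm_cgrad_lt (V i) (jpt z0 (F i) ζ)).le) hR (fun i => by
      have e : G i 0 - Complex.I * (G i 0).im = ((G i 0).re : ℂ) := by
        apply Complex.ext <;> simp
      rw [e, Complex.norm_real, ← (hFG i 0 h0m).2.1, hj0]
      exact hb i z0 hz0)
  have hf0 : f 0 = 0 := tendsto_nhds_unique (hf1 0 h0m) (by simp [hF0])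
  -- derivative relations at zero
  have hrel : deriv f 0 = -(deriv g 0) ^ 2 :=
    tendsto_nhds_unique (hf2 0 h0m) ((hg2 0 h0m).pow 2).neg
  have hgk : ‖deriv g 0‖ ≤ k := by
    refine le_of_tendsto (hg2 0 h0m).norm (Eventually.of_forall fun i => ?_)
    rw [hj0]
    exact hkb (V i) z0 ((hV i).mono hs1) fun z hz => hb i z (hs1 hz)
  have hfk : Complex.normSq (deriv f 0) < 1 := by
    rw [Complex.normSq_eq_norm_sq, hrel, norm_neg, norm_pow]
    have h0 := norm_nonneg (deriv g 0)
    have : ‖deriv g 0‖ ^ 2 < 1 := by nlinarith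
    nlinarith [sq_nonneg ‖deriv g 0‖]
  have hnhds : Metric.ball (0:ℂ) R ∈ 𝓝 (0:ℂ) := Metric.ball_mem_nhds _ hR
  have hfa : AnalyticAt ℂ f 0 := hfd.analyticAt hnhds
  have hga : AnalyticAt ℂ g 0 := hgd.analyticAt hnhds
  have dA : HasDerivAt (fun ζ => (z0.1 : ℂ) + (ζ + f ζ) / 2) ((1 + deriv f 0) / 2) 0 :=
    (((hasDerivAt_id (0:ℂ)).add hfa.differentiableAt.hasDerivAt).div_const 2).const_add _
  have dB : HasDerivAt (fun ζ => (z0.2 : ℂ) + -Complex.I * ((ζ - f ζ) / 2))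
      (-Complex.I * ((1 - deriv f 0) / 2)) 0 :=
    ((((hasDerivAt_id (0:ℂ)).sub hfa.differentiableAt.hasDerivAt).div_const 2).const_mul _).const_add _
  have hP : ∀ ζ : ℂ, (((z0.1 : ℂ) + (ζ + f ζ) / 2).re, ((z0.2 : ℂ) + -Complex.I * ((ζ - f ζ) / 2)).re)
      = jpt z0 f ζ := by
    intro ζ; ext <;> simp [jpt]
  have key := mse_of_param (A := fun ζ => (z0.1 : ℂ) + (ζ + f ζ) / 2)
    (B := fun ζ => (z0.2 : ℂ) + -Complex.I * ((ζ - f ζ) / 2)) (G := g) (ζ₀ := 0) (U := U)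
    (by fun_prop) (by fun_prop) hga
    (by rw [dA.deriv, dB.deriv, hrel]; linear_combination (1 + deriv g 0 ^ 2) ^ 2 / 4 * Complex.I_sq)
    (by
      rw [dA.deriv, dB.deriv]
      have : (starRingEnd ℂ ((1 + deriv f 0) / 2) * (-Complex.I * ((1 - deriv f 0) / 2))).im
        = -(1 - Complex.normSq (deriv f 0)) / 4 := by
        have c2 : (2:ℂ) = ((2:ℝ):ℂ) := by simp
        rw [c2]
        simp [Complex.normSq_apply, Complex.div_re, Complex.div_im]
        ring
      rw [this]
      intro h
      linarith)
    (by
      filter_upwards [hnhds] with ζ hζ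
      rw [hP]
      have hζR : ‖ζ‖ < R := by simpa using hζ
      have hmem : jpt z0 f ζ ∈ eball z0 R := by
        rw [mem_eball]
        have e : toC (jpt z0 f ζ) - toC z0 = (ζ + starRingEnd ℂ (f ζ)) / 2 := by
          apply Complex.ext <;> simp [jpt, sub_eq_add_neg]
        rw [e, norm_div]
        have := norm_add_le ζ (starRingEnd ℂ (f ζ))
        rw [RCLike.norm_conj] at this
        have h3 := hf3 ζ hζ
        rw [hf0, sub_zero] at h3
        rw [Complex.norm_ofNat, div_lt_iff₀ (by norm_num)]
        linarith
      have t1 : Tendsto (fun i => jpt z0 (F i) ζ) l (𝓝 (jpt z0 f ζ)) := by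
        unfold jpt
        refine Tendsto.prodMk_nhds ?_ ?_
        · exact ((Complex.continuous_re.tendsto _).comp (((hf1 ζ hζ).const_add ζ).div_const 2)).const_add _
        · exact ((Complex.continuous_im.tendsto _).comp (((hf1 ζ hζ).const_sub ζ).div_const 2)).const_add _
      have t2 : Tendsto (fun i => V i (jpt z0 (F i) ζ)) l (𝓝 (U (jpt z0 f ζ))) := by
        have t3 : Tendsto (fun i => V i (jpt z0 (F i) ζ) - V i (jpt z0 f ζ)) l (𝓝 0) := by
          refine squeeze_zero_norm (a := fun i => L * ‖jpt z0 (F i) ζ - jpt z0 f ζ‖) (fun i => ?_) ?_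
          · exact hL (V i) z0 ((hV i).mono hs2) (fun z hz => hb i z (hs2 hz)) _ hmem _
              (hFG i ζ hζ).1
          · have := ((tendsto_iff_norm_sub_tendsto_zero.1 t1).const_mul L)
            simpa using this
        have := t3.add (hl _ (hs1 hmem))
        simpa using this
      refine tendsto_nhds_unique t2 ?_
      have := (Complex.continuous_re.tendsto _).comp (hg1 ζ hζ)
      refine this.congr fun i => ?_
      simp [(hFG i ζ hζ).2.1])
  have e0 := hP 0
  have e1 : jpt z0 f 0 = z0 := by ext <;> simp [jpt, hf0]
  rw [e1] at e0
  rw [← e0]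
  exact key

/-! ### Comparison principle with a finite exceptional set -/

lemma mono_field {p1 q1 p2 q2 W1 W2 : ℝ} (h1 : 1 ≤ W1) (h2 : 1 ≤ W2)
    (e1 : W1 ^ 2 = 1 + p1 ^ 2 + q1 ^ 2) (e2 : W2 ^ 2 = 1 + p2 ^ 2 + q2 ^ 2) :
    0 ≤ (p1 - p2) * (p1 / W1 - p2 / W2) + (q1 - q2) * (q1 / W1 - q2 / W2) ∧
    ((p1 - p2) * (p1 / W1 - p2 / W2) + (q1 - q2) * (q1 / W1 - q2 / W2) = 0 →
      p1 = p2 ∧ q1 = q2) := by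
  have hW1 : 0 < W1 := by linarith
  have hW2 : 0 < W2 := by linarith
  have key : (p1 - p2) * (p1 / W1 - p2 / W2) + (q1 - q2) * (q1 / W1 - q2 / W2)
      = (W1 + W2) / (W1 * W2) * (W1 * W2 - (1 + p1 * p2 + q1 * q2)) := by
    field_simp
    grind
  have hsq : (W1 * W2) ^ 2 - (1 + p1 * p2 + q1 * q2) ^ 2
      = (p1 - p2) ^ 2 + (q1 - q2) ^ 2 + (p1 * q2 - p2 * q1) ^ 2 := by
    rw [mul_pow, e1, e2]; ring
  have hle : 1 + p1 * p2 + q1 * q2 ≤ W1 * W2 := by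
    apply le_of_abs_le
    apply abs_le_of_sq_le_sq _ (by positivity)
    nlinarith [sq_nonneg (p1 - p2), sq_nonneg (q1 - q2), sq_nonneg (p1 * q2 - p2 * q1), mul_pos hW1 hW2]
  have hpos : 0 < (W1 + W2) / (W1 * W2) := by positivity
  rw [key]
  refine ⟨mul_nonneg hpos.le (by linarith), fun h => ?_⟩
  have h0 : W1 * W2 - (1 + p1 * p2 + q1 * q2) = 0 := by
    rcases mul_eq_zero.1 h with h | h
    · exact absurd h hpos.ne'
    · exact h
  have h3 : (W1 * W2) ^ 2 - (1 + p1 * p2 + q1 * q2) ^ 2 = 0 := by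
    rw [sub_eq_zero.1 h0]; ring
  rw [h3] at hsq
  have a1 : (p1 - p2) ^ 2 = 0 := by nlinarith [sq_nonneg (p1 - p2), sq_nonneg (q1 - q2), sq_nonneg (p1 * q2 - p2 * q1)]
  have a2 : (q1 - q2) ^ 2 = 0 := by nlinarith [sq_nonneg (p1 - p2), sq_nonneg (q1 - q2), sq_nonneg (p1 * q2 - p2 * q1)]
  exact ⟨by nlinarith [pow_eq_zero_iff (n := 2) (by norm_num) |>.1 a1], by nlinarith [pow_eq_zero_iff (n := 2) (by norm_num) |>.1 a2]⟩

lemma exists_cutoff1 (p : ℝ × ℝ) {η : ℝ} (hη : 0 < η) : ∃ ψ : ℝ × ℝ → ℝ, ContDiff ℝ 1 ψ ∧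
    (∀ z, 0 ≤ ψ z ∧ ψ z ≤ 1) ∧ (∀ᶠ z in 𝓝 p, ψ z = 0) ∧ Integrable (fun z => ‖fderiv ℝ ψ z‖) ∧
    ∫ z, ‖fderiv ℝ ψ z‖ ≤ η ∧ ∀ z, η ≤ ‖z - p‖ → ψ z = 1 := by
  let b : ContDiffBump (0 : ℝ × ℝ) := ⟨1, 2, by norm_num, by norm_num⟩
  set I := ∫ z, ‖fderiv ℝ b z‖ with hI
  have hI0 : 0 ≤ I := integral_nonneg fun _ => norm_nonneg _
  obtain ⟨δ, hδ, hδ1, hδ2⟩ : ∃ δ : ℝ, 0 < δ ∧ δ * I ≤ η ∧ 2 * δ ≤ η := by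
    refine ⟨min (η / (I + 1)) (η / 2), by positivity, ?_, ?_⟩
    · have h := min_le_left (η / (I + 1)) (η / 2)
      calc _ ≤ η / (I + 1) * I := by gcongr
        _ ≤ η := by rw [div_mul_eq_mul_div, div_le_iff₀ (by positivity)]; nlinarith
    · linarith [min_le_right (η / (I + 1)) (η / 2)]
  have hb1 : ContDiff ℝ 1 b := b.contDiff
  have hd : ∀ z, HasFDerivAt (fun z => 1 - b (δ⁻¹ • (z - p)))
      (-(δ⁻¹ • fderiv ℝ b (δ⁻¹ • (z - p)))) z := by
    intro z
    have h1 : HasFDerivAt (fun z : ℝ × ℝ => δ⁻¹ • (z - p)) (δ⁻¹ • ContinuousLinearMap.id ℝ (ℝ × ℝ)) z :=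
      ((hasFDerivAt_id z).sub_const p).const_smul δ⁻¹
    have h2 := (hb1.differentiable (by norm_num) (δ⁻¹ • (z - p))).hasFDerivAt.comp z h1
    have h3 := h2.const_sub 1
    have e : (-(δ⁻¹ • fderiv ℝ b (δ⁻¹ • (z - p))) : ℝ × ℝ →L[ℝ] ℝ) =
        -((fderiv ℝ b (δ⁻¹ • (z - p))).comp (δ⁻¹ • ContinuousLinearMap.id ℝ (ℝ × ℝ))) := by
      ext v <;> simp
    rw [e]
    exact h3
  have hnorm : (fun z => ‖fderiv ℝ (fun z => 1 - b (δ⁻¹ • (z - p))) z‖)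
      = fun z => (fun z => (fun y => δ⁻¹ * ‖fderiv ℝ b y‖) (δ⁻¹ • z)) (z - p) := by
    funext z
    rw [(hd z).fderiv, norm_neg, norm_smul, Real.norm_of_nonneg (by positivity)]
  have hintg : Integrable (fun y : ℝ × ℝ => δ⁻¹ * ‖fderiv ℝ b y‖) := by
    refine Integrable.const_mul ?_ _
    exact ((hb1.continuous_fderiv (by norm_num)).integrable_of_hasCompactSupport
      (b.hasCompactSupport.fderiv ℝ)).norm
  refine ⟨fun z => 1 - b (δ⁻¹ • (z - p)), by fun_prop, fun z => ?_, ?_, ?_, ?_, ?_⟩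
  · have := b.le_one (x := δ⁻¹ • (z - p)); have := b.nonneg (x := δ⁻¹ • (z - p))
    constructor <;> linarith
  · have hc : Continuous fun z : ℝ × ℝ => δ⁻¹ • (z - p) := by fun_prop
    have ht : Tendsto (fun z : ℝ × ℝ => δ⁻¹ • (z - p)) (𝓝 p) (𝓝 0) := by
      have := hc.tendsto p; simpa using this
    filter_upwards [ht.eventually b.eventuallyEq_one] with z hz
    simp only [hz, Pi.one_apply, sub_self]
  · rw [hnorm]
    exact ((integrable_comp_smul_iff volume _ (inv_ne_zero hδ.ne')).2 hintg).comp_sub_right p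
  · rw [hnorm, integral_sub_right_eq_self (fun z => (fun y => δ⁻¹ * ‖fderiv ℝ b y‖) (δ⁻¹ • z)) p,
      Measure.integral_comp_inv_smul_of_nonneg volume (fun y => δ⁻¹ * ‖fderiv ℝ b y‖) hδ.le, integral_const_mul]
    simp only [Module.finrank_prod, Module.finrank_self, smul_eq_mul]
    calc δ ^ (1 + 1) * (δ⁻¹ * I) = δ * I := by field_simp
      _ ≤ η := hδ1
  · intro z hz
    have : b (δ⁻¹ • (z - p)) = 0 := by
      apply b.zero_of_le_dist
      rw [dist_zero_right, norm_smul, Real.norm_of_nonneg (by positivity)]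
      change (2:ℝ) ≤ _
      rw [inv_mul_eq_div, le_div_iff₀ hδ]; linarith
    simp [this]

lemma exists_cutoff {V : Set (ℝ × ℝ)} (hV : V.Finite) : ∀ η : ℝ, 0 < η → ∃ ψ : ℝ × ℝ → ℝ,
    ContDiff ℝ 1 ψ ∧ (∀ z, 0 ≤ ψ z ∧ ψ z ≤ 1) ∧ (∀ p ∈ V, ∀ᶠ z in 𝓝 p, ψ z = 0) ∧
    Integrable (fun z => ‖fderiv ℝ ψ z‖) ∧
    ∫ z, ‖fderiv ℝ ψ z‖ ≤ η ∧ ∀ z, (∀ p ∈ V, η ≤ ‖z - p‖) → ψ z = 1 := by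
  induction V, hV using Set.Finite.induction_on with
  | empty => exact fun η hη => ⟨fun _ => 1, contDiff_const, by simp, by simp, by simp, by simpa using hη.le, by simp⟩
  | @insert a s ha hs ih =>
    intro η hη
    obtain ⟨ψ, h1, h2, h3, h4, h5, h6⟩ := ih (η / 2) (by positivity)
    obtain ⟨φ, k1, k2, k3, k4, k5, k6⟩ := exists_cutoff1 a (η := η / 2) (by positivity)
    have hle : ∀ z, ‖fderiv ℝ (fun z => ψ z * φ z) z‖ ≤ ‖fderiv ℝ ψ z‖ + ‖fderiv ℝ φ z‖ := by
      intro z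
      rw [fderiv_fun_mul (h1.differentiable (by norm_num) z) (k1.differentiable (by norm_num) z)]
      refine (norm_add_le _ _).trans ?_
      rw [norm_smul, norm_smul, Real.norm_of_nonneg (h2 z).1, Real.norm_of_nonneg (k2 z).1]
      nlinarith [(h2 z).2, (k2 z).2, norm_nonneg (fderiv ℝ ψ z), norm_nonneg (fderiv ℝ φ z)]
    have hi : Integrable (fun z => ‖fderiv ℝ (fun z => ψ z * φ z) z‖) := by
      refine (h4.add k4).mono' ?_ ?_
      · exact (((h1.mul k1).continuous_fderiv (by norm_num)).norm).aestronglyMeasurable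
      · exact Eventually.of_forall fun z => by simpa using hle z
    refine ⟨fun z => ψ z * φ z, h1.mul k1, fun z => ⟨mul_nonneg (h2 z).1 (k2 z).1,
      mul_le_one₀ (h2 z).2 (k2 z).1 (k2 z).2⟩, ?_, hi, ?_, ?_⟩
    · rintro p (rfl | hp)
      · filter_upwards [k3] with z hz; simp [hz]
      · filter_upwards [h3 p hp] with z hz; simp [hz]
    · calc _ ≤ ∫ z, (‖fderiv ℝ ψ z‖ + ‖fderiv ℝ φ z‖) := integral_mono hi (h4.add k4) hle
        _ = _ := integral_add h4 k4
        _ ≤ η := by linarith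
    · intro z hz
      change ψ z * φ z = 1
      rw [h6 z fun p hp => by linarith [hz p (mem_insert_of_mem _ hp)], k6 z (by linarith [hz a (mem_insert _ _)]), one_mul]

theorem comparison {Ω V : Set (ℝ × ℝ)} (ho : IsOpen Ω) (hbd : Bornology.IsBounded Ω)
    (hV : V.Finite) (hVd : Disjoint V Ω) {u v : ℝ × ℝ → ℝ} (hu : IsMSE u Ω) (hv : IsMSE v Ω)
    (hb : ∀ b ∈ frontier Ω \ V, ∀ ε > 0, ∀ᶠ z in 𝓝[Ω] b, u z ≤ v z + ε) :
    ∀ z ∈ Ω, u z ≤ v z := by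
  by_contra hcon
  push Not at hcon
  obtain ⟨z0, hz0, hlt⟩ := hcon
  set ε := (u z0 - v z0) / 2 with hε
  have hε0 : 0 < ε := by rw [hε]; linarith
  rw [isMSE_iff ho] at hu hv
  classical
  set χ : ℝ → ℝ := fun t => Real.smoothTransition (t - ε) with hχ
  have hχs : ContDiff ℝ 1 χ := (Real.smoothTransition.contDiff (n := 1)).comp (contDiff_id.sub contDiff_const)
  have hχm : Monotone χ := fun a b hab => Real.smoothTransition.monotone (by linarith)
  set H : ℝ × ℝ → ℝ := fun z => if z ∈ Ω then χ (u z - v z) else 0 with hH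
  have hH01 : ∀ z, 0 ≤ H z ∧ H z ≤ 1 := by
    intro z
    by_cases hz : z ∈ Ω
    · simp only [hH, if_pos hz, hχ]
      exact ⟨Real.smoothTransition.nonneg _, Real.smoothTransition.le_one _⟩
    · simp [hH, hz]
  have hHin : ∀ z ∈ Ω, H =ᶠ[𝓝 z] fun z => χ (u z - v z) := by
    intro z hz
    filter_upwards [ho.mem_nhds hz] with y hy
    simp [hH, hy]
  have hHout : ∀ z, z ∉ Ω → z ∉ V → H =ᶠ[𝓝 z] fun _ => 0 := by
    intro z hz hzV
    by_cases hzc : z ∈ closure Ω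
    · have hf : z ∈ frontier Ω := by rw [ho.frontier_eq]; exact ⟨hzc, hz⟩
      have := hb z ⟨hf, hzV⟩ ε hε0
      rw [eventually_nhdsWithin_iff] at this
      filter_upwards [this] with y hy
      by_cases hyΩ : y ∈ Ω
      · simp only [hH, if_pos hyΩ, hχ]
        exact Real.smoothTransition.zero_of_nonpos (by linarith [hy hyΩ])
      · simp [hH, hyΩ]
    · filter_upwards [isClosed_closure.isOpen_compl.mem_nhds hzc] with y hy
      have : y ∉ Ω := fun h => hy (subset_closure h)
      simp [hH, this]
  have hVc : IsOpen Vᶜ := hV.isClosed.isOpen_compl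
  set X1 : ℝ × ℝ → ℝ := fun z => pd1 u z / Wg u z - pd1 v z / Wg v z with hX1
  set X2 : ℝ × ℝ → ℝ := fun z => pd2 u z / Wg u z - pd2 v z / Wg v z with hX2
  set Y1 : ℝ × ℝ → ℝ := fun z => H z * X1 z with hY1
  set Y2 : ℝ × ℝ → ℝ := fun z => H z * X2 z with hY2
  have hX1c : ∀ z ∈ Ω, ContDiffAt ℝ 1 X1 z := fun z hz =>
    ((contDiffAt_pd1 (hu z hz).1).div (contDiffAt_Wg (hu z hz).1) (by linarith [one_le_Wg u z])).sub
    ((contDiffAt_pd1 (hv z hz).1).div (contDiffAt_Wg (hv z hz).1) (by linarith [one_le_Wg v z]))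
  have hX2c : ∀ z ∈ Ω, ContDiffAt ℝ 1 X2 z := fun z hz =>
    ((contDiffAt_pd2 (hu z hz).1).div (contDiffAt_Wg (hu z hz).1) (by linarith [one_le_Wg u z])).sub
    ((contDiffAt_pd2 (hv z hz).1).div (contDiffAt_Wg (hv z hz).1) (by linarith [one_le_Wg v z]))
  have hwc : ∀ z ∈ Ω, ContDiffAt ℝ 1 (fun z => u z - v z) z := fun z hz =>
    ((hu z hz).1.sub (hv z hz).1).of_le (by norm_num)
  have hHc : ∀ z ∈ Ω, ContDiffAt ℝ 1 H z := fun z hz =>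
    (hχs.contDiffAt.comp z (hwc z hz)).congr_of_eventuallyEq (hHin z hz)
  have hXb : ∀ z, |X1 z| ≤ 2 ∧ |X2 z| ≤ 2 := by
    have hq : ∀ (w : ℝ × ℝ → ℝ) z, |pd1 w z / Wg w z| ≤ 1 ∧ |pd2 w z / Wg w z| ≤ 1 := by
      intro w z
      have hW : 0 < Wg w z := by linarith [one_le_Wg w z]
      rw [abs_div, abs_div, abs_of_pos hW, div_le_one hW, div_le_one hW]
      exact abs_pd_le_Wg w z
    intro z
    have := hq u z; have := hq v z
    constructor
    · refine (abs_sub _ _).trans ?_; linarith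
    · refine (abs_sub _ _).trans ?_; linarith
  have hY1c : ∀ z, z ∉ V → ContDiffAt ℝ 1 Y1 z := by
    intro z hz
    by_cases hzΩ : z ∈ Ω
    · exact (hHc z hzΩ).mul (hX1c z hzΩ)
    · refine contDiffAt_const (c := (0:ℝ)).congr_of_eventuallyEq ?_
      filter_upwards [hHout z hzΩ hz] with y hy; simp [hY1, hy]
  have hY2c : ∀ z, z ∉ V → ContDiffAt ℝ 1 Y2 z := by
    intro z hz
    by_cases hzΩ : z ∈ Ω
    · exact (hHc z hzΩ).mul (hX2c z hzΩ)
    · refine contDiffAt_const (c := (0:ℝ)).congr_of_eventuallyEq ?_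
      filter_upwards [hHout z hzΩ hz] with y hy; simp [hY2, hy]
  set D : ℝ × ℝ → ℝ := fun z => fderiv ℝ Y1 z (1, 0) + fderiv ℝ Y2 z (0, 1) with hD
  have hDout : ∀ z, z ∉ Ω → z ∉ V → D z = 0 := by
    intro z hz hzV
    have e1 : Y1 =ᶠ[𝓝 z] fun _ => 0 := by
      filter_upwards [hHout z hz hzV] with y hy; simp [hY1, hy]
    have e2 : Y2 =ᶠ[𝓝 z] fun _ => 0 := by
      filter_upwards [hHout z hz hzV] with y hy; simp [hY2, hy]
    simp [hD, e1.fderiv_eq, e2.fderiv_eq]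
  have hDin : ∀ z ∈ Ω, 0 ≤ D z ∧ (D z = 0 → fderiv ℝ H z = 0) := by
    intro z hz
    have dH := (hHc z hz).differentiableAt (by norm_num)
    have d1 := (hX1c z hz).differentiableAt (by norm_num)
    have d2 := (hX2c z hz).differentiableAt (by norm_num)
    have du := (hu z hz).1.differentiableAt (by norm_num)
    have dv := (hv z hz).1.differentiableAt (by norm_num)
    have hdiv : fderiv ℝ X1 z (1, 0) + fderiv ℝ X2 z (0, 1) = 0 := by
      have q1 := (contDiffAt_pd1 (hu z hz).1).div (contDiffAt_Wg (hu z hz).1) (by linarith [one_le_Wg u z])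
      have q2 := (contDiffAt_pd1 (hv z hz).1).div (contDiffAt_Wg (hv z hz).1) (by linarith [one_le_Wg v z])
      have q3 := (contDiffAt_pd2 (hu z hz).1).div (contDiffAt_Wg (hu z hz).1) (by linarith [one_le_Wg u z])
      have q4 := (contDiffAt_pd2 (hv z hz).1).div (contDiffAt_Wg (hv z hz).1) (by linarith [one_le_Wg v z])
      have r1 : DifferentiableAt ℝ (fun z => pd1 u z / Wg u z) z := q1.differentiableAt (by norm_num)
      have r2 : DifferentiableAt ℝ (fun z => pd1 v z / Wg v z) z := q2.differentiableAt (by norm_num)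
      have r3 : DifferentiableAt ℝ (fun z => pd2 u z / Wg u z) z := q3.differentiableAt (by norm_num)
      have r4 : DifferentiableAt ℝ (fun z => pd2 v z / Wg v z) z := q4.differentiableAt (by norm_num)
      have f1 := div_form (hu z hz).1
      have f2 := div_form (hv z hz).1
      rw [(hu z hz).2, zero_div] at f1
      rw [(hv z hz).2, zero_div] at f2
      rw [pd1_eq r1, pd2_eq r3] at f1
      rw [pd1_eq r2, pd2_eq r4] at f2
      rw [hX1, hX2, fderiv_fun_sub r1 r2, fderiv_fun_sub r3 r4]
      rw [ContinuousLinearMap.sub_apply, ContinuousLinearMap.sub_apply]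
      linarith
    have hfH : fderiv ℝ H z = deriv χ (u z - v z) • (fderiv ℝ u z - fderiv ℝ v z) := by
      rw [(hHin z hz).fderiv_eq]
      have h1 := (hχs.differentiable (by norm_num) (u z - v z)).hasDerivAt
      exact (h1.comp_hasFDerivAt z (du.hasFDerivAt.sub dv.hasFDerivAt)).fderiv
    have hχ' : 0 ≤ deriv χ (u z - v z) := hχm.deriv_nonneg
    have hval : D z = deriv χ (u z - v z) * ((pd1 u z - pd1 v z) * X1 z + (pd2 u z - pd2 v z) * X2 z) := by
      have g1 : fderiv ℝ H z (1, 0) = deriv χ (u z - v z) * (pd1 u z - pd1 v z) := by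
        rw [hfH, pd1_eq du, pd1_eq dv]; rfl
      have g2 : fderiv ℝ H z (0, 1) = deriv χ (u z - v z) * (pd2 u z - pd2 v z) := by
        rw [hfH, pd2_eq du, pd2_eq dv]; rfl
      have g3 : D z = (H z * fderiv ℝ X1 z (1, 0) + X1 z * fderiv ℝ H z (1, 0)) +
          (H z * fderiv ℝ X2 z (0, 1) + X2 z * fderiv ℝ H z (0, 1)) := by
        simp only [hD, hY1, hY2]
        rw [fderiv_fun_mul dH d1, fderiv_fun_mul dH d2]; rfl
      rw [g3, g1, g2]
      linear_combination H z * hdiv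
    have hm := mono_field (one_le_Wg u z) (one_le_Wg v z) (Wg_sq u z) (Wg_sq v z)
    rw [hval]
    refine ⟨mul_nonneg hχ' hm.1, fun h => ?_⟩
    rcases mul_eq_zero.1 h with h | h
    · rw [hfH, h, zero_smul]
    · obtain ⟨a1, a2⟩ := hm.2 h
      rw [hfH]
      have : fderiv ℝ u z - fderiv ℝ v z = 0 := by
        refine ContinuousLinearMap.ext fun w => ?_
        change fderiv ℝ u z w - fderiv ℝ v z w = 0
        rw [fderiv_eq_pd du, fderiv_eq_pd dv, a1, a2, sub_self]
      rw [this, smul_zero]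
  have hDc : ∀ z, z ∉ V → ContinuousAt D z := by
    intro z hz
    exact (((hY1c z hz).continuousAt_fderiv (by norm_num)).clm_apply continuousAt_const).add
      (((hY2c z hz).continuousAt_fderiv (by norm_num)).clm_apply continuousAt_const)
  have hK : IsCompact (closure Ω) := hbd.isCompact_closure
  -- the integral estimate
  have hest : ∀ ψ : ℝ × ℝ → ℝ, ContDiff ℝ 1 ψ → (∀ z, 0 ≤ ψ z ∧ ψ z ≤ 1) →
      (∀ p ∈ V, ∀ᶠ z in 𝓝 p, ψ z = 0) → Integrable (fun z => ‖fderiv ℝ ψ z‖) →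
      Integrable (fun z => ψ z * D z) ∧ ∫ z, ψ z * D z ≤ 4 * ∫ z, ‖fderiv ℝ ψ z‖ := by
    intro ψ hψ hψ01 hψV hψi
    have gen : ∀ (Y : ℝ × ℝ → ℝ) (e : ℝ × ℝ), (∀ z, z ∉ V → ContDiffAt ℝ 1 Y z) → (∀ z, z ∉ Ω → Y z = 0) →
        (∀ z, |Y z| ≤ 2) → ‖e‖ ≤ 1 → Integrable (fun z => ψ z * fderiv ℝ Y z e) ∧
        ∫ z, ψ z * fderiv ℝ Y z e ≤ 2 * ∫ z, ‖fderiv ℝ ψ z‖ := by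
      intro Y e hYc hY0 hY2 he
      have hψd : Differentiable ℝ ψ := hψ.differentiable (by norm_num)
      have hsupp : ∀ z, z ∉ closure Ω → Y =ᶠ[𝓝 z] fun _ => 0 := by
        intro z hz
        filter_upwards [isClosed_closure.isOpen_compl.mem_nhds hz] with y hy
        exact hY0 y fun h => hy (subset_closure h)
      have hψV' : ∀ p ∈ V, fderiv ℝ ψ =ᶠ[𝓝 p] fun _ => 0 := by
        intro p hp
        have : ψ =ᶠ[𝓝 p] fun _ => 0 := hψV p hp
        have h2 := this.fderiv (𝕜 := ℝ)
        filter_upwards [h2] with y hy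
        rw [hy]; simp
      have i1 : Integrable (fun z => ψ z * fderiv ℝ Y z e) := by
        apply Continuous.integrable_of_hasCompactSupport
        · rw [continuous_iff_continuousAt]
          intro z
          by_cases hz : z ∈ V
          · refine (continuousAt_const (y := (0:ℝ))).congr ?_
            filter_upwards [hψV z hz] with y hy; simp [hy]
          · exact hψ.continuous.continuousAt.mul
              (((hYc z hz).continuousAt_fderiv (by norm_num)).clm_apply continuousAt_const)
        · refine HasCompactSupport.intro hK fun z hz => ?_
          rw [(hsupp z hz).fderiv_eq]; simp
      have i2 : Integrable (fun z => fderiv ℝ ψ z e * Y z) := by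
        apply Continuous.integrable_of_hasCompactSupport
        · rw [continuous_iff_continuousAt]
          intro z
          by_cases hz : z ∈ V
          · refine (continuousAt_const (y := (0:ℝ))).congr ?_
            filter_upwards [hψV' z hz] with y hy; simp [hy]
          · exact ((hψ.continuous_fderiv (by norm_num)).continuousAt.clm_apply continuousAt_const).mul
              (hYc z hz).continuousAt
        · refine HasCompactSupport.intro hK fun z hz => ?_
          rw [hY0 z fun h => hz (subset_closure h), mul_zero]
      have i3 : Integrable (fun z => ψ z * Y z) := by
        apply Continuous.integrable_of_hasCompactSupport
        · rw [continuous_iff_continuousAt]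
          intro z
          by_cases hz : z ∈ V
          · refine (continuousAt_const (y := (0:ℝ))).congr ?_
            filter_upwards [hψV z hz] with y hy; simp [hy]
          · exact hψ.continuous.continuousAt.mul (hYc z hz).continuousAt
        · refine HasCompactSupport.intro hK fun z hz => ?_
          rw [hY0 z fun h => hz (subset_closure h), mul_zero]
      refine ⟨i1, ?_⟩
      rw [integral_mul_fderiv_eq_neg_fderiv_mul_of_integrable i2 i1 i3
        (fun z _ => hψd z) (fun z hz => ?_), ← integral_neg, ← integral_const_mul]
      · refine integral_mono i2.neg (hψi.const_mul 2) fun z => ?_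
        have a1 : |fderiv ℝ ψ z e| ≤ ‖fderiv ℝ ψ z‖ := by
          have := (fderiv ℝ ψ z).le_opNorm e
          rw [Real.norm_eq_abs] at this
          nlinarith [norm_nonneg (fderiv ℝ ψ z)]
        calc -(fderiv ℝ ψ z e * Y z) ≤ |fderiv ℝ ψ z e * Y z| := neg_le_abs _
          _ = |fderiv ℝ ψ z e| * |Y z| := abs_mul _ _
          _ ≤ ‖fderiv ℝ ψ z‖ * 2 := by gcongr; exact hY2 z
          _ = _ := by ring
      · have hzV : z ∉ V := by
          intro h
          exact notMem_tsupport_iff_eventuallyEq.2 (hψV z h) hz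
        exact (hYc z hzV).differentiableAt (by norm_num)
    have hYb : ∀ X : ℝ × ℝ → ℝ, (∀ z, |X z| ≤ 2) → ∀ z, |H z * X z| ≤ 2 := by
      intro X hX z
      rw [abs_mul, abs_of_nonneg (hH01 z).1]
      nlinarith [hX z, abs_nonneg (X z), (hH01 z).1, (hH01 z).2]
    have g1 := gen Y1 (1, 0) hY1c (fun z hz => by simp [hY1, hH, hz]) (hYb X1 fun z => (hXb z).1)
      (by simp [Prod.norm_def])
    have g2 := gen Y2 (0, 1) hY2c (fun z hz => by simp [hY2, hH, hz]) (hYb X2 fun z => (hXb z).2)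
      (by simp [Prod.norm_def])
    have e : (fun z => ψ z * D z) = fun z => ψ z * fderiv ℝ Y1 z (1, 0) + ψ z * fderiv ℝ Y2 z (0, 1) := by
      funext z; simp only [hD]; ring
    rw [e]
    refine ⟨g1.1.add g2.1, ?_⟩
    rw [integral_add g1.1 g2.1]
    linarith [g1.2, g2.2]
  have hD0 : ∀ z ∈ Ω, D z = 0 := by
    by_contra hne
    push Not at hne
    obtain ⟨z1, hz1, hne⟩ := hne
    have hDpos : 0 < D z1 := lt_of_le_of_ne (hDin z1 hz1).1 (Ne.symm hne)
    have hz1V : z1 ∉ V := fun h => hVd.le_bot ⟨h, hz1⟩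
    have hev : ∀ᶠ z in 𝓝 z1, D z1 / 2 < D z ∧ z ∈ Ω :=
      ((hDc z1 hz1V).eventually (lt_mem_nhds (by linarith))).and (ho.mem_nhds hz1)
    obtain ⟨r1, hr1, hr1s⟩ := Metric.eventually_nhds_iff_ball.1 hev
    obtain ⟨r2, hr2, hr2s⟩ := Metric.isOpen_iff.1 hVc z1 hz1V
    set ρ := min r1 (r2 / 2) with hρ
    have hρ0 : 0 < ρ := by positivity
    set m := (volume (Metric.ball z1 ρ)).toReal with hm
    have hm0 : 0 < m := ENNReal.toReal_pos (Metric.measure_ball_pos _ _ hρ0).ne' measure_ball_lt_top.ne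
    set η := min ρ (D z1 / 2 * m / 8) with hη
    have hη0 : 0 < η := by positivity
    obtain ⟨ψ, h1, h2, h3, h4, h5, h6⟩ := exists_cutoff hV η hη0
    obtain ⟨k1, k2⟩ := hest ψ h1 h2 h3 h4
    have hnn : ∀ z, 0 ≤ ψ z * D z := by
      intro z
      by_cases hz : z ∈ Ω
      · exact mul_nonneg (h2 z).1 (hDin z hz).1
      · by_cases hzV : z ∈ V
        · rw [(h3 z hzV).self_of_nhds, zero_mul]
        · rw [hDout z hz hzV, mul_zero]
    have hlow : D z1 / 2 * m ≤ ∫ z, ψ z * D z := by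
      have s1 : ∫ z in Metric.ball z1 ρ, (D z1 / 2) ≤ ∫ z in Metric.ball z1 ρ, ψ z * D z := by
        refine setIntegral_mono_on (integrableOn_const measure_ball_lt_top.ne) k1.integrableOn measurableSet_ball fun z hz => ?_
        have hz' : dist z z1 < ρ := hz
        have hψ1 : ψ z = 1 := by
          apply h6
          intro p hp
          by_contra hlt
          push Not at hlt
          have : p ∈ Metric.ball z1 r2 := by
            rw [Metric.mem_ball]
            calc dist p z1 ≤ dist p z + dist z z1 := dist_triangle _ _ _
              _ < ρ + ρ := by
                rw [dist_comm p z, dist_eq_norm z p]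
                have := min_le_left ρ (D z1 / 2 * m / 8)
                linarith
              _ ≤ r2 := by have := min_le_right r1 (r2 / 2); linarith
          exact hr2s this hp
        rw [hψ1, one_mul]
        exact (hr1s z (lt_of_lt_of_le hz' (min_le_left _ _))).1.le
      rw [setIntegral_const, smul_eq_mul, measureReal_def] at s1
      calc _ = m * (D z1 / 2) := by ring
        _ ≤ _ := s1
        _ ≤ _ := setIntegral_le_integral k1 (Eventually.of_forall hnn)
    have : η ≤ D z1 / 2 * m / 8 := min_le_right _ _
    have : 0 < D z1 / 2 * m := by positivity
    linarith
  -- conclusion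
  have hHd : ∀ z ∈ Vᶜ, DifferentiableAt ℝ H z ∧ fderiv ℝ H z = 0 := by
    intro z hz
    by_cases hzΩ : z ∈ Ω
    · exact ⟨(hHc z hzΩ).differentiableAt (by norm_num), (hDin z hzΩ).2 (hD0 z hzΩ)⟩
    · have e := hHout z hzΩ hz
      refine ⟨(differentiableAt_const (0:ℝ)).congr_of_eventuallyEq e, ?_⟩
      rw [e.fderiv_eq]; simp
  have hconn : IsPreconnected Vᶜ :=
    (hV.countable.isConnected_compl_of_one_lt_rank (by rw [rank_prod', Module.rank_self]; norm_num)).isPreconnected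
  obtain ⟨z2, hz2⟩ : ∃ z2, z2 ∉ Ω ∪ V := by
    by_contra hall
    push Not at hall
    have : Bornology.IsBounded (univ : Set (ℝ × ℝ)) :=
      (hbd.union hV.isBounded).subset fun z _ => hall z
    exact NormedSpace.unbounded_univ ℝ (ℝ × ℝ) this
  rw [mem_union, not_or] at hz2
  have hcst := hVc.is_const_of_fderiv_eq_zero (𝕜 := ℝ) hconn
    (fun z hz => (hHd z hz).1.differentiableWithinAt) (fun z hz => (hHd z hz).2)
    (fun h => hVd.le_bot ⟨h, hz0⟩ : z0 ∈ Vᶜ) hz2.2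
  have e1 : H z0 = χ (u z0 - v z0) := by simp [hH, hz0]
  have e2 : H z2 = 0 := by simp [hH, hz2.1]
  rw [e1, e2] at hcst
  have : 0 < χ (u z0 - v z0) := Real.smoothTransition.pos_of_pos (by rw [hε]; linarith)
  linarith

/-! ### The Douglas functional -/

/-- the point `e^{is}` of the unit circle. -/
noncomputable def cis (s : ℝ) : ℂ := Complex.exp (s * Complex.I)

lemma cis_def (s : ℝ) : cis s = Complex.exp (s * Complex.I) := rfl

lemma norm_cis (s : ℝ) : ‖cis s‖ = 1 := Complex.norm_exp_ofReal_mul_I s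

lemma cis_ne_zero (s : ℝ) : cis s ≠ 0 := Complex.exp_ne_zero _

lemma cis_add (s t : ℝ) : cis (s + t) = cis s * cis t := by
  simp only [cis, Complex.ofReal_add, add_mul, Complex.exp_add]

lemma cis_eq (s : ℝ) : cis s = ⟨Real.cos s, Real.sin s⟩ := by
  apply Complex.ext
  · simp [cis, Complex.exp_ofReal_mul_I_re]
  · simp [cis, Complex.exp_ofReal_mul_I_im]

lemma cis_re (s : ℝ) : (cis s).re = Real.cos s := by rw [cis_eq]
lemma cis_im (s : ℝ) : (cis s).im = Real.sin s := by rw [cis_eq]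

lemma continuous_cis : Continuous cis := by unfold cis; fun_prop

lemma cis_period (s : ℝ) : cis (s + 2 * π) = cis s := by
  rw [cis_eq, cis_eq]; simp

lemma norm_cis_sub_sq (s t : ℝ) : ‖cis s - cis t‖ ^ 2 = 4 * Real.sin ((s - t) / 2) ^ 2 := by
  rw [← Complex.normSq_eq_norm_sq, Complex.normSq_apply, Complex.sub_re, Complex.sub_im,
    cis_re, cis_re, cis_im, cis_im]
  have h1 := Real.cos_sq_add_sin_sq s
  have h2 := Real.cos_sq_add_sin_sq t
  have h3 : Real.cos (s - t) = 1 - 2 * Real.sin ((s - t) / 2) ^ 2 := by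
    have h4 := Real.cos_sq' ((s - t) / 2)
    have := Real.cos_two_mul ((s - t) / 2)
    rw [show 2 * ((s - t) / 2) = s - t by ring] at this
    rw [this, h4]; ring
  rw [Real.cos_sub] at h3
  nlinarith

/-- squared chord length of the boundary curve. -/
noncomputable def chord (g : ℂ → ℝ) (a b : ℝ) : ℝ := ‖cis a - cis b‖ ^ 2 + (g (cis a) - g (cis b)) ^ 2

/-- the Douglas kernel. -/
noncomputable def dker (s t : ℝ) : ℝ := 1 / (4 * Real.sin ((s - t) / 2) ^ 2)

/-- one period. -/
def per : Set ℝ := Ioc 0 (2 * π)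

/-- Douglas energy. -/
noncomputable def denergy (g : ℂ → ℝ) (α : ℝ → ℝ) : ENNReal :=
  ∫⁻ p in per ×ˢ per, ENNReal.ofReal (chord g (α p.1) (α p.2) * dker p.1 p.2)

/-- admissible monotone reparametrizations, normalized at three points. -/
structure Adm (α : ℝ → ℝ) : Prop where
  mono : Monotone α
  quasi : ∀ s, α (s + 2 * π) = α s + 2 * π
  p0 : α 0 = 0
  p1 : α (2 * π / 3) = 2 * π / 3
  p2 : α (4 * π / 3) = 4 * π / 3

lemma chord_nonneg (g : ℂ → ℝ) (a b : ℝ) : 0 ≤ chord g a b := by unfold chord; positivity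
lemma dker_nonneg (s t : ℝ) : 0 ≤ dker s t := by unfold dker; positivity

lemma measurableSet_per : MeasurableSet per := measurableSet_Ioc

lemma volume_per : volume per = ENNReal.ofReal (2 * π) := by simp [per]

lemma adm_id : Adm (fun s => s) := ⟨monotone_id, fun _ => rfl, rfl, rfl, rfl⟩

lemma Adm.le_dist {α : ℝ → ℝ} (h : Adm α) (s : ℝ) : |α s - s| ≤ 2 * π / 3 := by
  have hq : ∀ n : ℤ, ∀ s, α (s + n * (2 * π)) = α s + n * (2 * π) := by
    intro n
    induction n with
    | zero => simp
    | succ k ih => intro s; push_cast at *; rw [show s + (k + 1) * (2 * π) = (s + k * (2 * π)) + 2 * π by ring, h.quasi, ih]; ring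
    | pred k ih =>
      intro s
      push_cast at *
      have h1 := h.quasi (s + (-k - 1) * (2 * π))
      rw [show s + (-k - 1) * (2 * π) + 2 * π = s + -k * (2 * π) by ring, ih] at h1
      linarith
  have hp := Real.pi_pos
  obtain ⟨n, hn, -⟩ := existsUnique_add_zsmul_mem_Ico (show 0 < 2 * π by positivity) s 0
  simp only [zsmul_eq_mul, zero_add, mem_Ico] at hn
  have e := hq n s
  set x := s + n * (2 * π) with hx
  have e2 : α s - s = α x - x := by rw [e, hx]; ring
  rw [e2]
  have h3 : α (2 * π) = 2 * π := by have := h.quasi 0; rw [h.p0] at this; simpa using this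
  have m1 : ∀ a b, a ≤ b → α a ≤ α b := fun a b hab => h.mono hab
  rw [abs_le]
  rcases le_total x (2 * π / 3) with c | c
  · have := m1 0 x hn.1; have := m1 x _ c; rw [h.p0] at *; rw [h.p1] at *; constructor <;> linarith
  · rcases le_total x (4 * π / 3) with c' | c'
    · have := m1 _ x c; have := m1 x _ c'; rw [h.p1] at *; rw [h.p2] at *; constructor <;> linarith
    · have := m1 _ x c'; have := m1 x _ hn.2.le; rw [h.p2] at *; rw [h3] at *; constructor <;> linarith

lemma continuous_chord {g : ℂ → ℝ} (hg : Continuous g) : Continuous fun p : ℝ × ℝ => chord g p.1 p.2 := by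
  unfold chord
  have := continuous_cis
  fun_prop

lemma measurable_dker : Measurable fun p : ℝ × ℝ => dker p.1 p.2 := by
  unfold dker
  fun_prop

lemma measurable_integrand {g : ℂ → ℝ} (hg : Continuous g) {α : ℝ → ℝ} (h : Measurable α) :
    Measurable fun p : ℝ × ℝ => chord g (α p.1) (α p.2) * dker p.1 p.2 := by
  have h1 : Measurable fun p : ℝ × ℝ => (α p.1, α p.2) := by fun_prop
  exact ((continuous_chord hg).measurable.comp h1).mul measurable_dker

lemma denergy_id_lt_top {g : ℂ → ℝ} {L : ℝ} (hL : ∀ z w, |g z - g w| ≤ L * ‖z - w‖) :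
    denergy g (fun s => s) < ⊤ := by
  have hb : ∀ p : ℝ × ℝ, ENNReal.ofReal (chord g p.1 p.2 * dker p.1 p.2) ≤ ENNReal.ofReal (1 + L ^ 2) := by
    intro p
    apply ENNReal.ofReal_le_ofReal
    have h1 : chord g p.1 p.2 ≤ (1 + L ^ 2) * ‖cis p.1 - cis p.2‖ ^ 2 := by
      unfold chord
      have := hL (cis p.1) (cis p.2)
      have h2 : (g (cis p.1) - g (cis p.2)) ^ 2 ≤ (L * ‖cis p.1 - cis p.2‖) ^ 2 := by
        rw [← sq_abs]; gcongr
      nlinarith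
    rw [norm_cis_sub_sq] at h1
    unfold dker
    rcases eq_or_ne (Real.sin ((p.1 - p.2) / 2)) 0 with h0 | h0
    · rw [h0]; simp; positivity
    · rw [mul_one_div, div_le_iff₀ (by positivity)]; exact h1
  unfold denergy
  calc _ ≤ ∫⁻ p in per ×ˢ per, ENNReal.ofReal (1 + L ^ 2) := lintegral_mono hb
    _ < ⊤ := by
      rw [setLIntegral_const, Measure.volume_eq_prod, Measure.prod_prod, volume_per]
      exact ENNReal.mul_lt_top ENNReal.ofReal_lt_top (ENNReal.mul_lt_top ENNReal.ofReal_lt_top ENNReal.ofReal_lt_top)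

lemma tendsto_chord {g : ℂ → ℝ} (hg : Continuous g) {ι : Type*} {l : Filter ι} {a b : ι → ℝ} {x y : ℝ}
    (ha : Tendsto a l (𝓝 x)) (hb : Tendsto b l (𝓝 y)) : Tendsto (fun k => chord g (a k) (b k)) l (𝓝 (chord g x y)) := by
  have h1 : Tendsto (fun k => cis (a k)) l (𝓝 (cis x)) := (continuous_cis.tendsto x).comp ha
  have h2 : Tendsto (fun k => cis (b k)) l (𝓝 (cis y)) := (continuous_cis.tendsto y).comp hb
  have h3 : Tendsto (fun k => g (cis (a k))) l (𝓝 (g (cis x))) := (hg.tendsto _).comp h1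
  have h4 : Tendsto (fun k => g (cis (b k))) l (𝓝 (g (cis y))) := (hg.tendsto _).comp h2
  exact ((h1.sub h2).norm.pow 2).add ((h3.sub h4).pow 2)

lemma denergy_fatou {g : ℂ → ℝ} (hg : Continuous g) {α : ℝ → ℝ} {A : ℕ → ℝ → ℝ} (hA : ∀ n, Measurable (A n))
    (hlim : ∀ᵐ p : ℝ × ℝ, ENNReal.ofReal (chord g (α p.1) (α p.2) * dker p.1 p.2) =
      liminf (fun k => ENNReal.ofReal (chord g (A k p.1) (A k p.2) * dker p.1 p.2)) atTop) :
    denergy g α ≤ liminf (fun k => denergy g (A k)) atTop := by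
  have e1 : denergy g α = ∫⁻ p in per ×ˢ per, liminf (fun k => ENNReal.ofReal (chord g (A k p.1) (A k p.2) * dker p.1 p.2)) atTop := by
    rw [denergy]
    exact lintegral_congr_ae (ae_restrict_of_ae hlim)
  rw [e1]
  exact lintegral_liminf_le (μ := volume.restrict (per ×ˢ per))
      (f := fun k p => ENNReal.ofReal (chord g (A k p.1) (A k p.2) * dker p.1 p.2)) fun k =>
        (measurable_integrand hg (hA k)).ennreal_ofReal

theorem exists_minimizer {g : ℂ → ℝ} (hg : Continuous g) :
    ∃ α, Adm α ∧ ∀ β, Adm β → denergy g α ≤ denergy g β := by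
  set m := ⨅ β : {β : ℝ → ℝ // Adm β}, denergy g β with hm
  by_cases htop : m = ⊤
  · refine ⟨_, adm_id, fun β hβ => ?_⟩
    have : m ≤ denergy g β := iInf_le (fun β : {β : ℝ → ℝ // Adm β} => denergy g β) ⟨β, hβ⟩
    rw [htop, top_le_iff] at this
    rw [this]; exact le_top
  have hseq : ∀ n : ℕ, ∃ β : ℝ → ℝ, Adm β ∧ denergy g β < m + ((n : ENNReal) + 1)⁻¹ := by
    intro n
    have hlt : m < m + ((n : ENNReal) + 1)⁻¹ := ENNReal.lt_add_right htop (by simp)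
    obtain ⟨β, hβ⟩ := iInf_lt_iff.1 hlt
    exact ⟨β, β.2, hβ⟩
  choose A hA hAm using hseq
  -- ultralimit
  let l : Ultrafilter ℕ := Filter.hyperfilter ℕ
  have hle : (l : Filter ℕ) ≤ atTop := Nat.hyperfilter_le_atTop
  have hex : ∀ s, ∃ a, Tendsto (fun n => A n s) l (𝓝 a) := by
    intro s
    obtain ⟨w, -, hw⟩ := (isCompact_Icc (a := s - 2 * π / 3) (b := s + 2 * π / 3)).ultrafilter_le_nhds
      (l.map fun n => A n s) (by
        rw [le_principal_iff]
        refine Filter.mem_map.2 (univ_mem' fun n => ?_)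
        have := abs_le.1 ((hA n).le_dist s)
        simp only [mem_preimage, mem_Icc]
        constructor <;> linarith)
    exact ⟨w, hw⟩
  choose α hα using hex
  have hadm : Adm α := by
    refine ⟨fun s t hst => le_of_tendsto_of_tendsto' (hα s) (hα t) fun n => (hA n).mono hst, fun s => ?_, ?_, ?_, ?_⟩
    · refine tendsto_nhds_unique (hα _) (((hα s).add_const (2 * π)).congr fun n => ((hA n).quasi s).symm)
    · exact tendsto_nhds_unique (hα _) (tendsto_const_nhds.congr fun n => (hA n).p0.symm)
    · exact tendsto_nhds_unique (hα _) (tendsto_const_nhds.congr fun n => (hA n).p1.symm)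
    · exact tendsto_nhds_unique (hα _) (tendsto_const_nhds.congr fun n => (hA n).p2.symm)
  refine ⟨α, hadm, fun β hβ => ?_⟩
  refine le_trans ?_ (iInf_le (fun β : {β : ℝ → ℝ // Adm β} => denergy g β) ⟨β, hβ⟩)
  change denergy g α ≤ m
  -- subsequence
  obtain ⟨d, hd⟩ := TopologicalSpace.exists_dense_seq ℝ
  have hsub : ∀ k : ℕ, ∃ n ≥ k, ∀ j ≤ k, |A n (d j) - α (d j)| < 1 / ((k : ℝ) + 1) := by
    intro k
    have h1 : ∀ᶠ n in (l : Filter ℕ), ∀ j ∈ Finset.range (k + 1), |A n (d j) - α (d j)| < 1 / ((k : ℝ) + 1) := by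
      rw [Filter.eventually_all_finset]
      intro j _
      have := Metric.tendsto_nhds.1 (hα (d j)) (1 / ((k : ℝ) + 1)) (by positivity)
      simpa [Real.dist_eq] using this
    have h2 : ∀ᶠ n in (l : Filter ℕ), k ≤ n := hle (eventually_ge_atTop k)
    obtain ⟨n, h3, h4⟩ := (h1.and h2).exists
    exact ⟨n, h4, fun j hj => h3 j (Finset.mem_range.2 (by omega))⟩
  choose φ hφ1 hφ2 using hsub
  have hconv : ∀ s, ContinuousAt α s → Tendsto (fun k => A (φ k) s) atTop (𝓝 (α s)) := by
    intro s hs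
    rw [Metric.tendsto_atTop]
    intro ε hε
    obtain ⟨δ, hδ, hδs⟩ := Metric.continuousAt_iff.1 hs (ε / 2) (by positivity)
    obtain ⟨i, hi⟩ := hd.exists_mem_open isOpen_Ioo (nonempty_Ioo.2 (show s - δ < s by linarith))
    obtain ⟨j, hj⟩ := hd.exists_mem_open isOpen_Ioo (nonempty_Ioo.2 (show s < s + δ by linarith))
    obtain ⟨K, hK⟩ := exists_nat_gt (2 / ε)
    refine ⟨max K (max i j), fun k hk => ?_⟩
    have hkK : K ≤ k := (le_max_left _ _).trans hk
    have hki : i ≤ k := (le_max_left _ _).trans ((le_max_right _ _).trans hk)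
    have hkj : j ≤ k := (le_max_right _ _).trans ((le_max_right _ _).trans hk)
    have hk1 : 1 / ((k : ℝ) + 1) < ε / 2 := by
      rw [div_lt_iff₀ (by positivity)]
      rw [div_lt_iff₀ hε] at hK
      have : (K : ℝ) ≤ k := by exact_mod_cast hkK
      nlinarith
    have b1 := abs_lt.1 (hφ2 k i hki)
    have b2 := abs_lt.1 (hφ2 k j hkj)
    have c1 := hδs (x := d i) (by rw [Real.dist_eq, abs_lt]; constructor <;> linarith [hi.1, hi.2])
    have c2 := hδs (x := d j) (by rw [Real.dist_eq, abs_lt]; constructor <;> linarith [hj.1, hj.2])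
    rw [Real.dist_eq, abs_lt] at c1 c2
    have m1 := (hA (φ k)).mono hi.2.le
    have m2 := (hA (φ k)).mono hj.1.le
    rw [Real.dist_eq, abs_lt]
    constructor <;> linarith
  have hae1 : ∀ᵐ s : ℝ, ContinuousAt α s := by
    rw [ae_iff]; exact hadm.mono.countable_not_continuousAt.measure_zero _
  have hae : ∀ᵐ p : ℝ × ℝ, ContinuousAt α p.1 ∧ ContinuousAt α p.2 := by
    rw [Measure.volume_eq_prod]
    exact (Measure.quasiMeasurePreserving_fst.ae hae1).and (Measure.quasiMeasurePreserving_snd.ae hae1)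
  have hlim : ∀ᵐ p : ℝ × ℝ, ENNReal.ofReal (chord g (α p.1) (α p.2) * dker p.1 p.2) =
      liminf (fun k => ENNReal.ofReal (chord g (A (φ k) p.1) (A (φ k) p.2) * dker p.1 p.2)) atTop := by
    filter_upwards [hae] with p hp
    symm
    apply Tendsto.liminf_eq
    refine (ENNReal.continuous_ofReal.tendsto _).comp ?_
    refine Tendsto.mul_const _ ?_
    exact tendsto_chord hg (hconv _ hp.1) (hconv _ hp.2)
  calc denergy g α ≤ liminf (fun k => denergy g (A (φ k))) atTop := 
        denergy_fatou hg (fun k => (hA (φ k)).mono.measurable) hlim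
    _ ≤ liminf (fun k : ℕ => m + ((k : ENNReal) + 1)⁻¹) atTop := by
      refine liminf_le_liminf (Eventually.of_forall fun k => ?_)
      refine (hAm (φ k)).le.trans ?_
      gcongr
      exact hφ1 k
    _ = m := by
      apply Tendsto.liminf_eq
      have h1 : Tendsto (fun k : ℕ => ((k : ENNReal) + 1)⁻¹) atTop (𝓝 0) := by
        have := (tendsto_add_atTop_iff_nat 1).2 ENNReal.tendsto_inv_nat_nhds_zero
        refine this.congr fun k => ?_
        push_cast; rfl
      simpa using h1.const_add m

/-! ### Continuity of finite-energy parametrizations -/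

lemma Adm.quasi_int {α : ℝ → ℝ} (h : Adm α) (n : ℤ) : ∀ s, α (s + n * (2 * π)) = α s + n * (2 * π) := by
  induction n with
  | zero => simp
  | succ k ih => intro s; push_cast at *; rw [show s + (k + 1) * (2 * π) = (s + k * (2 * π)) + 2 * π by ring, h.quasi, ih]; ring
  | pred k ih =>
    intro s
    push_cast at *
    have h1 := h.quasi (s + (-k - 1) * (2 * π))
    rw [show s + (-k - 1) * (2 * π) + 2 * π = s + -k * (2 * π) by ring, ih] at h1
    linarith

lemma dker_shift (s t : ℝ) : dker s (t + 2 * π) = dker s t := by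
  unfold dker
  rw [show (s - (t + 2 * π)) / 2 = (s - t) / 2 - π by ring, Real.sin_sub_pi]; ring

lemma chord_shift (g : ℂ → ℝ) (s t : ℝ) : chord g s (t + 2 * π) = chord g s t := by
  unfold chord; rw [cis_period]

lemma jump_lower {α : ℝ → ℝ} (h : Adm α) (g : ℂ → ℝ) {s0 d : ℝ} (hd : 0 < d)
    (hj : ∀ s < s0, ∀ t > s0, d ≤ α t - α s) : ∃ c > 0, ∀ r, 0 < r → r ≤ π / 6 →
      ∀ s ∈ Ico (s0 - r) s0, ∀ t ∈ Ioc s0 (s0 + r), c / r ^ 2 ≤ chord g (α s) (α t) * dker s t := by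
  have hp := Real.pi_pos
  have hd5 : d ≤ 5 * π / 3 := by
    have := hj (s0 - π / 6) (by linarith) (s0 + π / 6) (by linarith)
    have a1 := abs_le.1 (h.le_dist (s0 - π / 6))
    have a2 := abs_le.1 (h.le_dist (s0 + π / 6))
    linarith
  set m := min (Real.sin (d / 2)) (Real.sin (5 * π / 6)) with hm
  have hm0 : 0 < m := lt_min (Real.sin_pos_of_pos_of_lt_pi (by linarith) (by linarith))
    (Real.sin_pos_of_pos_of_lt_pi (by linarith) (by linarith))
  refine ⟨m ^ 2, by positivity, fun r hr hr6 s hs t ht => ?_⟩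
  have a1 := abs_le.1 (h.le_dist s)
  have a2 := abs_le.1 (h.le_dist t)
  have h1 := hj s hs.2 t ht.1
  have h2 : α t - α s ≤ 5 * π / 3 := by linarith [hs.1, ht.2]
  have h3 : m ≤ Real.sin ((α t - α s) / 2) := by
    have := strictConcaveOn_sin_Icc.concaveOn.min_le_of_mem_Icc (x := d / 2) (y := 5 * π / 6)
      (z := (α t - α s) / 2) ⟨by linarith, by linarith⟩ ⟨by linarith, by linarith⟩ ⟨by linarith, by linarith⟩
    exact this
  have h4 : 4 * m ^ 2 ≤ chord g (α s) (α t) := by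
    unfold chord
    rw [norm_cis_sub_sq]
    have : Real.sin ((α s - α t) / 2) ^ 2 = Real.sin ((α t - α s) / 2) ^ 2 := by
      rw [show (α s - α t) / 2 = -((α t - α s) / 2) by ring, Real.sin_neg]; ring
    rw [this]
    have : m ^ 2 ≤ Real.sin ((α t - α s) / 2) ^ 2 := by gcongr
    nlinarith [sq_nonneg (g (cis (α s)) - g (cis (α t)))]
  have h5 : 1 / (4 * r ^ 2) ≤ dker s t := by
    unfold dker
    have e : Real.sin ((s - t) / 2) ^ 2 = Real.sin ((t - s) / 2) ^ 2 := by
      rw [show (s - t) / 2 = -((t - s) / 2) by ring, Real.sin_neg]; ring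
    rw [e]
    have q1 : 0 < Real.sin ((t - s) / 2) := Real.sin_pos_of_pos_of_lt_pi (by linarith [hs.2, ht.1])
      (by linarith [hs.1, ht.2])
    have q2 : Real.sin ((t - s) / 2) ≤ r := (Real.sin_le (by linarith [hs.2, ht.1])).trans (by linarith [hs.1, ht.2])
    gcongr
  calc m ^ 2 / r ^ 2 = (4 * m ^ 2) * (1 / (4 * r ^ 2)) := by field_simp
    _ ≤ _ := by gcongr; exact chord_nonneg _ _ _

theorem Adm.continuous {α : ℝ → ℝ} (h : Adm α) {g : ℂ → ℝ} (hE : denergy g α < ⊤) : Continuous α := by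
  have hp := Real.pi_pos
  rw [continuous_iff_continuousAt]
  intro x
  by_contra hx
  rw [h.mono.continuousAt_iff_leftLim_eq_rightLim] at hx
  have hlt : Function.leftLim α x < Function.rightLim α x :=
    lt_of_le_of_ne (h.mono.leftLim_le_rightLim le_rfl) hx
  obtain ⟨n, hn, -⟩ := existsUnique_add_zsmul_mem_Ioc (show 0 < 2 * π by positivity) x 0
  simp only [zsmul_eq_mul, zero_add] at hn
  set s0 := x + n * (2 * π) with hs0
  obtain ⟨c, hc, hlow⟩ := jump_lower h g (s0 := s0) (sub_pos.2 hlt) (by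
    intro s hs t ht
    have e1 := h.quasi_int n (s - n * (2 * π))
    have e2 := h.quasi_int n (t - n * (2 * π))
    simp only [sub_add_cancel] at e1 e2
    have i1 := h.mono.le_leftLim (show s - n * (2 * π) < x by linarith)
    have i2 := h.mono.rightLim_le (show x < t - n * (2 * π) by linarith)
    linarith)
  -- blocks
  have hblock : ∃ r0 > 0, ∀ r, 0 < r → r ≤ r0 → ∃ A B : Set ℝ, MeasurableSet A ∧ MeasurableSet B ∧ A ⊆ per ∧ B ⊆ per ∧
      volume A = ENNReal.ofReal r ∧ volume B = ENNReal.ofReal r ∧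
      ∀ s ∈ A, ∀ t ∈ B, c / r ^ 2 ≤ chord g (α s) (α t) * dker s t := by
    rcases hn.2.lt_or_eq with hl | he
    · refine ⟨min (π / 6) (min (s0 / 2) (2 * π - s0)), by have := hn.1; refine lt_min (by positivity) (lt_min (by linarith) (by linarith)), fun r hr hr0 => ?_⟩
      have k1 := hr0.trans (min_le_left _ _)
      have k2 := (hr0.trans (min_le_right _ _)).trans (min_le_left _ _)
      have k3 := (hr0.trans (min_le_right _ _)).trans (min_le_right _ _)
      refine ⟨Ico (s0 - r) s0, Ioc s0 (s0 + r), measurableSet_Ico, measurableSet_Ioc, ?_, ?_, by simp, by simp, hlow r hr k1⟩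
      · intro s hs; exact ⟨by linarith [hs.1], by linarith [hs.2]⟩
      · intro s hs; exact ⟨by linarith [hs.1, hn.1], by linarith [hs.2]⟩
    · refine ⟨π / 6, by positivity, fun r hr hr0 => ?_⟩
      refine ⟨Ico (s0 - r) s0, Ioc 0 r, measurableSet_Ico, measurableSet_Ioc, ?_, ?_, by simp, by simp, ?_⟩
      · intro s hs; exact ⟨by linarith [hs.1], by linarith [hs.2]⟩
      · intro s hs; exact ⟨hs.1, by linarith [hs.2]⟩
      · intro s hs t ht
        have := hlow r hr hr0 s hs (t + 2 * π) ⟨by linarith [ht.1], by linarith [ht.2]⟩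
        rwa [h.quasi, chord_shift, dker_shift] at this
  obtain ⟨r0, hr0, hb⟩ := hblock
  obtain ⟨δ, hδ, hδs⟩ := exists_pos_setLIntegral_lt_of_measure_lt (μ := volume.restrict (per ×ˢ per)) hE.ne
    (ε := ENNReal.ofReal c) (by simpa using hc)
  have hex : ∃ r, 0 < r ∧ r ≤ r0 ∧ ENNReal.ofReal (r * r) < δ := by
    have ht : Tendsto (fun r : ℝ => ENNReal.ofReal (r * r)) (𝓝[>] 0) (𝓝 0) := by
      have : Tendsto (fun r : ℝ => ENNReal.ofReal (r * r)) (𝓝 0) (𝓝 (ENNReal.ofReal (0 * 0))) :=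
        (ENNReal.continuous_ofReal.comp (by fun_prop : Continuous fun r : ℝ => r * r)).tendsto 0
      simp only [mul_zero, ENNReal.ofReal_zero] at this
      exact this.mono_left nhdsWithin_le_nhds
    have e1 := ht.eventually (gt_mem_nhds hδ)
    have e2 : ∀ᶠ r : ℝ in 𝓝[>] 0, r ∈ Ioc 0 r0 := Ioc_mem_nhdsGT hr0
    obtain ⟨r, h1, h2⟩ := (e1.and e2).exists
    exact ⟨r, h2.1, h2.2, h1⟩
  obtain ⟨r, hr, hrr, hrd⟩ := hex
  obtain ⟨A, B, hA, hB, hAp, hBp, vA, vB, hlo⟩ := hb r hr hrr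
  have hsub : A ×ˢ B ⊆ per ×ˢ per := prod_mono hAp hBp
  have hvol : volume (A ×ˢ B) = ENNReal.ofReal (r * r) := by
    rw [Measure.volume_eq_prod, Measure.prod_prod, vA, vB, ENNReal.ofReal_mul hr.le]
  have hres : (volume.restrict (per ×ˢ per)) (A ×ˢ B) = ENNReal.ofReal (r * r) := by
    rw [Measure.restrict_apply (hA.prod hB), inter_eq_left.2 hsub, hvol]
  have hfin := hδs (A ×ˢ B) (by rw [hres]; exact hrd)
  rw [Measure.restrict_restrict (hA.prod hB), inter_eq_left.2 hsub] at hfin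
  refine absurd hfin (not_lt.2 ?_)
  calc ENNReal.ofReal c = ENNReal.ofReal (c / r ^ 2) * volume (A ×ˢ B) := by
        rw [hvol, ← ENNReal.ofReal_mul (by positivity)]; congr 1; field_simp
    _ = ∫⁻ p in A ×ˢ B, ENNReal.ofReal (c / r ^ 2) := by rw [setLIntegral_const]
    _ ≤ _ := setLIntegral_mono' (hA.prod hB) fun p hp => ENNReal.ofReal_le_ofReal (hlo p.1 hp.1 p.2 hp.2)

/-! ### First variation of the Douglas energy -/

lemma variation_bounds {v v' : ℝ → ℝ} (hv : ∀ s, HasDerivAt v (v' s) s) (hc : Continuous v')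
    (hper : ∀ s, v (s + 2 * π) = v s) : ∃ L > 0, (∀ s, |v' s| ≤ L) ∧ ∀ s t, |v s - v t| ≤ L * |Real.sin ((s - t) / 2)| := by
  have hp := Real.pi_pos
  have hper' : Function.Periodic v' (2 * π) := by
    intro s
    have h1 : HasDerivAt (fun s => v (s + 2 * π)) (v' (s + 2 * π)) s := (hv (s + 2 * π)).comp_add_const s (2 * π)
    have h2 : (fun s => v (s + 2 * π)) = v := funext hper
    rw [h2] at h1
    exact h1.unique (hv s)
  obtain ⟨L, hL⟩ : ∃ L, ∀ s, |v' s| ≤ L := by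
    have := hper'.isBounded_of_continuous (by positivity) hc
    obtain ⟨L, hL⟩ := this.exists_norm_le
    exact ⟨L, fun s => hL _ (mem_range_self s)⟩
  have hL0 : 0 ≤ L := (abs_nonneg _).trans (hL 0)
  have hlip : ∀ s t, |v s - v t| ≤ L * |s - t| := fun s t =>
    Convex.norm_image_sub_le_of_norm_hasDerivWithin_le (fun x _ => (hv x).hasDerivWithinAt) (fun x _ => hL x)
      convex_univ (mem_univ t) (mem_univ s)
  refine ⟨max (π * L) (L + 1), lt_max_of_lt_right (by linarith), fun s => (hL s).trans ((by linarith : L ≤ L + 1).trans (le_max_right _ _)), fun s t => ?_⟩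
  refine le_trans ?_ (mul_le_mul_of_nonneg_right (le_max_left _ _) (abs_nonneg _))
  set n : ℤ := round ((s - t) / (2 * π))
  have hvp : v (s - n * (2 * π)) = v s := by
    have : Function.Periodic v (2 * π) := hper
    exact this.sub_int_mul_eq n
  have hn : |(s - t) / (2 * π) - n| ≤ 1 / 2 := abs_sub_round _
  set y := (s - t) / 2 - n * π with hy
  have hy2 : |y| ≤ π / 2 := by
    have : y = ((s - t) / (2 * π) - n) * π := by rw [hy]; field_simp
    rw [this, abs_mul, abs_of_pos hp]; nlinarith
  have hsin : |Real.sin y| = |Real.sin ((s - t) / 2)| := by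
    rw [hy, Real.sin_sub_int_mul_pi, abs_mul]
    simp [abs_zpow]
  have h1 := hlip (s - n * (2 * π)) t
  rw [hvp, show s - n * (2 * π) - t = 2 * y by rw [hy]; ring, abs_mul, abs_two] at h1
  have h2 := Real.mul_abs_le_abs_sin hy2
  rw [hsin] at h2
  have h3 : 2 * |y| ≤ π * |Real.sin ((s - t) / 2)| := by
    have : 2 * |y| = π * (2 / π * |y|) := by field_simp
    rw [this]; gcongr
  calc |v s - v t| ≤ L * (2 * |y|) := h1
    _ ≤ L * (π * |Real.sin ((s - t) / 2)|) := by gcongr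
    _ = _ := by ring

lemma energy_change {α : ℝ → ℝ} (h : Adm α) (g : ℂ → ℝ) {v v' : ℝ → ℝ} (hv : ∀ s, HasDerivAt v (v' s) s)
    (hper : ∀ s, v (s + 2 * π) = v s) (h0 : v 0 = 0) (h1 : v (2 * π / 3) = 0) (h2 : v (4 * π / 3) = 0)
    {L ε : ℝ} (hL : ∀ s, |v' s| ≤ L) (hε : |ε| * L ≤ 1 / 2) :
    ∃ β, Adm β ∧ denergy g β = ∫⁻ p in per ×ˢ per, ENNReal.ofReal ((1 + ε * v' p.1) * (1 + ε * v' p.2) *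
      (chord g (α p.1) (α p.2) * dker (p.1 + ε * v p.1) (p.2 + ε * v p.2))) := by
  have hp := Real.pi_pos
  have hpos : ∀ s, 0 < 1 + ε * v' s := by
    intro s
    have : |ε * v' s| ≤ 1 / 2 := by
      rw [abs_mul]; exact (mul_le_mul_of_nonneg_left (hL s) (abs_nonneg _)).trans hε
    have := (abs_le.1 this).1
    linarith
  set σ : ℝ → ℝ := fun s => s + ε * v s with hσ
  have hd : ∀ s, HasDerivAt σ (1 + ε * v' s) s := fun s => (hasDerivAt_id s).add ((hv s).const_mul ε)
  have hmono : StrictMono σ := strictMono_of_hasDerivAt_pos hd hpos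
  have hcont : Continuous σ := continuous_iff_continuousAt.2 fun s => (hd s).continuousAt
  have hq : ∀ s, σ (s + 2 * π) = σ s + 2 * π := by intro s; simp only [hσ, hper]; ring
  have s0 : σ 0 = 0 := by simp [hσ, h0]
  have s1 : σ (2 * π / 3) = 2 * π / 3 := by simp [hσ, h1]
  have s2 : σ (4 * π / 3) = 4 * π / 3 := by simp [hσ, h2]
  have s3 : σ (2 * π) = 2 * π := by have := hq 0; rw [s0] at this; simpa using this
  have hadm : Adm σ := ⟨hmono.monotone, hq, s0, s1, s2⟩
  have hsurj : Function.Surjective σ := by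
    apply hcont.surjective
    · refine tendsto_atTop_mono (f := fun s => s - 2 * π / 3) (fun s => ?_) (tendsto_atTop_add_const_right _ _ tendsto_id)
      have := abs_le.1 (hadm.le_dist s); linarith
    · refine tendsto_atBot_mono (f := fun s => s + 2 * π / 3) (fun s => ?_) (tendsto_atBot_add_const_right _ _ tendsto_id)
      have := abs_le.1 (hadm.le_dist s); linarith
  set e : ℝ ≃o ℝ := hmono.orderIsoOfSurjective σ hsurj with he
  have hes : ∀ s, e.symm (σ s) = s := fun s => e.symm_apply_apply s
  have hse : ∀ s, σ (e.symm s) = s := fun s => e.apply_symm_apply s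
  have himg : σ '' per = per := by
    apply Subset.antisymm
    · rintro _ ⟨s, hs, rfl⟩
      refine ⟨?_, ?_⟩
      · rw [← s0]; exact hmono hs.1
      · rw [← s3]; exact hmono.monotone hs.2
    · intro s hs
      refine ⟨e.symm s, ⟨?_, ?_⟩, hse s⟩
      · rw [← hmono.lt_iff_lt, hse, s0]; exact hs.1
      · rw [← hmono.le_iff_le, hse, s3]; exact hs.2
  refine ⟨fun s => α (e.symm s), ⟨h.mono.comp e.symm.monotone, fun s => ?_, ?_, ?_, ?_⟩, ?_⟩
  · have : e.symm (s + 2 * π) = e.symm s + 2 * π := by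
      apply hmono.injective; rw [hse, hq, hse]
    simp only [this, h.quasi]
  · have := hes 0; rw [s0] at this; simp only [this, h.p0]
  · have := hes (2 * π / 3); rw [s1] at this; simp only [this, h.p1]
  · have := hes (4 * π / 3); rw [s2] at this; simp only [this, h.p2]
  · have hprod : (Prod.map σ σ) '' (per ×ˢ per) = per ×ˢ per := by rw [prodMap_image_prod, himg]
    have key := lintegral_image_eq_lintegral_abs_det_fderiv_mul (volume : Measure (ℝ × ℝ))
      (s := per ×ˢ per) (f := Prod.map σ σ)
      (f' := fun p => ((1 + ε * v' p.1) • ContinuousLinearMap.id ℝ ℝ).prodMap ((1 + ε * v' p.2) • ContinuousLinearMap.id ℝ ℝ))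
      (measurableSet_per.prod measurableSet_per) (by
        intro p _
        apply HasFDerivAt.hasFDerivWithinAt
        have a1 : HasFDerivAt σ ((1 + ε * v' p.1) • ContinuousLinearMap.id ℝ ℝ) p.1 := by
          have := (hd p.1).hasFDerivAt
          refine this.congr_fderiv ?_
          ext; simp
        have a2 : HasFDerivAt σ ((1 + ε * v' p.2) • ContinuousLinearMap.id ℝ ℝ) p.2 := by
          have := (hd p.2).hasFDerivAt
          refine this.congr_fderiv ?_
          ext; simp
        exact HasFDerivAt.prodMap p a1 a2)
      ((hmono.injective.prodMap hmono.injective).injOn)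
      (fun q => ENNReal.ofReal (chord g (α (e.symm q.1)) (α (e.symm q.2)) * dker q.1 q.2))
    rw [hprod] at key
    rw [denergy, key]
    refine lintegral_congr fun p => ?_
    have hdet : (((1 + ε * v' p.1) • ContinuousLinearMap.id ℝ ℝ).prodMap ((1 + ε * v' p.2) • ContinuousLinearMap.id ℝ ℝ)).det
        = (1 + ε * v' p.1) * (1 + ε * v' p.2) := by
      rw [ContinuousLinearMap.det, ContinuousLinearMap.coe_prodMap, LinearMap.det_prodMap]
      simp
    rw [hdet, abs_of_pos (mul_pos (hpos _) (hpos _)), ← ENNReal.ofReal_mul (mul_pos (hpos _) (hpos _)).le]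
    simp only [Prod.map_fst, Prod.map_snd, hes]
    rfl

/-- kernel of the first variation. -/
noncomputable def bker (v v' : ℝ → ℝ) (s t : ℝ) : ℝ :=
  (v' s + v' t) / (4 * Real.sin ((s - t) / 2) ^ 2) - (v s - v t) * Real.cos ((s - t) / 2) / (4 * Real.sin ((s - t) / 2) ^ 3)

lemma deriv_kernel {a b x δ ε : ℝ} (hs : Real.sin (x + ε * δ) ≠ 0) :
    HasDerivAt (fun ε => (1 + ε * a) * (1 + ε * b) * (1 / (4 * Real.sin (x + ε * δ) ^ 2)))
      ((a * (1 + ε * b) + (1 + ε * a) * b) * (1 / (4 * Real.sin (x + ε * δ) ^ 2)) -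
        (1 + ε * a) * (1 + ε * b) * (2 * δ * Real.cos (x + ε * δ) / (4 * Real.sin (x + ε * δ) ^ 3))) ε := by
  have h1 : HasDerivAt (fun ε : ℝ => 1 + ε * a) a ε := by
    simpa using ((hasDerivAt_id ε).mul_const a).const_add 1
  have h2 : HasDerivAt (fun ε : ℝ => 1 + ε * b) b ε := by
    simpa using ((hasDerivAt_id ε).mul_const b).const_add 1
  have h3 : HasDerivAt (fun ε : ℝ => x + ε * δ) δ ε := by
    simpa using ((hasDerivAt_id ε).mul_const δ).const_add x
  have h4 : HasDerivAt (fun ε => 4 * Real.sin (x + ε * δ) ^ 2) (4 * (2 * Real.sin (x + ε * δ) * (Real.cos (x + ε * δ) * δ))) ε := by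
    simpa using (h3.sin.pow 2).const_mul 4
  have h5 := (h1.mul h2).mul (h4.inv (by positivity))
  simp only [one_div]
  refine h5.congr_deriv ?_
  simp only [Pi.mul_apply, Pi.inv_apply]
  field_simp
  ring

lemma kernel_bound {a b x δ ε L : ℝ} (hL : 0 < L) (ha : |a| ≤ L) (hb : |b| ≤ L) (hδ : |δ| ≤ L * |Real.sin x|)
    (hε : |ε| * L ≤ 1 / 2) : |(a * (1 + ε * b) + (1 + ε * a) * b) * (1 / (4 * Real.sin (x + ε * δ) ^ 2)) -
        (1 + ε * a) * (1 + ε * b) * (2 * δ * Real.cos (x + ε * δ) / (4 * Real.sin (x + ε * δ) ^ 3))|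
      ≤ (100 * L) * (1 / (4 * Real.sin x ^ 2)) ∧ (Real.sin x ≠ 0 → Real.sin (x + ε * δ) ≠ 0) := by
  have hS : |Real.sin x| / 2 ≤ |Real.sin (x + ε * δ)| := by
    have h1 := Real.abs_sin_sub_sin_le (x + ε * δ) x
    rw [add_sub_cancel_left, abs_mul] at h1
    have h2 : |ε| * |δ| ≤ |Real.sin x| / 2 := by
      calc |ε| * |δ| ≤ |ε| * (L * |Real.sin x|) := by gcongr
        _ = (|ε| * L) * |Real.sin x| := by ring
        _ ≤ 1 / 2 * |Real.sin x| := by gcongr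
        _ = _ := by ring
    have h3 := abs_sub_abs_le_abs_sub (Real.sin x) (Real.sin (x + ε * δ))
    rw [abs_sub_comm] at h3
    linarith
  rcases eq_or_ne (Real.sin x) 0 with h0 | h0
  · have hd0 : δ = 0 := by rw [h0] at hδ; simpa using hδ
    subst hd0
    simp [h0]
  have hx : 0 < |Real.sin x| := abs_pos.2 h0
  set y := |Real.sin x|
  set S := |Real.sin (x + ε * δ)| with hSd
  have hSp : 0 < S := by linarith
  have e1 : |1 + ε * a| ≤ 3 / 2 := by
    have : |ε * a| ≤ 1 / 2 := by rw [abs_mul]; exact (mul_le_mul_of_nonneg_left ha (abs_nonneg _)).trans hε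
    have h3 := abs_add_le 1 (ε * a); rw [abs_one] at h3; linarith
  have e2 : |1 + ε * b| ≤ 3 / 2 := by
    have : |ε * b| ≤ 1 / 2 := by rw [abs_mul]; exact (mul_le_mul_of_nonneg_left hb (abs_nonneg _)).trans hε
    have h3 := abs_add_le 1 (ε * b); rw [abs_one] at h3; linarith
  refine ⟨?_, fun _ => abs_pos.1 hSp⟩
  have t1 : |(a * (1 + ε * b) + (1 + ε * a) * b) * (1 / (4 * Real.sin (x + ε * δ) ^ 2))| ≤ (3 * L) * (1 / y ^ 2) := by
    rw [abs_mul]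
    gcongr
    · refine (abs_add_le _ _).trans ?_
      rw [abs_mul, abs_mul]
      have : |a| * |1 + ε * b| ≤ L * (3 / 2) := by gcongr
      have : |1 + ε * a| * |b| ≤ (3 / 2) * L := by gcongr
      linarith
    · rw [abs_div, abs_one, abs_mul, abs_pow, ← hSd]
      have : |(4 : ℝ)| = 4 := by norm_num
      rw [this]
      apply one_div_le_one_div_of_le (by positivity)
      nlinarith
  have t2 : |(1 + ε * a) * (1 + ε * b) * (2 * δ * Real.cos (x + ε * δ) / (4 * Real.sin (x + ε * δ) ^ 3))| ≤
      (9 / 4) * (4 * L * (1 / y ^ 2)) := by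
    rw [abs_mul, abs_mul, abs_div, abs_mul, abs_mul, abs_mul, abs_pow, ← hSd]
    have f4 : |(4 : ℝ)| = 4 := by norm_num
    rw [f4, abs_two]
    have hc := Real.abs_cos_le_one (x + ε * δ)
    have : 2 * |δ| * |Real.cos (x + ε * δ)| / (4 * S ^ 3) ≤ 4 * L * (1 / y ^ 2) := by
      calc 2 * |δ| * |Real.cos (x + ε * δ)| / (4 * S ^ 3) ≤ 2 * (L * y) * 1 / (4 * (y / 2) ^ 3) := by gcongr
        _ = _ := by field_simp; norm_num
    calc |1 + ε * a| * |1 + ε * b| * _ ≤ (3 / 2 * (3 / 2)) * (4 * L * (1 / y ^ 2)) := by gcongr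
      _ = _ := by ring
  have e3 : Real.sin x ^ 2 = y ^ 2 := (sq_abs _).symm
  rw [e3]
  refine (abs_sub _ _).trans ?_
  calc _ ≤ (3 * L) * (1 / y ^ 2) + (9 / 4) * (4 * L * (1 / y ^ 2)) := add_le_add t1 t2
    _ = 12 * L / y ^ 2 := by ring
    _ ≤ 25 * L / y ^ 2 := by gcongr; linarith
    _ = _ := by field_simp; norm_num

lemma kernel_bound2 {a b x δ ε L : ℝ} (hL : 0 < L) (ha : |a| ≤ L) (hb : |b| ≤ L) (hδ : |δ| ≤ L * |Real.sin x|)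
    (hε : |ε| * L ≤ 1 / 2) : 0 ≤ (1 + ε * a) * (1 + ε * b) * (1 / (4 * Real.sin (x + ε * δ) ^ 2)) ∧
    (1 + ε * a) * (1 + ε * b) * (1 / (4 * Real.sin (x + ε * δ) ^ 2)) ≤ 9 * (1 / (4 * Real.sin x ^ 2)) := by
  have hS : |Real.sin x| / 2 ≤ |Real.sin (x + ε * δ)| := by
    have h1 := Real.abs_sin_sub_sin_le (x + ε * δ) x
    rw [add_sub_cancel_left, abs_mul] at h1
    have h2 : |ε| * |δ| ≤ |Real.sin x| / 2 := by
      calc |ε| * |δ| ≤ |ε| * (L * |Real.sin x|) := by gcongr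
        _ = (|ε| * L) * |Real.sin x| := by ring
        _ ≤ 1 / 2 * |Real.sin x| := by gcongr
        _ = _ := by ring
    have h3 := abs_sub_abs_le_abs_sub (Real.sin x) (Real.sin (x + ε * δ))
    rw [abs_sub_comm] at h3
    linarith
  have e1 : |ε * a| ≤ 1 / 2 := by rw [abs_mul]; exact (mul_le_mul_of_nonneg_left ha (abs_nonneg _)).trans hε
  have e2 : |ε * b| ≤ 1 / 2 := by rw [abs_mul]; exact (mul_le_mul_of_nonneg_left hb (abs_nonneg _)).trans hε
  have e1' := abs_le.1 e1
  have e2' := abs_le.1 e2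
  have p1 : 0 ≤ 1 + ε * a := by linarith
  have p2 : 0 ≤ 1 + ε * b := by linarith
  refine ⟨by positivity, ?_⟩
  rcases eq_or_ne (Real.sin x) 0 with h0 | h0
  · have hd0 : δ = 0 := by rw [h0] at hδ; simpa using hδ
    subst hd0
    simp [h0]
  have hx : 0 < |Real.sin x| := abs_pos.2 h0
  rw [← sq_abs (Real.sin x), ← sq_abs (Real.sin (x + ε * δ))]
  calc (1 + ε * a) * (1 + ε * b) * (1 / (4 * |Real.sin (x + ε * δ)| ^ 2))
      ≤ (3 / 2 * (3 / 2)) * (1 / (4 * (|Real.sin x| / 2) ^ 2)) := by gcongr <;> linarith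
    _ = _ := by field_simp; norm_num

lemma measurable_chord {g : ℂ → ℝ} (hg : Continuous g) {α : ℝ → ℝ} (h : Measurable α) :
    Measurable fun p : ℝ × ℝ => chord g (α p.1) (α p.2) := by
  have h1 : Measurable fun p : ℝ × ℝ => cis (α p.1) := continuous_cis.measurable.comp (h.comp measurable_fst)
  have h2 : Measurable fun p : ℝ × ℝ => cis (α p.2) := continuous_cis.measurable.comp (h.comp measurable_snd)
  have h3 : Measurable fun p : ℝ × ℝ => g (cis (α p.1)) := hg.measurable.comp h1
  have h4 : Measurable fun p : ℝ × ℝ => g (cis (α p.2)) := hg.measurable.comp h2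
  unfold chord
  fun_prop

theorem first_variation {α : ℝ → ℝ} (h : Adm α) {g : ℂ → ℝ} (hg : Continuous g) (hE : denergy g α < ⊤)
    (hmin : ∀ β, Adm β → denergy g α ≤ denergy g β) {v v' : ℝ → ℝ} (hv : ∀ s, HasDerivAt v (v' s) s)
    (hc : Continuous v') (hper : ∀ s, v (s + 2 * π) = v s) (h0 : v 0 = 0) (h1 : v (2 * π / 3) = 0)
    (h2 : v (4 * π / 3) = 0) :
    ∫ p in per ×ˢ per, chord g (α p.1) (α p.2) * bker v v' p.1 p.2 = 0 := by
  obtain ⟨L, hL, hv'L, hvL⟩ := variation_bounds hv hc hper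
  have hcv : Continuous v := continuous_iff_continuousAt.2 fun s => (hv s).continuousAt
  set μ : Measure (ℝ × ℝ) := volume.restrict (per ×ˢ per) with hμ
  let ch : ℝ × ℝ → ℝ := fun p => chord g (α p.1) (α p.2)
  have hch : Measurable ch := measurable_chord hg h.mono.measurable
  let x : ℝ × ℝ → ℝ := fun p => (p.1 - p.2) / 2
  let δ : ℝ × ℝ → ℝ := fun p => (v p.1 - v p.2) / 2
  let F : ℝ → ℝ × ℝ → ℝ := fun ε p => ch p *
    ((1 + ε * v' p.1) * (1 + ε * v' p.2) * (1 / (4 * Real.sin (x p + ε * δ p) ^ 2)))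
  let F' : ℝ → ℝ × ℝ → ℝ := fun ε p => ch p *
    ((v' p.1 * (1 + ε * v' p.2) + (1 + ε * v' p.1) * v' p.2) * (1 / (4 * Real.sin (x p + ε * δ p) ^ 2)) -
        (1 + ε * v' p.1) * (1 + ε * v' p.2) * (2 * δ p * Real.cos (x p + ε * δ p) / (4 * Real.sin (x p + ε * δ p) ^ 3)))
  have hδ : ∀ p, |δ p| ≤ L * |Real.sin (x p)| := by
    intro p
    have := hvL p.1 p.2
    simp only [δ, x, abs_div, abs_two]
    have := abs_nonneg (v p.1 - v p.2)
    linarith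
  have hch0 : ∀ p, 0 ≤ ch p := fun p => chord_nonneg _ _ _
  have hFm : ∀ ε, Measurable (F ε) := by
    intro ε
    have m1 : Measurable fun p : ℝ × ℝ => v p.1 := hcv.measurable.comp measurable_fst
    have m2 : Measurable fun p : ℝ × ℝ => v p.2 := hcv.measurable.comp measurable_snd
    have m3 : Measurable fun p : ℝ × ℝ => v' p.1 := hc.measurable.comp measurable_fst
    have m4 : Measurable fun p : ℝ × ℝ => v' p.2 := hc.measurable.comp measurable_snd
    simp only [F, x, δ]
    fun_prop
  have hF'm : ∀ ε, Measurable (F' ε) := by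
    intro ε
    have m1 : Measurable fun p : ℝ × ℝ => v p.1 := hcv.measurable.comp measurable_fst
    have m2 : Measurable fun p : ℝ × ℝ => v p.2 := hcv.measurable.comp measurable_snd
    have m3 : Measurable fun p : ℝ × ℝ => v' p.1 := hc.measurable.comp measurable_fst
    have m4 : Measurable fun p : ℝ × ℝ => v' p.2 := hc.measurable.comp measurable_snd
    simp only [F', x, δ]
    fun_prop
  have hFeq : ∀ ε p, (1 + ε * v' p.1) * (1 + ε * v' p.2) *
      (chord g (α p.1) (α p.2) * dker (p.1 + ε * v p.1) (p.2 + ε * v p.2)) = F ε p := by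
    intro ε p
    simp only [F, ch, x, δ, dker]
    rw [show (p.1 + ε * v p.1 - (p.2 + ε * v p.2)) / 2 = (p.1 - p.2) / 2 + ε * ((v p.1 - v p.2) / 2) by ring]
    ring
  have hF0 : ∀ p, F 0 p = chord g (α p.1) (α p.2) * dker p.1 p.2 := by
    intro p; rw [← hFeq 0 p]; simp
  have hEF : denergy g α = ∫⁻ p, ENNReal.ofReal (F 0 p) ∂μ := by
    rw [denergy]; simp only [hF0]
    rfl
  have hF0nn : ∀ p, 0 ≤ F 0 p := fun p => by
    rw [hF0]; exact mul_nonneg (chord_nonneg _ _ _) (dker_nonneg _ _)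
  have hint0 : Integrable (F 0) μ := by
    refine ⟨(hFm 0).aestronglyMeasurable, ?_⟩
    rw [hasFiniteIntegral_iff_ofReal (Eventually.of_forall hF0nn), ← hEF]
    exact hE
  set r := 1 / (2 * L) with hr
  have hr0 : 0 < r := by positivity
  have hball : ∀ ε ∈ Metric.ball (0 : ℝ) r, |ε| * L ≤ 1 / 2 := by
    intro ε hε
    rw [mem_ball_zero_iff, Real.norm_eq_abs] at hε
    calc |ε| * L ≤ r * L := by gcongr
      _ = 1 / 2 := by rw [hr]; field_simp
  have hF0' : ∀ p, F 0 p = ch p * (1 / (4 * Real.sin (x p) ^ 2)) := by intro p; simp [F]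
  have hder : HasDerivAt (fun ε => ∫ p, F ε p ∂μ) (∫ p, F' 0 p ∂μ) 0 := by
    refine (hasDerivAt_integral_of_dominated_loc_of_deriv_le (F := F) (F' := F') (x₀ := (0 : ℝ))
      (s := Metric.ball 0 r) (bound := fun p => (100 * L) * F 0 p) (Metric.ball_mem_nhds _ hr0)
      (Eventually.of_forall fun ε => (hFm ε).aestronglyMeasurable) hint0 (hF'm 0).aestronglyMeasurable
      (Eventually.of_forall fun p ε hε => ?_) (hint0.const_mul _)
      (Eventually.of_forall fun p ε hε => ?_)).2
    · have := (kernel_bound hL (hv'L p.1) (hv'L p.2) (hδ p) (hball ε hε)).1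
      rw [hF0', Real.norm_eq_abs]
      simp only [F']
      rw [abs_mul, abs_of_nonneg (hch0 p)]
      calc _ ≤ ch p * ((100 * L) * (1 / (4 * Real.sin (x p) ^ 2))) := by gcongr; exact hch0 p
        _ = _ := by ring
    · by_cases hs : Real.sin (x p) = 0
      · have hd0 : δ p = 0 := by have := hδ p; rw [hs] at this; simpa using this
        have e1 : (fun ε => F ε p) = fun _ => 0 := by funext ε; simp [F, hd0, hs]
        have e2 : F' ε p = 0 := by simp [F', hd0, hs]
        rw [e1, e2]; exact hasDerivAt_const _ _
      · have hs2 := (kernel_bound hL (hv'L p.1) (hv'L p.2) (hδ p) (hball ε hε)).2 hs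
        exact (deriv_kernel hs2).const_mul (ch p)
  have hlm : IsLocalMin (fun ε => ∫ p, F ε p ∂μ) 0 := by
    filter_upwards [Metric.ball_mem_nhds (0 : ℝ) hr0] with ε hε
    have hb := hball ε hε
    obtain ⟨β, hβ, hβE⟩ := energy_change h g hv hper h0 h1 h2 hv'L hb
    have hle := hmin β hβ
    simp only [hFeq] at hβE
    have hnn : ∀ p, 0 ≤ F ε p := fun p => mul_nonneg (hch0 p) (kernel_bound2 hL (hv'L p.1) (hv'L p.2) (hδ p) hb).1
    have hle9 : ∀ p, F ε p ≤ 9 * F 0 p := by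
      intro p
      rw [hF0']
      have := (kernel_bound2 hL (hv'L p.1) (hv'L p.2) (hδ p) hb).2
      calc F ε p ≤ ch p * (9 * (1 / (4 * Real.sin (x p) ^ 2))) := mul_le_mul_of_nonneg_left this (hch0 p)
        _ = _ := by ring
    have hinte : Integrable (F ε) μ := by
      refine (hint0.const_mul 9).mono' (hFm ε).aestronglyMeasurable (Eventually.of_forall fun p => ?_)
      rw [Real.norm_eq_abs, abs_of_nonneg (hnn p)]; exact hle9 p
    rw [integral_eq_lintegral_of_nonneg_ae (Eventually.of_forall hF0nn) (hFm 0).aestronglyMeasurable,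
      integral_eq_lintegral_of_nonneg_ae (Eventually.of_forall hnn) (hFm ε).aestronglyMeasurable]
    apply ENNReal.toReal_mono
    · have := hinte.2
      rw [hasFiniteIntegral_iff_ofReal (Eventually.of_forall hnn)] at this
      exact this.ne
    · rw [← hEF, hμ, ← hβE]; exact hle
  have := hlm.hasDerivAt_eq_zero hder
  rw [← this]
  refine integral_congr_ae (Eventually.of_forall fun p => ?_)
  simp only [F', ch, bker, x, δ]
  simp only [zero_mul, add_zero, mul_one, one_mul]
  ring

/-! ### Conformality -/

lemma hasDerivAt_cis (s : ℝ) : HasDerivAt cis (Complex.I * cis s) s := by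
  have h1 : HasDerivAt (fun s : ℝ => (s : ℂ) * Complex.I) Complex.I s := by
    simpa using (Complex.ofRealCLM.hasDerivAt (x := s)).mul_const Complex.I
  have := h1.cexp
  rw [mul_comm]
  exact this

lemma cis_sub_ne {ζ : ℂ} (hζ : ‖ζ‖ < 1) (s : ℝ) : cis s - ζ ≠ 0 := by
  intro h
  have := norm_cis s
  rw [sub_eq_zero.1 h] at this
  linarith

/-- derivative kernel of the Herglotz transform. -/
noncomputable def kz (ζ : ℂ) (s : ℝ) : ℂ := cis s / (cis s - ζ) ^ 2

lemma continuous_kz {ζ : ℂ} (hζ : ‖ζ‖ < 1) : Continuous (kz ζ) := by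
  unfold kz
  have := continuous_cis
  exact this.div (by fun_prop) fun s => pow_ne_zero 2 (cis_sub_ne hζ s)

lemma integral_per_eq {E : Type*} [NormedAddCommGroup E] [NormedSpace ℝ E] (f : ℝ → E) :
    ∫ s in per, f s = ∫ s in (0 : ℝ)..(2 * π), f s := by
  rw [intervalIntegral.integral_of_le (by positivity)]; rfl

lemma integral_kz {ζ : ℂ} (hζ : ‖ζ‖ < 1) : ∫ s in per, kz ζ s = 0 := by
  rw [integral_per_eq]
  have hd : ∀ s : ℝ, HasDerivAt (fun s => Complex.I * (cis s - ζ)⁻¹) (kz ζ s) s := by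
    intro s
    have := (((hasDerivAt_cis s).sub_const ζ).inv (cis_sub_ne hζ s)).const_mul Complex.I
    refine this.congr_deriv ?_
    unfold kz
    have hI := Complex.I_sq
    have := cis_sub_ne hζ s
    field_simp
    rw [hI]; ring
  rw [intervalIntegral.integral_eq_sub_of_hasDerivAt (fun s _ => hd s) ((continuous_kz hζ).intervalIntegrable _ _)]
  have : cis (2 * π) = cis 0 := by simpa using cis_period 0
  rw [this]; simp

lemma cis_cs (x : ℝ) : cis x = (Real.cos x : ℂ) + (Real.sin x : ℂ) * Complex.I := by
  rw [cis_def, Complex.exp_mul_I, Complex.ofReal_cos, Complex.ofReal_sin]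

lemma cis_cs_neg (x : ℝ) : cis (-x) = (Real.cos x : ℂ) - (Real.sin x : ℂ) * Complex.I := by
  rw [cis_cs, Real.cos_neg, Real.sin_neg, Complex.ofReal_neg]; ring

lemma cis_facts (s t : ℝ) :
    4 * (Real.sin ((s - t) / 2) : ℂ) ^ 2 * (cis s * cis t) = -(cis s - cis t) ^ 2 ∧
    (Real.cos ((s - t) / 2) : ℂ) * (cis s - cis t) = Complex.I * (cis s + cis t) * (Real.sin ((s - t) / 2) : ℂ) := by
  have hs : cis s = cis ((s + t) / 2) * cis ((s - t) / 2) := by rw [← cis_add]; congr 1; ring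
  have ht : cis t = cis ((s + t) / 2) * cis (-((s - t) / 2)) := by rw [← cis_add]; congr 1; ring
  have e1 : cis ((s - t) / 2) = (Real.cos ((s - t) / 2) : ℂ) + (Real.sin ((s - t) / 2) : ℂ) * Complex.I := by
    exact cis_cs _
  have e2 : cis (-((s - t) / 2)) = (Real.cos ((s - t) / 2) : ℂ) - (Real.sin ((s - t) / 2) : ℂ) * Complex.I := by
    exact cis_cs_neg _
  have e3 : (Real.cos ((s - t) / 2) : ℂ) ^ 2 + (Real.sin ((s - t) / 2) : ℂ) ^ 2 = 1 := by
    exact_mod_cast Real.cos_sq_add_sin_sq ((s - t) / 2)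
  have hI := Complex.I_sq
  rw [hs, ht, e1, e2]
  generalize (Real.cos ((s - t) / 2) : ℂ) = c at *
  generalize (Real.sin ((s - t) / 2) : ℂ) = d at *
  constructor
  · grind
  · grind

lemma bker_complex {ζ : ℂ} (hζ : ‖ζ‖ < 1) {s t : ℝ} (hst : Real.sin ((s - t) / 2) ≠ 0) :
    (-2 * Complex.I * ζ * kz ζ s + -2 * Complex.I * ζ * kz ζ t) / ((4 * Real.sin ((s - t) / 2) ^ 2 : ℝ) : ℂ)
      - ((cis s + ζ) / (cis s - ζ) - (cis t + ζ) / (cis t - ζ)) * (Real.cos ((s - t) / 2) : ℂ) /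
        ((4 * Real.sin ((s - t) / 2) ^ 3 : ℝ) : ℂ) = 2 * Complex.I * ζ ^ 2 * (kz ζ s * kz ζ t) := by
  obtain ⟨h1, h2⟩ := cis_facts s t
  have hd : (Real.sin ((s - t) / 2) : ℂ) ≠ 0 := by exact_mod_cast hst
  have n1 := cis_sub_ne hζ s
  have n2 := cis_sub_ne hζ t
  have n3 := cis_ne_zero s
  have n4 := cis_ne_zero t
  unfold kz
  simp only [Complex.ofReal_mul, Complex.ofReal_pow, Complex.ofReal_ofNat]
  generalize (Real.cos ((s - t) / 2) : ℂ) = c at *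
  generalize (Real.sin ((s - t) / 2) : ℂ) = d at *
  generalize cis s = S at *
  generalize cis t = T at *
  have hST : S - T ≠ 0 := by
    intro h; rw [h] at h1
    have : 4 * d ^ 2 * (S * T) ≠ 0 := by simp [hd, n3, n4]
    exact this (by rw [h1]; ring)
  have hc : c = Complex.I * (S + T) / (S - T) * d := by
    field_simp; linear_combination h2
  have hdd : 4 * d ^ 2 = -(S - T) ^ 2 / (S * T) := by
    field_simp; linear_combination h1
  have hd3 : 4 * d ^ 3 = -(S - T) ^ 2 / (S * T) * d := by rw [← hdd]; ring
  rw [hdd, hd3, hc]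
  field_simp
  ring

/-- complex function whose real part is used as a variation. -/
noncomputable def wz (c ζ : ℂ) (s : ℝ) : ℂ := c * ((cis s + ζ) / (cis s - ζ))

lemma hasDerivAt_wz {ζ : ℂ} (hζ : ‖ζ‖ < 1) (c : ℂ) (s : ℝ) :
    HasDerivAt (wz c ζ) (c * (-2 * Complex.I * ζ * kz ζ s)) s := by
  have h := (((hasDerivAt_cis s).add_const ζ).div ((hasDerivAt_cis s).sub_const ζ) (cis_sub_ne hζ s)).const_mul c
  refine h.congr_deriv ?_
  unfold kz
  have := cis_sub_ne hζ s
  field_simp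
  ring

lemma bker_ecos (a s t : ℝ) : bker (fun s => (1 + 2 * Real.cos (s - a)) / 3) (fun s => -2 * Real.sin (s - a) / 3) s t = 0 := by
  unfold bker
  by_cases hs : Real.sin ((s - t) / 2) = 0
  · simp [hs]
  have e1 : Real.sin (s - a) + Real.sin (t - a) = 2 * Real.sin ((s + t) / 2 - a) * Real.cos ((s - t) / 2) := by
    have key : ∀ m x : ℝ, Real.sin (m + x) + Real.sin (m - x) = 2 * Real.sin m * Real.cos x := by
      intro m x; rw [Real.sin_add, Real.sin_sub]; ring
    rw [← key]; congr 2 <;> ring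
  have e2 : Real.cos (s - a) - Real.cos (t - a) = -2 * Real.sin ((s + t) / 2 - a) * Real.sin ((s - t) / 2) := by
    have key : ∀ m x : ℝ, Real.cos (m + x) - Real.cos (m - x) = -2 * Real.sin m * Real.sin x := by
      intro m x; rw [Real.cos_add, Real.cos_sub]; ring
    rw [← key]; congr 2 <;> ring
  have e3 : -2 * Real.sin (s - a) / 3 + -2 * Real.sin (t - a) / 3 = -2 / 3 * (2 * Real.sin ((s + t) / 2 - a) * Real.cos ((s - t) / 2)) := by
    rw [← e1]; ring
  have e4 : (1 + 2 * Real.cos (s - a)) / 3 - (1 + 2 * Real.cos (t - a)) / 3 = 2 / 3 * (-2 * Real.sin ((s + t) / 2 - a) * Real.sin ((s - t) / 2)) := by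
    rw [← e2]; ring
  rw [e3, e4]
  field_simp
  ring

lemma cos_2pi3 : Real.cos (2 * π / 3) = -1 / 2 := by
  rw [show 2 * π / 3 = π - π / 3 by ring, Real.cos_pi_sub, Real.cos_pi_div_three]; norm_num

lemma cos_4pi3 : Real.cos (4 * π / 3) = -1 / 2 := by
  rw [show 4 * π / 3 = π / 3 + π by ring, Real.cos_add_pi, Real.cos_pi_div_three]; norm_num

lemma re_bker {ζ : ℂ} (hζ : ‖ζ‖ < 1) (c : ℂ) {s t : ℝ} (hst : Real.sin ((s - t) / 2) ≠ 0) :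
    bker (fun s => (wz c ζ s).re) (fun s => (c * (-2 * Complex.I * ζ * kz ζ s)).re) s t =
      (c * (2 * Complex.I * ζ ^ 2 * (kz ζ s * kz ζ t))).re := by
  rw [← bker_complex hζ hst, mul_sub, ← mul_div_assoc, ← mul_div_assoc, ← mul_assoc, Complex.sub_re,
    Complex.div_ofReal_re, Complex.div_ofReal_re, Complex.re_mul_ofReal, mul_add, Complex.add_re, mul_sub, Complex.sub_re]
  rfl

lemma variation_zero {α : ℝ → ℝ} (h : Adm α) {g : ℂ → ℝ} (hg : Continuous g) (hE : denergy g α < ⊤)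
    (hmin : ∀ β, Adm β → denergy g α ≤ denergy g β) {ζ : ℂ} (hζ : ‖ζ‖ < 1) (c : ℂ) :
    ∫ p in per ×ˢ per, chord g (α p.1) (α p.2) * (c * (2 * Complex.I * ζ ^ 2 * (kz ζ p.1 * kz ζ p.2))).re = 0 := by
  have hp := Real.pi_pos
  set v0 : ℝ → ℝ := fun s => (wz c ζ s).re with hv0
  set v0' : ℝ → ℝ := fun s => (c * (-2 * Complex.I * ζ * kz ζ s)).re with hv0'
  let e : ℝ → ℝ → ℝ := fun a s => (1 + 2 * Real.cos (s - a)) / 3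
  let e' : ℝ → ℝ → ℝ := fun a s => -2 * Real.sin (s - a) / 3
  have hed : ∀ a s, HasDerivAt (e a) (e' a s) s := by
    intro a s
    have h1 : HasDerivAt (fun s : ℝ => s - a) 1 s := (hasDerivAt_id s).sub_const a
    have h2 := ((h1.cos.const_mul 2).const_add 1).div_const 3
    refine h2.congr_deriv ?_
    simp only [e']; ring
  have hvd : ∀ s, HasDerivAt v0 (v0' s) s := fun s =>
    (Complex.reCLM.hasFDerivAt.comp_hasDerivAt s (hasDerivAt_wz hζ c s))
  have hv0p : ∀ s, v0 (s + 2 * π) = v0 s := by intro s; simp only [hv0, wz, cis_period]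
  have hep : ∀ a s, e a (s + 2 * π) = e a s := by
    intro a s; simp only [e]
    rw [show s + 2 * π - a = (s - a) + 2 * π by ring, Real.cos_add_two_pi]
  set a1 := 2 * π / 3 with ha1
  set a2 := 4 * π / 3 with ha2
  set v : ℝ → ℝ := fun s => v0 s - v0 0 * e 0 s - v0 a1 * e a1 s - v0 a2 * e a2 s with hv
  set v' : ℝ → ℝ := fun s => v0' s - v0 0 * e' 0 s - v0 a1 * e' a1 s - v0 a2 * e' a2 s with hv'
  have hc0 : Continuous v0' := by
    have := continuous_kz hζ
    simp only [hv0']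
    exact Complex.continuous_re.comp (by fun_prop)
  have d1 : Real.cos (a1 - a2) = -1 / 2 := by
    rw [← Real.cos_neg, show -(a1 - a2) = 2 * π / 3 by rw [ha1, ha2]; ring, cos_2pi3]
  have d2 : Real.cos (a2 - a1) = -1 / 2 := by
    rw [show (a2 - a1) = 2 * π / 3 by rw [ha1, ha2]; ring, cos_2pi3]
  have d3 : Real.cos a1 = -1 / 2 := cos_2pi3
  have d4 : Real.cos a2 = -1 / 2 := cos_4pi3
  have key := first_variation h hg hE hmin (v := v) (v' := v')
    (fun s => (((hvd s).sub ((hed 0 s).const_mul _)).sub ((hed a1 s).const_mul _)).sub ((hed a2 s).const_mul _))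
    (by simp only [hv', e']; fun_prop)
    (by intro s; simp only [hv, hv0p, hep])
    (by simp only [hv, e, zero_sub, Real.cos_neg, d3, d4, sub_zero, Real.cos_zero]; ring)
    (by rw [← ha1]; simp only [hv, e, sub_self, d1, d3, sub_zero, Real.cos_zero]; ring)
    (by rw [← ha2]; simp only [hv, e, sub_self, d2, d4, sub_zero, Real.cos_zero]; ring)
  rw [← key]
  refine setIntegral_congr_fun (measurableSet_per.prod measurableSet_per) fun p hpp => ?_
  obtain ⟨⟨p1, p2⟩, ⟨p3, p4⟩⟩ := hpp
  by_cases hs : Real.sin ((p.1 - p.2) / 2) = 0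
  · have : (p.1 - p.2) / 2 = 0 := (Real.sin_eq_zero_iff_of_lt_of_lt (by linarith) (by linarith)).1 hs
    have : p.1 = p.2 := by linarith
    rw [this]; simp [chord]
  · congr 1
    rw [← re_bker hζ c hs]
    have : bker v v' p.1 p.2 = bker v0 v0' p.1 p.2 - v0 0 * bker (e 0) (e' 0) p.1 p.2 -
        v0 a1 * bker (e a1) (e' a1) p.1 p.2 - v0 a2 * bker (e a2) (e' a2) p.1 p.2 := by
      simp only [bker, hv, hv']; ring
    rw [this, bker_ecos, bker_ecos, bker_ecos]
    simp [hv0, hv0']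

lemma integrableOn_per2 {E : Type*} [NormedAddCommGroup E] {f : ℝ × ℝ → E} (hf : Continuous f) :
    IntegrableOn f (per ×ˢ per) := by
  have : IsCompact (Icc (0 : ℝ) (2 * π) ×ˢ Icc (0 : ℝ) (2 * π)) := isCompact_Icc.prod isCompact_Icc
  exact (hf.continuousOn.integrableOn_compact this).mono_set (prod_mono Ioc_subset_Icc_self Ioc_subset_Icc_self)

lemma integrableOn_per {E : Type*} [NormedAddCommGroup E] {f : ℝ → E} (hf : Continuous f) :
    IntegrableOn f per :=
  (hf.continuousOn.integrableOn_compact isCompact_Icc).mono_set Ioc_subset_Icc_self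

lemma square_expand {X : ℝ → ℝ} (hX : Continuous X) {k : ℝ → ℂ} (hk : Continuous k) (h0 : ∫ s in per, k s = 0) :
    ∫ p in per ×ˢ per, ((X p.1 - X p.2 : ℝ) : ℂ) ^ 2 * (k p.1 * k p.2) = -2 * (∫ s in per, (X s : ℂ) * k s) ^ 2 := by
  have hXc : Continuous fun s => (X s : ℂ) := Complex.continuous_ofReal.comp hX
  have e : ∀ p : ℝ × ℝ, ((X p.1 - X p.2 : ℝ) : ℂ) ^ 2 * (k p.1 * k p.2) =
      ((X p.1 : ℂ) ^ 2 * k p.1) * k p.2 + k p.1 * ((X p.2 : ℂ) ^ 2 * k p.2) -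
        2 * (((X p.1 : ℂ) * k p.1) * ((X p.2 : ℂ) * k p.2)) := by
    intro p; push_cast; ring
  simp only [e]
  have i1 : IntegrableOn (fun p : ℝ × ℝ => ((X p.1 : ℂ) ^ 2 * k p.1) * k p.2) (per ×ˢ per) := integrableOn_per2 (by fun_prop)
  have i2 : IntegrableOn (fun p : ℝ × ℝ => k p.1 * ((X p.2 : ℂ) ^ 2 * k p.2)) (per ×ˢ per) := integrableOn_per2 (by fun_prop)
  have i3 : IntegrableOn (fun p : ℝ × ℝ => 2 * (((X p.1 : ℂ) * k p.1) * ((X p.2 : ℂ) * k p.2))) (per ×ˢ per) := integrableOn_per2 (by fun_prop)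
  have i12 : IntegrableOn (fun p : ℝ × ℝ => ((X p.1 : ℂ) ^ 2 * k p.1) * k p.2 + k p.1 * ((X p.2 : ℂ) ^ 2 * k p.2)) (per ×ˢ per) := i1.add i2
  rw [integral_sub i12 i3, integral_add i1 i2, integral_const_mul]
  have f1 := setIntegral_prod_mul (μ := (volume : Measure ℝ)) (ν := (volume : Measure ℝ)) (fun s => (X s : ℂ) ^ 2 * k s) (fun s => k s) per per
  have f2 := setIntegral_prod_mul (μ := (volume : Measure ℝ)) (ν := (volume : Measure ℝ)) (fun s => k s) (fun s => (X s : ℂ) ^ 2 * k s) per per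
  have f3 := setIntegral_prod_mul (μ := (volume : Measure ℝ)) (ν := (volume : Measure ℝ)) (fun s => (X s : ℂ) * k s) (fun s => (X s : ℂ) * k s) per per
  rw [← Measure.volume_eq_prod] at f1 f2 f3
  rw [f1, f2, f3, h0]
  ring

theorem conformal_raw {α : ℝ → ℝ} (h : Adm α) {g : ℂ → ℝ} (hg : Continuous g) (hE : denergy g α < ⊤)
    (hmin : ∀ β, Adm β → denergy g α ≤ denergy g β) {ζ : ℂ} (hζ : ‖ζ‖ < 1) (hζ0 : ζ ≠ 0) :
    (∫ s in per, (Real.cos (α s) : ℂ) * kz ζ s) ^ 2 + (∫ s in per, (Real.sin (α s) : ℂ) * kz ζ s) ^ 2 +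
      (∫ s in per, (g (cis (α s)) : ℂ) * kz ζ s) ^ 2 = 0 := by
  have hα := h.continuous hE
  have hk := continuous_kz hζ
  have hcc := continuous_cis
  have hC : Continuous fun s => Real.cos (α s) := by fun_prop
  have hS : Continuous fun s => Real.sin (α s) := by fun_prop
  have hG : Continuous fun s => g (cis (α s)) := by fun_prop
  have hch : ∀ p : ℝ × ℝ, (chord g (α p.1) (α p.2) : ℂ) = ((Real.cos (α p.1) - Real.cos (α p.2) : ℝ) : ℂ) ^ 2 +
      ((Real.sin (α p.1) - Real.sin (α p.2) : ℝ) : ℂ) ^ 2 + ((g (cis (α p.1)) - g (cis (α p.2)) : ℝ) : ℂ) ^ 2 := by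
    intro p
    rw [chord, ← Complex.normSq_eq_norm_sq, Complex.normSq_apply, Complex.sub_re, Complex.sub_im,
      cis_re, cis_re, cis_im, cis_im]
    push_cast; ring
  let K : ℝ × ℝ → ℂ := fun p => (chord g (α p.1) (α p.2) : ℂ) * (kz ζ p.1 * kz ζ p.2)
  have q1 : IntegrableOn (fun p : ℝ × ℝ => ((Real.cos (α p.1) - Real.cos (α p.2) : ℝ) : ℂ) ^ 2 * (kz ζ p.1 * kz ζ p.2)) (per ×ˢ per) :=
    integrableOn_per2 (by fun_prop)
  have q2 : IntegrableOn (fun p : ℝ × ℝ => ((Real.sin (α p.1) - Real.sin (α p.2) : ℝ) : ℂ) ^ 2 * (kz ζ p.1 * kz ζ p.2)) (per ×ˢ per) :=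
    integrableOn_per2 (by fun_prop)
  have q3 : IntegrableOn (fun p : ℝ × ℝ => ((g (cis (α p.1)) - g (cis (α p.2)) : ℝ) : ℂ) ^ 2 * (kz ζ p.1 * kz ζ p.2)) (per ×ˢ per) :=
    integrableOn_per2 (by fun_prop)
  have hKe : K = fun p => ((Real.cos (α p.1) - Real.cos (α p.2) : ℝ) : ℂ) ^ 2 * (kz ζ p.1 * kz ζ p.2) +
      ((Real.sin (α p.1) - Real.sin (α p.2) : ℝ) : ℂ) ^ 2 * (kz ζ p.1 * kz ζ p.2) +
      ((g (cis (α p.1)) - g (cis (α p.2)) : ℝ) : ℂ) ^ 2 * (kz ζ p.1 * kz ζ p.2) := by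
    funext p; simp only [K, hch]; ring
  have hKi : IntegrableOn K (per ×ˢ per) := by rw [hKe]; exact (q1.add q2).add q3
  have hK0 : ∫ p in per ×ˢ per, K p = 0 := by
    have hre : ∀ c : ℂ, (c * (2 * Complex.I * ζ ^ 2) * ∫ p in per ×ˢ per, K p).re = 0 := by
      intro c
      have := variation_zero h hg hE hmin hζ c
      rw [← integral_const_mul]
      have e := (Complex.reCLM.integral_comp_comm (hKi.const_mul (c * (2 * Complex.I * ζ ^ 2))))
      simp only [Complex.reCLM_apply] at e
      rw [← e, ← this]
      refine integral_congr_ae (Eventually.of_forall fun p => ?_)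
      simp only [K]
      rw [← Complex.re_ofReal_mul]
      congr 1; ring
    by_contra hne
    set J := ∫ p in per ×ˢ per, K p
    have hne2 : 2 * Complex.I * ζ ^ 2 * J ≠ 0 := by simp [hζ0, hne]
    have := hre ((2 * Complex.I * ζ ^ 2 * J)⁻¹)
    rw [mul_assoc, inv_mul_cancel₀ hne2] at this
    simp at this
  have h0 := integral_kz hζ
  have r1 := square_expand hC hk h0
  have r2 := square_expand hS hk h0
  have r3 := square_expand hG hk h0
  have q12 : IntegrableOn (fun p : ℝ × ℝ => ((Real.cos (α p.1) - Real.cos (α p.2) : ℝ) : ℂ) ^ 2 * (kz ζ p.1 * kz ζ p.2) +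
      ((Real.sin (α p.1) - Real.sin (α p.2) : ℝ) : ℂ) ^ 2 * (kz ζ p.1 * kz ζ p.2)) (per ×ˢ per) := q1.add q2
  rw [hKe, integral_add q12 q3, integral_add q1 q2, r1, r2, r3] at hK0
  linear_combination (-1 / 2) * hK0

/-! ### The Herglotz transform -/

/-- Herglotz transform of a function on the circle (in the angle variable). -/
noncomputable def Hz (X : ℝ → ℝ) (ζ : ℂ) : ℂ :=
  (1 / (2 * π) : ℝ) * ∫ s in per, (X s : ℂ) * ((cis s + ζ) / (cis s - ζ))

/-- Poisson kernel. -/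
noncomputable def Pk (ζ : ℂ) (s : ℝ) : ℝ := (1 - ‖ζ‖ ^ 2) / ‖cis s - ζ‖ ^ 2

lemma Pk_pos {ζ : ℂ} (hζ : ‖ζ‖ < 1) (s : ℝ) : 0 < Pk ζ s := by
  have h1 : 0 < ‖cis s - ζ‖ := norm_pos_iff.2 (cis_sub_ne hζ s)
  have h2 : 0 < 1 - ‖ζ‖ ^ 2 := by nlinarith [norm_nonneg ζ]
  unfold Pk; positivity

lemma continuous_Pk {ζ : ℂ} (hζ : ‖ζ‖ < 1) : Continuous (Pk ζ) := by
  unfold Pk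
  have := continuous_cis
  refine continuous_const.div (by fun_prop) fun s => ?_
  exact pow_ne_zero 2 (norm_ne_zero_iff.2 (cis_sub_ne hζ s))

lemma re_herglotz (ζ : ℂ) (s : ℝ) : ((cis s + ζ) / (cis s - ζ)).re = Pk ζ s := by
  have h1 := norm_cis s
  rw [Complex.div_re, Pk, ← Complex.normSq_eq_norm_sq, ← Complex.normSq_eq_norm_sq, ← add_div]
  have h2 : Complex.normSq (cis s) = 1 := by rw [Complex.normSq_eq_norm_sq, h1]; norm_num
  congr 1
  rw [Complex.normSq_apply] at *
  simp only [Complex.add_re, Complex.sub_re, Complex.add_im, Complex.sub_im]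
  linear_combination h2

lemma continuous_hk {ζ : ℂ} (hζ : ‖ζ‖ < 1) : Continuous fun s => (cis s + ζ) / (cis s - ζ) := by
  have := continuous_cis
  exact (by fun_prop : Continuous fun s => cis s + ζ).div (by fun_prop) fun s => cis_sub_ne hζ s

lemma re_Hz {X : ℝ → ℝ} (hX : Continuous X) {ζ : ℂ} (hζ : ‖ζ‖ < 1) :
    (Hz X ζ).re = (1 / (2 * π)) * ∫ s in per, X s * Pk ζ s := by
  have hXc : Continuous fun s => (X s : ℂ) := Complex.continuous_ofReal.comp hX
  have hi : IntegrableOn (fun s => (X s : ℂ) * ((cis s + ζ) / (cis s - ζ))) per :=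
    integrableOn_per (hXc.mul (continuous_hk hζ))
  rw [Hz, Complex.re_ofReal_mul]
  congr 1
  have e := Complex.reCLM.integral_comp_comm hi
  simp only [Complex.reCLM_apply] at e
  rw [← e]
  simp only [Complex.re_ofReal_mul, re_herglotz]

lemma hasDerivAt_Hz {X : ℝ → ℝ} (hX : Continuous X) {ζ : ℂ} (hζ : ‖ζ‖ < 1) :
    HasDerivAt (Hz X) ((1 / π : ℝ) * ∫ s in per, (X s : ℂ) * kz ζ s) ζ := by
  have hXc : Continuous fun s => (X s : ℂ) := Complex.continuous_ofReal.comp hX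
  obtain ⟨B, hB⟩ : ∃ B, ∀ s ∈ per, |X s| ≤ B := by
    obtain ⟨B, hB⟩ := isCompact_Icc.exists_bound_of_continuousOn (f := X) (s := Icc 0 (2 * π)) hX.continuousOn
    exact ⟨B, fun s hs => hB s (Ioc_subset_Icc_self hs)⟩
  obtain ⟨r, hr1, hr2⟩ := exists_between hζ
  have hmem : Metric.ball (0 : ℂ) r ∈ 𝓝 ζ := Metric.isOpen_ball.mem_nhds (by simpa using hr1)
  have key := (hasDerivAt_integral_of_dominated_loc_of_deriv_le (μ := volume.restrict per)
    (F := fun (ζ : ℂ) s => (X s : ℂ) * ((cis s + ζ) / (cis s - ζ)))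
    (F' := fun (ζ : ℂ) s => (X s : ℂ) * (2 * kz ζ s)) (x₀ := ζ) (s := Metric.ball 0 r)
    (bound := fun _ => B * (2 / (1 - r) ^ 2)) hmem ?_ ?_ ?_ ?_ ?_ ?_).2
  · have h2 := key.const_mul ((1 / (2 * π) : ℝ) : ℂ)
    have e : (((1 / (2 * π) : ℝ) : ℂ) * ∫ s in per, (X s : ℂ) * (2 * kz ζ s)) = (1 / π : ℝ) * ∫ s in per, (X s : ℂ) * kz ζ s := by
      have : ∀ s, (X s : ℂ) * (2 * kz ζ s) = 2 * ((X s : ℂ) * kz ζ s) := fun s => by ring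
      simp only [this]
      rw [integral_const_mul, ← mul_assoc]
      congr 1
      have hp : (π : ℂ) ≠ 0 := by exact_mod_cast Real.pi_ne_zero
      push_cast; field_simp
    rw [← e]
    exact h2
  · filter_upwards [hmem] with w hw
    have hw1 : ‖w‖ < 1 := by rw [mem_ball_zero_iff] at hw; linarith
    exact (hXc.mul (continuous_hk hw1)).aestronglyMeasurable
  · exact integrableOn_per (hXc.mul (continuous_hk hζ))
  · have := continuous_kz hζ
    exact (by fun_prop : Continuous fun s => (X s : ℂ) * (2 * kz ζ s)).aestronglyMeasurable
  · refine (ae_restrict_iff' measurableSet_per).2 (Eventually.of_forall fun s hs w hw => ?_)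
    rw [mem_ball_zero_iff] at hw
    have h1 : 1 - r ≤ ‖cis s - w‖ := by
      have := norm_sub_norm_le (cis s) w
      rw [norm_cis] at this; linarith
    rw [norm_mul, Complex.norm_real, Real.norm_eq_abs]
    have hB0 : 0 ≤ B := (abs_nonneg _).trans (hB s hs)
    gcongr
    · exact hB s hs
    · rw [kz, norm_mul, norm_div, norm_pow, norm_cis, mul_one_div]
      have h3 : 0 < 1 - r := by linarith
      have : ‖(2 : ℂ)‖ = 2 := by norm_num
      rw [this]
      gcongr
  · exact integrableOn_const (by rw [volume_per]; exact ENNReal.ofReal_ne_top)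
  · refine Eventually.of_forall fun s w hw => ?_
    have hw1 : ‖w‖ < 1 := by rw [mem_ball_zero_iff] at hw; linarith
    have hne := cis_sub_ne hw1 s
    have h1 : HasDerivAt (fun w : ℂ => cis s + w) 1 w := (hasDerivAt_id w).const_add _
    have h2 : HasDerivAt (fun w : ℂ => cis s - w) (-1) w := (hasDerivAt_id w).const_sub _
    have h3 := (h1.div h2 hne).const_mul (X s : ℂ)
    refine h3.congr_deriv ?_
    unfold kz
    field_simp
    ring

lemma Hz_one {ζ : ℂ} (hζ : ‖ζ‖ < 1) : Hz (fun _ => 1) ζ = 1 := by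
  have hd : ∀ w ∈ Metric.ball (0 : ℂ) 1, HasDerivAt (Hz fun _ => 1) 0 w := by
    intro w hw
    have hw1 : ‖w‖ < 1 := by simpa using hw
    have := hasDerivAt_Hz (X := fun _ => 1) continuous_const hw1
    simp only [Complex.ofReal_one, one_mul, integral_kz hw1, mul_zero] at this
    exact this
  have hc := Convex.norm_image_sub_le_of_norm_hasDerivWithin_le (C := 0) (fun x hx => (hd x hx).hasDerivWithinAt)
    (fun x _ => by simp) (convex_ball (0 : ℂ) 1) (Metric.mem_ball_self one_pos) (show ζ ∈ Metric.ball (0 : ℂ) 1 by simpa using hζ)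
  rw [zero_mul, norm_le_zero_iff, sub_eq_zero] at hc
  rw [hc, Hz]
  have : ∀ s, ((cis s + 0) / (cis s - 0)) = 1 := by
    intro s; rw [add_zero, sub_zero, div_self (cis_ne_zero s)]
  simp only [this, Complex.ofReal_one, mul_one]
  rw [setIntegral_const, Measure.real, volume_per, ENNReal.toReal_ofReal (by positivity)]
  have hp : (π : ℂ) ≠ 0 := by exact_mod_cast Real.pi_ne_zero
  simp; field_simp

lemma integral_Pk {ζ : ℂ} (hζ : ‖ζ‖ < 1) : ∫ s in per, Pk ζ s = 2 * π := by
  have h1 := re_Hz (X := fun _ => 1) continuous_const hζ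
  rw [Hz_one hζ] at h1
  simp only [Complex.one_re, one_mul] at h1
  have hp := Real.pi_pos
  field_simp at h1
  linarith

lemma cis_eq_cis {s t : ℝ} (h : cis s = cis t) : ∃ n : ℤ, s = t + n * (2 * π) := by
  obtain ⟨n, hn⟩ := Complex.exp_eq_exp_iff_exists_int.1 h
  refine ⟨n, ?_⟩
  have := congrArg Complex.im hn
  simpa using this

/-- boundary values of the Poisson integral. -/
theorem Hz_boundary {X : ℝ → ℝ} (hX : Continuous X) (hper : Function.Periodic X (2 * π)) (s0 : ℝ) {ε : ℝ} (hε : 0 < ε) :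
    ∃ η > 0, ∀ ζ : ℂ, ‖ζ‖ < 1 → ‖ζ - cis s0‖ < η → |(Hz X ζ).re - X s0| < ε := by
  have hp := Real.pi_pos
  obtain ⟨B, hB⟩ : ∃ B, ∀ s, |X s| ≤ B := by
    obtain ⟨L, hL⟩ := (hper.isBounded_of_continuous (by positivity) hX).exists_norm_le
    exact ⟨L, fun s => hL _ (mem_range_self s)⟩
  have hB0 : 0 ≤ B := (abs_nonneg _).trans (hB 0)
  -- modulus of continuity in the chord
  obtain ⟨δ, hδ, hδs⟩ : ∃ δ > 0, ∀ s ∈ per, ‖cis s - cis s0‖ < δ → |X s - X s0| ≤ ε / 2 := by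
    let K := Icc 0 (2 * π) ∩ {s | ε / 2 ≤ |X s - X s0|}
    have hKc : IsCompact K := isCompact_Icc.inter_right (isClosed_le continuous_const (by fun_prop))
    rcases K.eq_empty_or_nonempty with he | hne
    · refine ⟨1, one_pos, fun s hs _ => ?_⟩
      by_contra hcon
      have : s ∈ K := ⟨Ioc_subset_Icc_self hs, (not_le.1 hcon).le⟩
      rw [he] at this; exact this
    · have hcc := continuous_cis
      obtain ⟨s1, hs1, hmin⟩ := hKc.exists_isMinOn hne (f := fun s => ‖cis s - cis s0‖) (by fun_prop)
      refine ⟨‖cis s1 - cis s0‖, ?_, fun s hs hlt => ?_⟩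
      · rw [gt_iff_lt, norm_pos_iff]
        intro h0
        obtain ⟨n, hn⟩ := cis_eq_cis (sub_eq_zero.1 h0)
        have h2 := hs1.2
        rw [mem_ofPred_eq, hn, hper.int_mul n s0] at h2
        simp at h2; linarith
      · by_contra hcon
        have : s ∈ K := ⟨Ioc_subset_Icc_self hs, (not_le.1 hcon).le⟩
        exact absurd hlt (not_lt.2 (hmin this))
  set c := ε * δ ^ 2 / (64 * (B + 1)) with hc
  have hc0 : 0 < c := by positivity
  refine ⟨min (δ / 2) c, by positivity, fun ζ hζ hlt => ?_⟩
  have hlt1 := hlt.trans_le (min_le_left _ _)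
  have hlt2 := hlt.trans_le (min_le_right _ _)
  have hP := continuous_Pk hζ
  have hI := integral_Pk hζ
  have h1 : 1 - ‖ζ‖ ^ 2 ≤ 2 * c := by
    have := norm_sub_norm_le (cis s0) ζ
    rw [norm_cis, norm_sub_rev] at this
    nlinarith [norm_nonneg ζ]
  have hpt : ∀ s ∈ per, |(X s - X s0) * Pk ζ s| ≤ ε / 2 * Pk ζ s + ε / 4 := by
    intro s hs
    have hPs := (Pk_pos hζ s).le
    rw [abs_mul, abs_of_nonneg hPs]
    rcases lt_or_ge ‖cis s - cis s0‖ δ with hl | hl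
    · have := hδs s hs hl
      nlinarith
    · have h2 : δ / 2 ≤ ‖cis s - ζ‖ := by
        have := norm_sub_le_norm_sub_add_norm_sub (cis s) ζ (cis s0)
        linarith
      have h3 : Pk ζ s ≤ 2 * c / (δ / 2) ^ 2 := by unfold Pk; gcongr
      have h4 : |X s - X s0| ≤ 2 * B := by
        have := abs_sub (X s) (X s0); linarith [hB s, hB s0]
      have h5 : 2 * B * (2 * c / (δ / 2) ^ 2) ≤ ε / 4 := by
        rw [hc]
        rw [show 2 * B * (2 * (ε * δ ^ 2 / (64 * (B + 1))) / (δ / 2) ^ 2) = ε / 4 * (B / (B + 1)) by field_simp; ring]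
        have : B / (B + 1) ≤ 1 := (div_le_one (by linarith)).2 (by linarith)
        nlinarith
      calc |X s - X s0| * Pk ζ s ≤ 2 * B * (2 * c / (δ / 2) ^ 2) := by gcongr
        _ ≤ ε / 4 := h5
        _ ≤ _ := by nlinarith
  have e1 : (Hz X ζ).re - X s0 = (1 / (2 * π)) * ∫ s in per, (X s - X s0) * Pk ζ s := by
    rw [re_Hz hX hζ]
    simp only [sub_mul]
    have i1 : IntegrableOn (fun s => X s * Pk ζ s) per := integrableOn_per (hX.mul hP)
    have i2 : IntegrableOn (fun s => X s0 * Pk ζ s) per := integrableOn_per (continuous_const.mul hP)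
    rw [integral_sub i1 i2, integral_const_mul, hI]
    field_simp
  have i3 : IntegrableOn (fun s => ε / 2 * Pk ζ s + ε / 4) per := integrableOn_per (by fun_prop)
  have e2 : |∫ s in per, (X s - X s0) * Pk ζ s| ≤ ∫ s in per, (ε / 2 * Pk ζ s + ε / 4) := by
    rw [← Real.norm_eq_abs]
    refine norm_integral_le_of_norm_le i3 ?_
    exact (ae_restrict_iff' measurableSet_per).2 (Eventually.of_forall fun s hs => hpt s hs)
  have e3 : ∫ s in per, (ε / 2 * Pk ζ s + ε / 4) = 2 * π * (3 * ε / 4) := by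
    have i1 : IntegrableOn (fun s => ε / 2 * Pk ζ s) per := integrableOn_per (continuous_const.mul hP)
    have i2 : IntegrableOn (fun _ : ℝ => ε / 4) per := integrableOn_per continuous_const
    rw [integral_add i1 i2, integral_const_mul, hI,
      setIntegral_const, Measure.real, volume_per, ENNReal.toReal_ofReal (by positivity), smul_eq_mul]
    ring
  rw [e1, abs_mul, abs_of_pos (by positivity)]
  rw [e3] at e2
  calc 1 / (2 * π) * _ ≤ 1 / (2 * π) * (2 * π * (3 * ε / 4)) := by gcongr
    _ = 3 * ε / 4 := by field_simp
    _ < ε := by linarith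

/-! ### Nonvanishing of the Jacobian -/

lemma per_shift {f : ℝ → ℝ} (hper : Function.Periodic f (2 * π)) (p : ℝ) :
    ∫ s in per, f s = ∫ s in p..(p + 2 * π), f s := by
  rw [integral_per_eq, hper.intervalIntegral_add_eq p 0, zero_add]

lemma per_int_pos {f : ℝ → ℝ} (hf : Continuous f) (hper : Function.Periodic f (2 * π)) (p : ℝ)
    (h0 : ∀ s ∈ Icc p (p + 2 * π), 0 ≤ f s) {s0 : ℝ} (hs0 : s0 ∈ Icc p (p + 2 * π)) (h1 : 0 < f s0) :
    0 < ∫ s in per, f s := by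
  have hp := Real.pi_pos
  rw [per_shift hper p]
  exact intervalIntegral.integral_pos (by linarith) hf.continuousOn (fun x hx => h0 x (Ioc_subset_Icc_self hx)) ⟨s0, hs0, h1⟩

lemma Pk_periodic (ζ : ℂ) : Function.Periodic (Pk ζ) (2 * π) := by
  intro s; unfold Pk; rw [cis_period]

lemma Adm.surj {α : ℝ → ℝ} (h : Adm α) (hα : Continuous α) : Function.Surjective α := by
  refine hα.surjective ?_ ?_
  · refine tendsto_atTop_mono (f := fun s => s - 2 * π / 3) (fun s => ?_) (tendsto_atTop_add_const_right _ _ tendsto_id)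
    have := abs_le.1 (h.le_dist s); linarith
  · refine tendsto_atBot_mono (g := α) (f := fun s => s + 2 * π / 3) (fun s => ?_) (tendsto_atBot_add_const_right _ _ tendsto_id)
    have := abs_le.1 (h.le_dist s); linarith

lemma Adm.cos_periodic {α : ℝ → ℝ} (h : Adm α) (β : ℝ) : Function.Periodic (fun s => Real.cos (α s - β)) (2 * π) := by
  intro s
  have := h.quasi s
  simp only [this]
  rw [show α s + 2 * π - β = α s - β + 2 * π by ring, Real.cos_add_two_pi]

lemma kz_ident {ζ : ℂ} (hζ : ‖ζ‖ < 1) (w : ℂ) (c s : ℝ) :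
    (1 - ‖ζ‖ ^ 2) ^ 2 * ((c - (w * cis s).re) / (‖cis s - ζ‖ ^ 2) ^ 2) =
      ((2 * c * ζ - w * ζ ^ 2 - starRingEnd ℂ w) * kz ζ s).re +
      (c * (1 + ‖ζ‖ ^ 2) - 2 * (w * ζ).re) / ‖cis s - ζ‖ ^ 2 := by
  have hne := cis_sub_ne hζ s
  have hD : ‖cis s - ζ‖ ^ 2 ≠ 0 := pow_ne_zero 2 (norm_ne_zero_iff.2 hne)
  have h1 : (cis s).re * (cis s).re + (cis s).im * (cis s).im = 1 := by
    have := norm_cis s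
    rw [← Complex.normSq_apply, Complex.normSq_eq_norm_sq, this]; norm_num
  have hk : ∀ k : ℂ, (k * kz ζ s).re = (k * cis s * (starRingEnd ℂ (cis s - ζ)) ^ 2).re / (‖cis s - ζ‖ ^ 2) ^ 2 := by
    intro k
    rw [← Complex.div_ofReal_re]
    congr 1
    have e : (((‖cis s - ζ‖ ^ 2) ^ 2 : ℝ) : ℂ) = ((cis s - ζ) * starRingEnd ℂ (cis s - ζ)) ^ 2 := by
      rw [Complex.mul_conj, Complex.normSq_eq_norm_sq]; push_cast; rfl
    have hc : starRingEnd ℂ (cis s - ζ) ≠ 0 := (map_ne_zero _).2 hne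
    rw [e, kz]
    field_simp
  rw [hk]
  have e1 : ‖cis s - ζ‖ ^ 2 = ((cis s).re - ζ.re) ^ 2 + ((cis s).im - ζ.im) ^ 2 := by
    rw [← Complex.normSq_eq_norm_sq, Complex.normSq_apply, Complex.sub_re, Complex.sub_im]; ring
  have e2 : ‖ζ‖ ^ 2 = ζ.re ^ 2 + ζ.im ^ 2 := by
    rw [← Complex.normSq_eq_norm_sq, Complex.normSq_apply]; ring
  rw [e1] at hD ⊢
  rw [e2]
  field_simp
  simp [pow_two, Complex.mul_re, Complex.mul_im]
  grind

theorem rkc {α : ℝ → ℝ} (h : Adm α) (hα : Continuous α) {ζ : ℂ} (hζ : ‖ζ‖ < 1) (β : ℝ) :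
    ∫ s in per, ((Real.cos (α s - β) : ℝ) : ℂ) * kz ζ s ≠ 0 := by
  intro h0
  have hpi := Real.pi_pos
  set φ : ℝ → ℝ := fun s => Real.cos (α s - β) with hφ
  have hφc : Continuous φ := by fun_prop
  have hφp : Function.Periodic φ (2 * π) := h.cos_periodic β
  have hP := continuous_Pk hζ
  have hPp := Pk_periodic ζ
  have hPpos := Pk_pos hζ
  set c : ℝ := (1 / (2 * π)) * ∫ s in per, φ s * Pk ζ s with hc
  have i1 : IntegrableOn (fun s => φ s * Pk ζ s) per := integrableOn_per (hφc.mul hP)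
  have i2 : IntegrableOn (fun s => Pk ζ s) per := integrableOn_per hP
  have hI := integral_Pk hζ
  have hcI : ∫ s in per, φ s * Pk ζ s = 2 * π * c := by rw [hc]; field_simp
  have c1 : c < 1 := by
    obtain ⟨s0, hs0⟩ := h.surj hα (β + π)
    have := per_int_pos (f := fun s => Pk ζ s - φ s * Pk ζ s) (by fun_prop) (hPp.sub (hφp.mul hPp)) s0
      (fun s _ => by
        have h1 := Real.cos_le_one (α s - β); have h2 := hPpos s; simp only [hφ]; nlinarith) (left_mem_Icc.2 (by linarith))
      (by have h2 := hPpos s0; simp only [hφ, hs0, add_sub_cancel_left, Real.cos_pi]; linarith)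
    rw [integral_sub i2 i1, hI, hcI] at this
    nlinarith
  have c2 : -1 < c := by
    obtain ⟨s0, hs0⟩ := h.surj hα β
    have := per_int_pos (f := fun s => Pk ζ s + φ s * Pk ζ s) (by fun_prop) (hPp.add (hφp.mul hPp)) s0
      (fun s _ => by
        have h1 := Real.neg_one_le_cos (α s - β); have h2 := hPpos s; simp only [hφ]; nlinarith) (left_mem_Icc.2 (by linarith))
      (by have h2 := hPpos s0; simp only [hφ, hs0, sub_self, Real.cos_zero]; linarith)
    rw [integral_add i2 i1, hI, hcI] at this
    nlinarith
  set γ := Real.arccos c with hγ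
  have hcγ : Real.cos γ = c := Real.cos_arccos c2.le c1.le
  have g0 : 0 < γ := Real.arccos_pos.2 c1
  have gpi : γ < π := by
    refine lt_of_le_of_ne (Real.arccos_le_pi c) fun he => ?_
    rw [he, Real.cos_pi] at hcγ; linarith
  obtain ⟨p, hp⟩ := h.surj hα (β - γ)
  obtain ⟨q, hq⟩ := h.surj hα (β + γ)
  obtain ⟨s0, hs0⟩ := h.surj hα β
  have hmono := h.mono
  have hps : p < s0 := by by_contra hh; have := hmono (not_lt.1 hh); linarith
  have hsq : s0 < q := by by_contra hh; have := hmono (not_lt.1 hh); linarith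
  have hqp : q < p + 2 * π := by
    by_contra hh; have := hmono (not_lt.1 hh); rw [h.quasi] at this; linarith
  set T : ℝ → ℝ := fun s => (φ s - c) * ((Real.cos ((q - p) / 2) - (cis (-((p + q) / 2)) * cis s).re) / (‖cis s - ζ‖ ^ 2) ^ 2) with hT
  have hTe : ∀ s, T s = (φ s - c) * (2 * Real.sin ((s - p) / 2) * Real.sin ((s - q) / 2) / (‖cis s - ζ‖ ^ 2) ^ 2) := by
    intro s
    simp only [hT]
    rw [← cis_add, cis_re]
    congr 2
    rw [show (q - p) / 2 = (s - p) / 2 - (s - q) / 2 by ring, show -((p + q) / 2) + s = (s - p) / 2 + (s - q) / 2 by ring,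
      Real.cos_sub, Real.cos_add]
    ring
  have hDpos : ∀ s, 0 < (‖cis s - ζ‖ ^ 2) ^ 2 := fun s => by
    have : 0 < ‖cis s - ζ‖ := norm_pos_iff.2 (cis_sub_ne hζ s)
    positivity
  have hcis := continuous_cis
  have hTc : Continuous T := by
    refine (hφc.sub continuous_const).mul (Continuous.div ?_ (by fun_prop) fun s => (hDpos s).ne')
    exact continuous_const.sub (Complex.continuous_re.comp (continuous_const.mul hcis))
  have hTp : Function.Periodic T (2 * π) := by
    intro s; simp only [hT, cis_period, hφp s]
  have hneg : 0 < ∫ s in per, -T s := by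
    refine per_int_pos hTc.neg (fun s => by simp only [hTp s]) p (fun s hs => ?_) (s0 := s0) ⟨hps.le, by linarith⟩ ?_
    · rw [hTe, neg_nonneg]
      have hDs := hDpos s
      have a1 := hmono hs.1
      have a2 := hmono hs.2
      rw [h.quasi] at a2
      have sp : 0 ≤ Real.sin ((s - p) / 2) := Real.sin_nonneg_of_nonneg_of_le_pi (by linarith [hs.1]) (by linarith [hs.2])
      rcases le_total s q with hsq' | hsq'
      · have b := hmono hsq'
        have sq : Real.sin ((s - q) / 2) ≤ 0 := Real.sin_nonpos_of_nonpos_of_neg_pi_le (by linarith) (by linarith [hs.1])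
        have hφs : c ≤ φ s := by
          rw [← hcγ, hφ]
          simp only
          rw [← Real.cos_abs (α s - β)]
          exact Real.cos_le_cos_of_nonneg_of_le_pi (abs_nonneg _) gpi.le (abs_le.2 ⟨by linarith, by linarith⟩)
        refine mul_nonpos_of_nonneg_of_nonpos (by linarith) (div_nonpos_of_nonpos_of_nonneg ?_ hDs.le)
        nlinarith
      · have b := hmono hsq'
        have sq : 0 ≤ Real.sin ((s - q) / 2) := Real.sin_nonneg_of_nonneg_of_le_pi (by linarith) (by linarith [hs.2])
        have hφs : φ s ≤ c := by
          rw [← hcγ, hφ]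
          simp only
          rcases le_total (α s - β) π with h3 | h3
          · exact Real.cos_le_cos_of_nonneg_of_le_pi g0.le h3 (by linarith)
          · rw [← Real.cos_two_pi_sub]
            exact Real.cos_le_cos_of_nonneg_of_le_pi g0.le (by linarith) (by linarith)
        refine mul_nonpos_of_nonpos_of_nonneg (by linarith) (div_nonneg ?_ hDs.le)
        positivity
    · rw [hTe, neg_pos]
      have hDs := hDpos s0
      have sp : 0 < Real.sin ((s0 - p) / 2) := Real.sin_pos_of_pos_of_lt_pi (by linarith) (by linarith)
      have sq : Real.sin ((s0 - q) / 2) < 0 := Real.sin_neg_of_neg_of_neg_pi_lt (by linarith) (by linarith)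
      have hφs : φ s0 = 1 := by simp [hφ, hs0]
      rw [hφs]
      refine mul_neg_of_pos_of_neg (by linarith) (div_neg_of_neg_of_pos ?_ hDs)
      nlinarith
  -- the integral vanishes
  set w := cis (-((p + q) / 2)) with hw
  set C := Real.cos ((q - p) / 2) with hC
  set k1 : ℂ := 2 * C * ζ - w * ζ ^ 2 - starRingEnd ℂ w with hk1
  set k2 : ℝ := C * (1 + ‖ζ‖ ^ 2) - 2 * (w * ζ).re with hk2
  have hn : 0 < 1 - ‖ζ‖ ^ 2 := by nlinarith [norm_nonneg ζ]
  have hTk : ∀ s, (1 - ‖ζ‖ ^ 2) ^ 2 * T s = (k1 * ((φ s : ℂ) * kz ζ s)).re - c * (k1 * kz ζ s).re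
      + (k2 / (1 - ‖ζ‖ ^ 2) * (φ s * Pk ζ s) - k2 / (1 - ‖ζ‖ ^ 2) * c * Pk ζ s) := by
    intro s
    have := kz_ident hζ w C s
    rw [← hk1, ← hk2] at this
    have e0 : (k1 * ((φ s : ℂ) * kz ζ s)).re = φ s * (k1 * kz ζ s).re := by
      rw [show k1 * ((φ s : ℂ) * kz ζ s) = (φ s : ℂ) * (k1 * kz ζ s) by ring, Complex.re_ofReal_mul]
    calc (1 - ‖ζ‖ ^ 2) ^ 2 * T s = (φ s - c) * ((1 - ‖ζ‖ ^ 2) ^ 2 * ((C - (w * cis s).re) / (‖cis s - ζ‖ ^ 2) ^ 2)) := by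
          simp only [hT]; ring
      _ = _ := by
          rw [this, e0, Pk]
          field_simp
  have hkz := continuous_kz hζ
  have j1 : IntegrableOn (fun s => (φ s : ℂ) * kz ζ s) per := integrableOn_per ((Complex.continuous_ofReal.comp hφc).mul hkz)
  have j2 : IntegrableOn (fun s => kz ζ s) per := integrableOn_per hkz
  have z1 : ∫ s in per, (k1 * ((φ s : ℂ) * kz ζ s)).re = 0 := by
    have := integral_re (j1.const_mul k1)
    simp only [RCLike.re_eq_complex_re] at this
    rw [this, integral_const_mul, h0]; simp
  have z2 : ∫ s in per, (k1 * kz ζ s).re = 0 := by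
    have := integral_re (j2.const_mul k1)
    simp only [RCLike.re_eq_complex_re] at this
    rw [this, integral_const_mul, integral_kz hζ]; simp
  have l1 : IntegrableOn (fun s => (k1 * ((φ s : ℂ) * kz ζ s)).re) per := (j1.const_mul k1).re
  have l2 : IntegrableOn (fun s => c * (k1 * kz ζ s).re) per := ((j2.const_mul k1).re).const_mul c
  have l3 : IntegrableOn (fun s => k2 / (1 - ‖ζ‖ ^ 2) * (φ s * Pk ζ s)) per := i1.const_mul _
  have l4 : IntegrableOn (fun s => k2 / (1 - ‖ζ‖ ^ 2) * c * Pk ζ s) per := i2.const_mul _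
  have l12 : IntegrableOn (fun s => (k1 * ((φ s : ℂ) * kz ζ s)).re - c * (k1 * kz ζ s).re) per := l1.sub l2
  have l34 : IntegrableOn (fun s => k2 / (1 - ‖ζ‖ ^ 2) * (φ s * Pk ζ s) - k2 / (1 - ‖ζ‖ ^ 2) * c * Pk ζ s) per := l3.sub l4
  have hz : ∫ s in per, (1 - ‖ζ‖ ^ 2) ^ 2 * T s = 0 := by
    simp only [hTk]
    rw [integral_add l12 l34, integral_sub l1 l2, integral_sub l3 l4, z1, integral_const_mul, z2, integral_const_mul, integral_const_mul, hI, hcI]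
    ring
  rw [integral_const_mul] at hz
  rw [integral_neg] at hneg
  have : (1 - ‖ζ‖ ^ 2) ^ 2 * ∫ s in per, T s < 0 := mul_neg_of_pos_of_neg (by positivity) (by linarith)
  linarith

/-! ### A section of the harmonic map -/

/-- The harmonic map associated with two holomorphic functions. -/
noncomputable def zmap (A B : ℂ → ℂ) (ζ : ℂ) : ℂ := ⟨(A ζ).re, (B ζ).re⟩

lemma zmap_local {A B : ℂ → ℂ} {ζ₀ : ℂ} (hA : AnalyticAt ℂ A ζ₀) (hB : AnalyticAt ℂ B ζ₀)
    (hJ : (starRingEnd ℂ (deriv A ζ₀) * deriv B ζ₀).im ≠ 0) :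
    ∃ e : OpenPartialHomeomorph ℂ ℂ, ζ₀ ∈ e.source ∧ zmap A B = e := by
  set P : ℂ → ℝ × ℝ := fun ζ => ((A ζ).re, (B ζ).re) with hP
  have cA : ContDiffAt ℝ 2 (fun ζ => (A ζ).re) ζ₀ :=
    Complex.reCLM.contDiff.contDiffAt.comp ζ₀ (hA.contDiffAt.restrict_scalars ℝ)
  have cB : ContDiffAt ℝ 2 (fun ζ => (B ζ).re) ζ₀ :=
    Complex.reCLM.contDiff.contDiffAt.comp ζ₀ (hB.contDiffAt.restrict_scalars ℝ)
  have cP : ContDiffAt ℝ 2 P ζ₀ := cA.prodMk cB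
  have dP : HasFDerivAt P
      ((Complex.reCLM.comp ((ContinuousLinearMap.toSpanSingleton ℂ (deriv A ζ₀)).restrictScalars ℝ)).prod
       (Complex.reCLM.comp ((ContinuousLinearMap.toSpanSingleton ℂ (deriv B ζ₀)).restrictScalars ℝ)))
      ζ₀ := (hasFDerivAt_re_of_hasDerivAt hA.differentiableAt.hasDerivAt).prodMk
        (hasFDerivAt_re_of_hasDerivAt hB.differentiableAt.hasDerivAt)
  obtain ⟨e, he⟩ := exists_equiv_of_injective (by simp)
    ((Complex.reCLM.comp ((ContinuousLinearMap.toSpanSingleton ℂ (deriv A ζ₀)).restrictScalars ℝ)).prod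
     (Complex.reCLM.comp ((ContinuousLinearMap.toSpanSingleton ℂ (deriv B ζ₀)).restrictScalars ℝ)))
    (by
      intro v hv
      simp only [ContinuousLinearMap.prod_apply, Prod.mk_eq_zero] at hv
      obtain ⟨h1, h2⟩ := hv
      simp at h1 h2
      simp at hJ
      have e1 : v.re * ((deriv A ζ₀).re * (deriv B ζ₀).im + -((deriv A ζ₀).im * (deriv B ζ₀).re)) = 0 := by
        linear_combination (deriv B ζ₀).im * h1 - (deriv A ζ₀).im * h2
      have e2 : v.im * ((deriv A ζ₀).re * (deriv B ζ₀).im + -((deriv A ζ₀).im * (deriv B ζ₀).re)) = 0 := by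
        linear_combination (deriv B ζ₀).re * h1 - (deriv A ζ₀).re * h2
      apply Complex.ext
      · exact (mul_eq_zero.1 e1).resolve_right hJ
      · exact (mul_eq_zero.1 e2).resolve_right hJ)
  have hPe : HasFDerivAt P (e : ℂ →L[ℝ] ℝ × ℝ) ζ₀ := by
    rw [he]; exact dP
  have hst := cP.hasStrictFDerivAt' hPe (by simp)
  refine ⟨(hst.toOpenPartialHomeomorph P).trans Complex.equivRealProdCLM.symm.toHomeomorph.toOpenPartialHomeomorph, ?_, ?_⟩
  · simpa using hst.mem_toOpenPartialHomeomorph_source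
  · funext ζ
    rfl

lemma zmap_section {A B : ℂ → ℂ} (hA : ∀ ζ ∈ Metric.ball (0 : ℂ) 1, AnalyticAt ℂ A ζ)
    (hB : ∀ ζ ∈ Metric.ball (0 : ℂ) 1, AnalyticAt ℂ B ζ)
    (hJ : ∀ ζ ∈ Metric.ball (0 : ℂ) 1, (starRingEnd ℂ (deriv A ζ) * deriv B ζ).im ≠ 0)
    (hm : ∀ ζ ∈ Metric.ball (0 : ℂ) 1, zmap A B ζ ∈ Metric.ball (0 : ℂ) 1)
    (hbd : ∀ ζ : ℂ, ‖ζ‖ = 1 → ∃ b : ℂ, ‖b‖ = 1 ∧ Tendsto (zmap A B) (𝓝[Metric.ball 0 1] ζ) (𝓝 b)) :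
    ∃ σ : ℂ → ℂ, ContinuousOn σ (Metric.ball 0 1) ∧ (∀ z ∈ Metric.ball (0 : ℂ) 1, σ z ∈ Metric.ball (0 : ℂ) 1) ∧
      ∀ z ∈ Metric.ball (0 : ℂ) 1, zmap A B (σ z) = z := by
  set D : Set ℂ := Metric.ball (0 : ℂ) 1 with hD
  have hDo : IsOpen D := Metric.isOpen_ball
  set F : D → D := fun ζ => ⟨zmap A B ζ, hm ζ ζ.2⟩ with hF
  have hlocal : IsLocalHomeomorphOn (zmap A B) D := fun ζ hζ => by
    obtain ⟨e, he, h⟩ := zmap_local (hA ζ hζ) (hB ζ hζ) (hJ ζ hζ)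
    exact ⟨e, he, h⟩
  have hFc : Continuous F := by
    refine Continuous.subtype_mk ?_ _
    exact hlocal.continuousOn.restrict
  have hval : IsLocalHomeomorph (Subtype.val : D → ℂ) := hDo.isOpenEmbedding_subtypeVal.isLocalHomeomorph
  have hFl : IsLocalHomeomorph F := by
    refine IsLocalHomeomorph.of_comp (g := (Subtype.val : D → ℂ)) ?_ hval hFc
    have : (Subtype.val : D → ℂ) ∘ F = zmap A B ∘ (Subtype.val : D → ℂ) := rfl
    rw [this, isLocalHomeomorph_iff_isLocalHomeomorphOn_univ]
    exact hlocal.comp hval.isLocalHomeomorphOn fun x _ => x.2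
  have hprop : IsProperMap F := by
    refine isProperMap_iff_ultrafilter_of_t2.2 ⟨hFc, fun 𝒰 y hy => ?_⟩
    have hcomp : IsCompact (Metric.closedBall (0 : ℂ) 1) := isCompact_closedBall _ _
    obtain ⟨ζ, hζ, hle⟩ := hcomp.ultrafilter_le_nhds (𝒰.map (Subtype.val : D → ℂ))
      (le_principal_iff.2 (Ultrafilter.mem_map.2 (univ_mem' fun x => Metric.ball_subset_closedBall x.2)))
    have ht : Tendsto (Subtype.val : D → ℂ) 𝒰 (𝓝 ζ) := hle
    have hζ1 : ‖ζ‖ ≤ 1 := by simpa using hζ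
    rcases hζ1.lt_or_eq with hlt | heq
    · refine ⟨⟨ζ, by simpa [hD] using hlt⟩, ?_⟩
      rw [nhds_subtype_eq_comap]
      exact tendsto_iff_comap.1 ht
    · exfalso
      obtain ⟨b, hb, htb⟩ := hbd ζ heq
      have t1 : Tendsto (Subtype.val : D → ℂ) 𝒰 (𝓝[D] ζ) :=
        tendsto_nhdsWithin_iff.2 ⟨ht, Eventually.of_forall fun x => x.2⟩
      have t2 : Tendsto (fun x : D => (F x : ℂ)) 𝒰 (𝓝 b) := htb.comp t1
      have t3 : Tendsto (fun x : D => (F x : ℂ)) 𝒰 (𝓝 (y : ℂ)) := (continuous_subtype_val.tendsto y).comp hy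
      have := tendsto_nhds_unique t2 t3
      have h2 : ‖(y : ℂ)‖ < 1 := mem_ball_zero_iff.1 y.2
      rw [← this] at h2; linarith
  have hfin : ∀ x : D, (F ⁻¹' {x}).Finite := fun x => by
    refine (hprop.isCompact_preimage isCompact_singleton).finite ?_
    refine ((hFl.isLocalHomeomorphOn).mono (subset_univ _)).isDiscrete_of_image ?_
    exact (Set.Finite.subset (finite_singleton x) (image_preimage_subset F {x})).isDiscrete
  have hcovOn : IsCoveringMapOn F univ :=
    hprop.isClosedMap.isCoveringMapOn_of_isLocalHomeomorphOn (fun x _ => hfin x) (hFl.isLocalHomeomorphOn.mono (subset_univ _))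
  have hcov : IsCoveringMap F := isCoveringMap_iff_isCoveringMapOn_univ.2 hcovOn
  have hD0 : (0 : ℂ) ∈ D := by simp [hD]
  haveI : ContractibleSpace D := (convex_ball (0 : ℂ) 1).contractibleSpace ⟨0, hD0⟩
  haveI : LocallyPathConnectedSpace D := hDo.locallyPathConnectedSpace
  obtain ⟨s, ⟨_, hs⟩, _⟩ := hcov.existsUnique_continuousMap_lifts (ContinuousMap.id D) (F ⟨0, hD0⟩) ⟨0, hD0⟩ rfl
  classical
  refine ⟨fun z => if h : z ∈ D then (s ⟨z, h⟩ : ℂ) else 0, ?_, ?_, ?_⟩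
  · rw [continuousOn_iff_continuous_restrict]
    have : D.domRestrict (fun z => if h : z ∈ D then (s ⟨z, h⟩ : ℂ) else 0) = fun x => (s x : ℂ) := by
      funext x; simp [Set.domRestrict]
    rw [this]
    exact continuous_subtype_val.comp s.continuous
  · intro z hz; simp only [dif_pos hz]; exact (s ⟨z, hz⟩).2
  · intro z hz
    simp only [dif_pos hz]
    have := congrFun hs ⟨z, hz⟩
    exact congrArg Subtype.val this

/-! ### Solution of the Plateau problem over a disk for Lipschitz data -/

lemma Hz_tendsto {X : ℝ → ℝ} (hX : Continuous X) (hper : Function.Periodic X (2 * π)) (s0 : ℝ) :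
    Tendsto (fun ζ => (Hz X ζ).re) (𝓝[Metric.ball 0 1] (cis s0)) (𝓝 (X s0)) := by
  rw [Metric.tendsto_nhdsWithin_nhds]
  intro ε hε
  obtain ⟨η, hη, h⟩ := Hz_boundary hX hper s0 hε
  refine ⟨η, hη, fun ζ hζ hd => ?_⟩
  rw [Real.dist_eq]
  exact h ζ (mem_ball_zero_iff.1 hζ) (by rwa [dist_eq_norm] at hd)

lemma analyticAt_Hz {X : ℝ → ℝ} (hX : Continuous X) {ζ : ℂ} (hζ : ζ ∈ Metric.ball (0 : ℂ) 1) : AnalyticAt ℂ (Hz X) ζ := by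
  have : DifferentiableOn ℂ (Hz X) (Metric.ball 0 1) := fun z hz =>
    (hasDerivAt_Hz hX (mem_ball_zero_iff.1 hz)).differentiableAt.differentiableWithinAt
  exact this.analyticAt (Metric.isOpen_ball.mem_nhds hζ)

lemma exists_angle {a b : ℂ} (h : (starRingEnd ℂ a * b).im = 0) :
    ∃ β : ℝ, (Real.cos β : ℂ) * a + (Real.sin β : ℂ) * b = 0 := by
  by_cases ha : a = 0
  · exact ⟨0, by simp [ha]⟩
  set t : ℝ := (starRingEnd ℂ a * b).re / Complex.normSq a with ht
  have hn : Complex.normSq a ≠ 0 := by simpa using ha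
  have hb : b = (t : ℂ) * a := by
    have e1 : starRingEnd ℂ a * b = ((starRingEnd ℂ a * b).re : ℂ) := by
      apply Complex.ext
      · simp only [Complex.ofReal_re]
      · rw [h]; simp only [Complex.ofReal_im]
    have e2 : (Complex.normSq a : ℂ) = starRingEnd ℂ a * a := Complex.normSq_eq_conj_mul_self
    have e3 : (Complex.normSq a : ℂ) * b = (Complex.normSq a : ℂ) * ((t : ℂ) * a) := by
      have e4 : (Complex.normSq a : ℂ) * (t : ℂ) = starRingEnd ℂ a * b := by
        rw [e1, ht, ← Complex.ofReal_mul]; congr 1; field_simp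
      rw [← mul_assoc, e4, e2]; ring
    exact mul_left_cancel₀ (by exact_mod_cast hn) e3
  set w : ℂ := ⟨-t, 1⟩ with hw
  have hw0 : w ≠ 0 := fun h0 => by have := congrArg Complex.im h0; simp [hw] at this
  refine ⟨Complex.arg w, ?_⟩
  rw [Complex.cos_arg hw0, Complex.sin_arg, hb]
  have : (‖w‖ : ℂ) ≠ 0 := by exact_mod_cast norm_ne_zero_iff.2 hw0
  simp only [hw, Complex.ofReal_div, Complex.ofReal_neg, Complex.ofReal_one]
  ring

lemma Hz_cos_sub {α : ℝ → ℝ} (hα : Continuous α) {ζ : ℂ} (hζ : ‖ζ‖ < 1) (β : ℝ) :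
    ∫ s in per, ((Real.cos (α s - β) : ℝ) : ℂ) * kz ζ s =
      (Real.cos β : ℂ) * (∫ s in per, (Real.cos (α s) : ℂ) * kz ζ s) + (Real.sin β : ℂ) * (∫ s in per, (Real.sin (α s) : ℂ) * kz ζ s) := by
  have hk := continuous_kz hζ
  have hc : Continuous fun s => (Real.cos (α s) : ℂ) := Complex.continuous_ofReal.comp (Real.continuous_cos.comp hα)
  have hs : Continuous fun s => (Real.sin (α s) : ℂ) := Complex.continuous_ofReal.comp (Real.continuous_sin.comp hα)
  have i1 : IntegrableOn (fun s => (Real.cos β : ℂ) * ((Real.cos (α s) : ℂ) * kz ζ s)) per :=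
    integrableOn_per (continuous_const.mul (hc.mul hk))
  have i2 : IntegrableOn (fun s => (Real.sin β : ℂ) * ((Real.sin (α s) : ℂ) * kz ζ s)) per :=
    integrableOn_per (continuous_const.mul (hs.mul hk))
  rw [← integral_const_mul, ← integral_const_mul, ← integral_add i1 i2]
  congr 1
  funext s
  rw [Real.cos_sub, Complex.ofReal_add, Complex.ofReal_mul, Complex.ofReal_mul]
  ring

lemma mean_lt_one {α : ℝ → ℝ} (h : Adm α) (hα : Continuous α) {ζ : ℂ} (hζ : ‖ζ‖ < 1) (β : ℝ) :
    (Hz (fun s => Real.cos (α s)) ζ).re * Real.cos β + (Hz (fun s => Real.sin (α s)) ζ).re * Real.sin β < 1 := by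
  have hpi := Real.pi_pos
  have hP := continuous_Pk hζ
  have hPp := Pk_periodic ζ
  have hPpos := Pk_pos hζ
  rw [re_Hz (by fun_prop) hζ, re_Hz (by fun_prop) hζ]
  have i1 : IntegrableOn (fun s => Real.cos β * (Real.cos (α s) * Pk ζ s)) per := integrableOn_per (by fun_prop)
  have i2 : IntegrableOn (fun s => Real.sin β * (Real.sin (α s) * Pk ζ s)) per := integrableOn_per (by fun_prop)
  have i3 : IntegrableOn (fun s => Pk ζ s) per := integrableOn_per hP
  have i12 : IntegrableOn (fun s => Real.cos β * (Real.cos (α s) * Pk ζ s) + Real.sin β * (Real.sin (α s) * Pk ζ s)) per := i1.add i2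
  obtain ⟨s0, hs0⟩ := h.surj hα (β + π)
  have hcs := h.cos_periodic β
  have key : ∀ s, Pk ζ s - (Real.cos β * (Real.cos (α s) * Pk ζ s) + Real.sin β * (Real.sin (α s) * Pk ζ s)) = Pk ζ s - Real.cos (α s - β) * Pk ζ s := by
    intro s; rw [Real.cos_sub]; ring
  have := per_int_pos (f := fun s => Pk ζ s - Real.cos (α s - β) * Pk ζ s) (by fun_prop) (hPp.sub (hcs.mul hPp)) s0
      (fun s _ => by
        have h1 := Real.cos_le_one (α s - β); have h2 := hPpos s; nlinarith) (left_mem_Icc.2 (by linarith))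
      (by have h2 := hPpos s0; simp only [hs0, add_sub_cancel_left, Real.cos_pi]; linarith)
  simp only [← key] at this
  rw [integral_sub i3 i12, integral_add i1 i2, integral_Pk hζ, integral_const_mul, integral_const_mul] at this
  have e : 1 / (2 * π) * (2 * π) = 1 := by field_simp
  have h3 : 0 < 1 / (2 * π) := by positivity
  nlinarith

theorem disk_param {g : ℂ → ℝ} {L : ℝ} (hL : ∀ z w, |g z - g w| ≤ L * ‖z - w‖) :
    ∃ A B G σ : ℂ → ℂ, (∀ ζ ∈ Metric.ball (0 : ℂ) 1, AnalyticAt ℂ A ζ ∧ AnalyticAt ℂ B ζ ∧ AnalyticAt ℂ G ζ ∧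
      deriv A ζ ^ 2 + deriv B ζ ^ 2 + deriv G ζ ^ 2 = 0 ∧ (starRingEnd ℂ (deriv A ζ) * deriv B ζ).im ≠ 0) ∧
      (∀ z ∈ Metric.ball (0 : ℂ) 1, σ z ∈ Metric.ball (0 : ℂ) 1 ∧ zmap A B (σ z) = z ∧
        ∀ᶠ ζ in 𝓝 (σ z), σ (zmap A B ζ) = ζ) ∧
      ∀ b : ℂ, ‖b‖ = 1 → Tendsto (fun w => (G (σ w)).re) (𝓝[Metric.ball 0 1] b) (𝓝 (g b)) := by
  have hg : Continuous g := by
    have : LipschitzWith (Real.toNNReal L) g := LipschitzWith.of_dist_le_mul fun z w => by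
      rw [Real.dist_eq, dist_eq_norm]
      refine (hL z w).trans (mul_le_mul_of_nonneg_right (Real.le_coe_toNNReal L) (norm_nonneg _))
    exact this.continuous
  obtain ⟨α, h, hmin⟩ := exists_minimizer hg
  have hE : denergy g α < ⊤ := (hmin _ adm_id).trans_lt (denergy_id_lt_top hL)
  have hα := h.continuous hE
  have hpi := Real.pi_pos
  have hcis := continuous_cis
  have cA : Continuous fun s => Real.cos (α s) := by fun_prop
  have cB : Continuous fun s => Real.sin (α s) := by fun_prop
  have cG : Continuous fun s => g (cis (α s)) := by fun_prop
  have pA : Function.Periodic (fun s => Real.cos (α s)) (2 * π) := fun s => by simp only [h.quasi, Real.cos_add_two_pi]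
  have pB : Function.Periodic (fun s => Real.sin (α s)) (2 * π) := fun s => by simp only [h.quasi, Real.sin_add_two_pi]
  have pG : Function.Periodic (fun s => g (cis (α s))) (2 * π) := fun s => by simp only [h.quasi, cis_period]
  set A := Hz (fun s => Real.cos (α s)) with hA
  set B := Hz (fun s => Real.sin (α s)) with hB
  set G := Hz (fun s => g (cis (α s))) with hG
  have aA : ∀ ζ ∈ Metric.ball (0 : ℂ) 1, AnalyticAt ℂ A ζ := fun ζ hζ => analyticAt_Hz cA hζ
  have aB : ∀ ζ ∈ Metric.ball (0 : ℂ) 1, AnalyticAt ℂ B ζ := fun ζ hζ => analyticAt_Hz cB hζ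
  have aG : ∀ ζ ∈ Metric.ball (0 : ℂ) 1, AnalyticAt ℂ G ζ := fun ζ hζ => analyticAt_Hz cG hζ
  have conf0 : ∀ ζ ∈ Metric.ball (0 : ℂ) 1, ζ ≠ 0 → deriv A ζ ^ 2 + deriv B ζ ^ 2 + deriv G ζ ^ 2 = 0 := by
    intro ζ hζ h0
    have hζ' := mem_ball_zero_iff.1 hζ
    rw [(hasDerivAt_Hz cA hζ').deriv, (hasDerivAt_Hz cB hζ').deriv, (hasDerivAt_Hz cG hζ').deriv]
    have := conformal_raw h hg hE hmin hζ' h0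
    rw [mul_pow, mul_pow, mul_pow, ← mul_add, ← mul_add, this, mul_zero]
  have conf : ∀ ζ ∈ Metric.ball (0 : ℂ) 1, deriv A ζ ^ 2 + deriv B ζ ^ 2 + deriv G ζ ^ 2 = 0 := by
    intro ζ hζ
    by_cases h0 : ζ = 0
    · have c : ContinuousAt (fun ζ => deriv A ζ ^ 2 + deriv B ζ ^ 2 + deriv G ζ ^ 2) ζ :=
        (((aA ζ hζ).deriv.continuousAt.pow 2).add ((aB ζ hζ).deriv.continuousAt.pow 2)).add ((aG ζ hζ).deriv.continuousAt.pow 2)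
      have t1 : Tendsto (fun ζ => deriv A ζ ^ 2 + deriv B ζ ^ 2 + deriv G ζ ^ 2) (𝓝[≠] ζ) _ := c.tendsto.mono_left nhdsWithin_le_nhds
      refine tendsto_nhds_unique t1 (tendsto_const_nhds.congr' ?_)
      filter_upwards [self_mem_nhdsWithin, nhdsWithin_le_nhds (Metric.isOpen_ball.mem_nhds hζ)] with w hw1 hw2
      exact (conf0 w hw2 (by rw [h0] at hw1; exact hw1)).symm
    · exact conf0 ζ hζ h0
  have jac : ∀ ζ ∈ Metric.ball (0 : ℂ) 1, (starRingEnd ℂ (deriv A ζ) * deriv B ζ).im ≠ 0 := by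
    intro ζ hζ hcon
    have hζ' := mem_ball_zero_iff.1 hζ
    obtain ⟨β, hβ⟩ := exists_angle hcon
    rw [(hasDerivAt_Hz cA hζ').deriv, (hasDerivAt_Hz cB hζ').deriv] at hβ
    apply rkc h hα hζ' β
    rw [Hz_cos_sub hα hζ' β]
    have hpi0 : ((1 / π : ℝ) : ℂ) ≠ 0 := by
      have : (1 / π : ℝ) ≠ 0 := by positivity
      exact_mod_cast this
    refine (mul_eq_zero.1 (?_ : ((1 / π : ℝ) : ℂ) * _ = 0)).resolve_left hpi0
    rw [← hβ]; ring
  have hm : ∀ ζ ∈ Metric.ball (0 : ℂ) 1, zmap A B ζ ∈ Metric.ball (0 : ℂ) 1 := by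
    intro ζ hζ
    have hζ' := mem_ball_zero_iff.1 hζ
    rw [mem_ball_zero_iff]
    by_cases h0 : zmap A B ζ = 0
    · rw [h0]; simp
    have := mean_lt_one h hα hζ' (Complex.arg (zmap A B ζ))
    rw [Complex.cos_arg h0, Complex.sin_arg] at this
    have hn : 0 < ‖zmap A B ζ‖ := norm_pos_iff.2 h0
    have e : ‖zmap A B ζ‖ ^ 2 = (zmap A B ζ).re ^ 2 + (zmap A B ζ).im ^ 2 := by
      rw [← Complex.normSq_eq_norm_sq, Complex.normSq_apply]; ring
    calc ‖zmap A B ζ‖ = ‖zmap A B ζ‖ ^ 2 / ‖zmap A B ζ‖ := by field_simp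
      _ = (A ζ).re * ((zmap A B ζ).re / ‖zmap A B ζ‖) + (B ζ).re * ((zmap A B ζ).im / ‖zmap A B ζ‖) := by
          rw [e]
          have e1 : (zmap A B ζ).re = (A ζ).re := rfl
          have e2 : (zmap A B ζ).im = (B ζ).re := rfl
          rw [e1, e2]; ring
      _ < 1 := this
  have hcisarg : ∀ ζ : ℂ, ‖ζ‖ = 1 → cis (Complex.arg ζ) = ζ := by
    intro ζ hζ
    have := Complex.norm_mul_exp_arg_mul_I ζ
    rwa [hζ, Complex.ofReal_one, one_mul] at this
  have tz : ∀ s0 : ℝ, Tendsto (zmap A B) (𝓝[Metric.ball 0 1] (cis s0)) (𝓝 (cis (α s0))) := by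
    intro s0
    have t1 := Hz_tendsto cA pA s0
    have t2 := Hz_tendsto cB pB s0
    have t3 := (continuous_toC.tendsto (Real.cos (α s0), Real.sin (α s0))).comp (t1.prodMk_nhds t2)
    rw [cis_eq (α s0)]
    exact t3
  obtain ⟨σ, hσc, hσm, hσs⟩ := zmap_section aA aB jac hm (fun ζ hζ => ⟨cis (α (Complex.arg ζ)), norm_cis _, by
    have := tz (Complex.arg ζ); rwa [hcisarg ζ hζ] at this⟩)
  refine ⟨A, B, G, σ, fun ζ hζ => ⟨aA ζ hζ, aB ζ hζ, aG ζ hζ, conf ζ hζ, jac ζ hζ⟩, fun z hz => ⟨hσm z hz, hσs z hz, ?_⟩, ?_⟩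
  · obtain ⟨e, he, hze⟩ := zmap_local (aA _ (hσm z hz)) (aB _ (hσm z hz)) (jac _ (hσm z hz))
    have hzc : ContinuousAt (zmap A B) (σ z) := by rw [hze]; exact e.continuousAt he
    have hσca : ContinuousAt σ z := (hσc z hz).continuousAt (Metric.isOpen_ball.mem_nhds hz)
    have hcomp : Tendsto (fun ζ => σ (zmap A B ζ)) (𝓝 (σ z)) (𝓝 (σ z)) := by
      have h1 : Tendsto (zmap A B) (𝓝 (σ z)) (𝓝 z) := by have := hzc.tendsto; rwa [hσs z hz] at this
      exact hσca.tendsto.comp h1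
    filter_upwards [hcomp.eventually (e.open_source.mem_nhds he), e.open_source.mem_nhds he,
      Metric.isOpen_ball.mem_nhds (hσm z hz)] with ζ h1 h2 h3
    refine e.injOn h1 h2 ?_
    rw [← hze]
    exact hσs _ (hm ζ h3)
  · intro b hb
    rw [tendsto_iff_ultrafilter]
    intro 𝒰 h𝒰
    have hb1 : Metric.ball (0 : ℂ) 1 ∈ (𝒰 : Filter ℂ) := h𝒰 self_mem_nhdsWithin
    have hidt : Tendsto id (𝒰 : Filter ℂ) (𝓝 b) := h𝒰.trans nhdsWithin_le_nhds
    obtain ⟨ζ, hζ, hle⟩ := (isCompact_closedBall (0 : ℂ) 1).ultrafilter_le_nhds (𝒰.map σ)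
      (le_principal_iff.2 (Ultrafilter.mem_map.2 (mem_of_superset hb1 fun w hw => Metric.ball_subset_closedBall (hσm w hw))))
    have ht : Tendsto σ 𝒰 (𝓝 ζ) := hle
    have hζ1 : ‖ζ‖ ≤ 1 := by simpa using hζ
    have hzid : ∀ᶠ w in (𝒰 : Filter ℂ), zmap A B (σ w) = id w := mem_of_superset hb1 fun w hw => hσs w hw
    rcases hζ1.lt_or_eq with hlt | heq
    · exfalso
      have hζb : ζ ∈ Metric.ball (0 : ℂ) 1 := mem_ball_zero_iff.2 hlt
      obtain ⟨e, he, hze⟩ := zmap_local (aA _ hζb) (aB _ hζb) (jac _ hζb)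
      have hzc : ContinuousAt (zmap A B) ζ := by rw [hze]; exact e.continuousAt he
      have t1 : Tendsto id (𝒰 : Filter ℂ) (𝓝 (zmap A B ζ)) := (hzc.tendsto.comp ht).congr' hzid
      have := tendsto_nhds_unique hidt t1
      have h2 := mem_ball_zero_iff.1 (hm ζ hζb)
      rw [← this] at h2; linarith
    · have ht' : Tendsto σ 𝒰 (𝓝[Metric.ball 0 1] (cis (Complex.arg ζ))) := by
        rw [hcisarg ζ heq]
        exact tendsto_nhdsWithin_iff.2 ⟨ht, mem_of_superset hb1 fun w hw => hσm w hw⟩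
      have t1 : Tendsto id (𝒰 : Filter ℂ) (𝓝 (cis (α (Complex.arg ζ)))) := ((tz (Complex.arg ζ)).comp ht').congr' hzid
      have e := tendsto_nhds_unique hidt t1
      rw [e]
      exact (Hz_tendsto cG pG (Complex.arg ζ)).comp ht'

/-! ### Dirichlet problem in disks -/

lemma isMSE_of_pt {U : ℝ × ℝ → ℝ} {Ω : Set (ℝ × ℝ)} (ho : IsOpen Ω)
    (h : ∀ z ∈ Ω, ContDiffAt ℝ 2 U z ∧ mseExpr U z = 0) : IsMSE U Ω :=
  (isMSE_iff ho).2 h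

theorem disk_lip {g : ℂ → ℝ} {L : ℝ} (hL : ∀ z w, |g z - g w| ≤ L * ‖z - w‖) (P : ℝ × ℝ) {ρ : ℝ} (hρ : 0 < ρ) :
    ∃ U : ℝ × ℝ → ℝ, IsMSE U (eball P ρ) ∧
      ∀ b, ‖toC b - toC P‖ = ρ → Tendsto U (𝓝[eball P ρ] b) (𝓝 (g (toC b))) := by
  have hL0 : ∀ z w, |g (toC P + ρ * z) / ρ - g (toC P + ρ * w) / ρ| ≤ L * ‖z - w‖ := by
    intro z w
    rw [← sub_div, abs_div, abs_of_pos hρ, div_le_iff₀ hρ]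
    refine (hL _ _).trans_eq ?_
    rw [show toC P + ρ * z - (toC P + ρ * w) = (ρ : ℂ) * (z - w) by ring, norm_mul, Complex.norm_real, Real.norm_eq_abs, abs_of_pos hρ]
    ring
  obtain ⟨A, B, G, σ, hp, hσ, hbd⟩ := disk_param (g := fun w => g (toC P + ρ * w) / ρ) hL0
  have hρc : (ρ : ℂ) ≠ 0 := by exact_mod_cast hρ.ne'
  set T : ℝ × ℝ → ℂ := fun z => (toC z - toC P) / ρ with hT
  have hTc : Continuous T := (continuous_toC.sub continuous_const).div_const _
  have hTb : ∀ z, z ∈ eball P ρ → T z ∈ Metric.ball (0 : ℂ) 1 := by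
    intro z hz
    rw [mem_ball_zero_iff, hT]
    simp only [norm_div, Complex.norm_real, Real.norm_eq_abs, abs_of_pos hρ]
    rw [div_lt_one hρ]
    exact mem_eball.1 hz
  refine ⟨fun z => ρ * (G (σ (T z))).re, isMSE_of_pt (isOpen_eball P ρ) fun z hz => ?_, fun b hb => ?_⟩
  · obtain ⟨s1, s2, s3⟩ := hσ (T z) (hTb z hz)
    obtain ⟨hA, hB, hG, hc, hJ⟩ := hp _ s1
    have hT1 : ∀ ζ, T ((P.1 + ρ * A ζ : ℂ).re, (P.2 + ρ * B ζ : ℂ).re) = zmap A B ζ := by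
      intro ζ
      rw [hT]
      simp only
      rw [div_eq_iff hρc]
      apply Complex.ext <;> simp [zmap] <;> ring
    have hz' : ((P.1 + ρ * A (σ (T z)) : ℂ).re, (P.2 + ρ * B (σ (T z)) : ℂ).re) = z := by
      have e := hT1 (σ (T z))
      rw [s2] at e
      simp only [hT] at e
      rw [div_left_inj' hρc, sub_left_inj] at e
      have := congrArg toR e
      rwa [toR_toC, toR_toC] at this
    have dA : deriv (fun ζ => (P.1 : ℂ) + ρ * A ζ) (σ (T z)) = ρ * deriv A (σ (T z)) := by
      rw [deriv_const_add, deriv_const_mul _ hA.differentiableAt]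
    have dB : deriv (fun ζ => (P.2 : ℂ) + ρ * B ζ) (σ (T z)) = ρ * deriv B (σ (T z)) := by
      rw [deriv_const_add, deriv_const_mul _ hB.differentiableAt]
    have dG : deriv (fun ζ => (ρ : ℂ) * G ζ) (σ (T z)) = ρ * deriv G (σ (T z)) := by
      rw [deriv_const_mul _ hG.differentiableAt]
    have := mse_of_param (A := fun ζ => (P.1 : ℂ) + ρ * A ζ) (B := fun ζ => (P.2 : ℂ) + ρ * B ζ) (G := fun ζ => (ρ : ℂ) * G ζ)
      (ζ₀ := σ (T z)) (U := fun z => ρ * (G (σ (T z))).re)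
      (analyticAt_const.add (analyticAt_const.mul hA)) (analyticAt_const.add (analyticAt_const.mul hB)) (analyticAt_const.mul hG)
      (by rw [dA, dB, dG, mul_pow, mul_pow, mul_pow, ← mul_add, ← mul_add, hc, mul_zero])
      (by
        rw [dA, dB, map_mul, Complex.conj_ofReal,
          show (ρ : ℂ) * starRingEnd ℂ (deriv A (σ (T z))) * (ρ * deriv B (σ (T z))) =
            ((ρ * ρ : ℝ) : ℂ) * (starRingEnd ℂ (deriv A (σ (T z))) * deriv B (σ (T z))) by push_cast; ring, Complex.im_ofReal_mul]
        exact mul_ne_zero (by positivity) hJ)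
      (by
        filter_upwards [s3] with ζ h3
        simp only [hT1, h3, Complex.re_ofReal_mul])
    simp only [hz'] at this
    exact this
  · have hTb1 : ‖T b‖ = 1 := by
      rw [hT]
      simp only [norm_div, Complex.norm_real, Real.norm_eq_abs, abs_of_pos hρ]
      rw [hb, div_self hρ.ne']
    have t1 := hbd (T b) hTb1
    have t2 : Tendsto T (𝓝[eball P ρ] b) (𝓝[Metric.ball 0 1] (T b)) :=
      tendsto_nhdsWithin_iff.2 ⟨hTc.continuousAt.tendsto.mono_left nhdsWithin_le_nhds, eventually_mem_nhdsWithin.mono fun z hz => hTb z hz⟩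
    have t3 := (t1.comp t2).const_mul ρ
    have e : ρ * (g (toC P + ρ * T b) / ρ) = g (toC b) := by
      rw [mul_div_cancel₀ _ hρ.ne']
      congr 1
      simp only [hT]
      field_simp
      ring
    rw [e] at t3
    exact t3

/-- Uniform approximation on a compact set of continuous functions by Lipschitz ones. -/
lemma lip_approx {S : Set ℂ} (hS : IsCompact S) (hne : S.Nonempty) {g : ℂ → ℝ} (hg : ContinuousOn g S) {ε : ℝ} (hε : 0 < ε) :
    ∃ (h : ℂ → ℝ) (L : ℝ), (∀ z w, |h z - h w| ≤ L * ‖z - w‖) ∧ ∀ z ∈ S, |h z - g z| ≤ ε := by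
  obtain ⟨δ, hδ, hd⟩ := Metric.uniformContinuousOn_iff.1 (hS.uniformContinuousOn_of_continuous hg) ε hε
  obtain ⟨M, hM⟩ := hS.exists_bound_of_continuousOn hg
  have hM0 : 0 ≤ M := by
    obtain ⟨z, hz⟩ := hne
    exact (norm_nonneg _).trans (hM z hz)
  haveI : Nonempty S := hne.to_subtype
  set L : ℝ := 2 * M / δ with hL
  have hL0 : 0 ≤ L := by positivity
  have hbdd : ∀ z : ℂ, BddBelow (range fun w : S => g w + L * ‖z - w‖) := fun z => ⟨-M, by
    rintro _ ⟨w, rfl⟩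
    have := (abs_le.1 (hM w w.2)).1
    have h2 : 0 ≤ L * ‖z - w‖ := by positivity
    simp only; linarith⟩
  have key : ∀ z w : ℂ, (⨅ y : S, (g y + L * ‖z - y‖)) - (⨅ y : S, (g y + L * ‖w - y‖)) ≤ L * ‖z - w‖ := by
    intro z w
    rw [sub_le_iff_le_add, ← sub_le_iff_le_add']
    refine le_ciInf fun y => ?_
    have h1 := ciInf_le (hbdd z) y
    have h2 : ‖z - y‖ ≤ ‖z - w‖ + ‖w - y‖ := norm_sub_le_norm_sub_add_norm_sub z w y
    nlinarith
  refine ⟨fun z => ⨅ w : S, (g w + L * ‖z - w‖), L, fun z w => abs_le.2 ⟨?_, key z w⟩, fun z hz => abs_le.2 ⟨?_, ?_⟩⟩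
  · have := key w z
    rw [norm_sub_rev] at this
    linarith
  · have : g z - ε ≤ ⨅ w : S, (g w + L * ‖z - w‖) := by
      refine le_ciInf fun w => ?_
      by_cases hw : ‖z - w‖ < δ
      · have := hd z hz w w.2 (show dist z (w : ℂ) < δ by rwa [dist_eq_norm])
        rw [Real.dist_eq] at this
        have := (abs_lt.1 this).2
        have h2 : 0 ≤ L * ‖z - w‖ := by positivity
        linarith
      · have h2 : 2 * M ≤ L * ‖z - w‖ := by
          calc 2 * M = L * δ := by rw [hL]; field_simp
            _ ≤ _ := by gcongr; exact not_lt.1 hw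
        have h3 := (abs_le.1 (hM w w.2)).1
        have h4 := (abs_le.1 (hM z hz)).2
        linarith
    linarith
  · have h1 := ciInf_le (hbdd z) ⟨z, hz⟩
    simp only [sub_self, norm_zero, mul_zero, add_zero] at h1
    linarith

lemma IsMSE.add_const {u : ℝ × ℝ → ℝ} {Ω : Set (ℝ × ℝ)} (h : IsMSE u Ω) (c : ℝ) : IsMSE (fun z => u z + c) Ω := by
  have e1 : pd1 (fun z => u z + c) = pd1 u := by funext z; simp [pd1]
  have e2 : pd2 (fun z => u z + c) = pd2 u := by funext z; simp [pd2]
  refine ⟨h.1.add contDiffOn_const, ?_⟩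
  rw [e1, e2]
  exact h.2

lemma IsMSE.neg {u : ℝ × ℝ → ℝ} {Ω : Set (ℝ × ℝ)} (h : IsMSE u Ω) : IsMSE (fun z => - u z) Ω := by
  have e1 : ∀ u : ℝ × ℝ → ℝ, pd1 (fun z => - u z) = fun z => - pd1 u z := fun u => by funext z; simp [pd1, deriv.fun_neg]
  have e2 : ∀ u : ℝ × ℝ → ℝ, pd2 (fun z => - u z) = fun z => - pd2 u z := fun u => by funext z; simp [pd2, deriv.fun_neg]
  refine ⟨h.1.neg, fun z hz => ?_⟩
  have := h.2 z hz
  rw [e1, e2, e1, e2, e2]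
  linear_combination -this

lemma isMSE_const (c : ℝ) (Ω : Set (ℝ × ℝ)) : IsMSE (fun _ => c) Ω := by
  refine ⟨contDiffOn_const, fun z _ => ?_⟩
  have e1 : ∀ c : ℝ, pd1 (fun _ => c) = fun _ => 0 := fun c => by funext z; simp [pd1]
  have e2 : ∀ c : ℝ, pd2 (fun _ => c) = fun _ => 0 := fun c => by funext z; simp [pd2]
  rw [e1, e2, e1, e2]; simp

lemma frontier_eball {P b : ℝ × ℝ} {ρ : ℝ} (hb : b ∈ frontier (eball P ρ)) : ‖toC b - toC P‖ = ρ := by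
  rw [(isOpen_eball P ρ).frontier_eq] at hb
  refine le_antisymm ?_ (not_lt.1 fun h => hb.2 (mem_eball.2 h))
  have hc : IsClosed {z : ℝ × ℝ | ‖toC z - toC P‖ ≤ ρ} :=
    isClosed_le ((continuous_toC.sub continuous_const).norm) continuous_const
  exact closure_minimal (fun z hz => (mem_eball.1 hz).le) hc hb.1

lemma isBounded_eball (P : ℝ × ℝ) (ρ : ℝ) : Bornology.IsBounded (eball P ρ) := by
  have hc : IsCompact (toR '' Metric.closedBall (toC P) ρ) := (isCompact_closedBall _ _).image continuous_toR
  refine hc.isBounded.subset fun z hz => ⟨toC z, ?_, toR_toC z⟩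
  rw [Metric.mem_closedBall, dist_eq_norm]
  exact (mem_eball.1 hz).le

lemma disk_compare {P : ℝ × ℝ} {ρ : ℝ} {u v g h : ℝ × ℝ → ℝ} {c : ℝ} (hu : IsMSE u (eball P ρ)) (hv : IsMSE v (eball P ρ))
    (tu : ∀ b, ‖toC b - toC P‖ = ρ → Tendsto u (𝓝[eball P ρ] b) (𝓝 (g b)))
    (tv : ∀ b, ‖toC b - toC P‖ = ρ → Tendsto v (𝓝[eball P ρ] b) (𝓝 (h b)))
    (hgh : ∀ b, ‖toC b - toC P‖ = ρ → g b ≤ h b + c) : ∀ z ∈ eball P ρ, u z ≤ v z + c := by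
  refine comparison (isOpen_eball P ρ) (isBounded_eball P ρ) finite_empty (empty_disjoint _) hu (hv.add_const c) ?_
  intro b hb ε hε
  have hb1 := frontier_eball hb.1
  have h1 := (tu b hb1).eventually (eventually_lt_nhds (show g b < g b + ε / 2 by linarith))
  have h2 := (tv b hb1).eventually (eventually_gt_nhds (show h b - ε / 2 < h b by linarith))
  filter_upwards [h1, h2] with z h3 h4
  have := hgh b hb1
  linarith

theorem disk_cont {g : ℝ × ℝ → ℝ} (P : ℝ × ℝ) {ρ : ℝ} (hρ : 0 < ρ) (hg : ContinuousOn g {b | ‖toC b - toC P‖ = ρ}) :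
    ∃ U : ℝ × ℝ → ℝ, IsMSE U (eball P ρ) ∧
      ∀ b, ‖toC b - toC P‖ = ρ → Tendsto U (𝓝[eball P ρ] b) (𝓝 (g b)) := by
  have hSc : IsCompact (Metric.sphere (toC P) ρ) := isCompact_sphere _ _
  have hSne : (Metric.sphere (toC P) ρ).Nonempty := NormedSpace.sphere_nonempty.2 hρ.le
  have hgC : ContinuousOn (fun w => g (toR w)) (Metric.sphere (toC P) ρ) := by
    refine hg.comp continuous_toR.continuousOn fun w hw => ?_
    rw [mem_ofPred_eq, toC_toR]
    exact mem_sphere_iff_norm.1 hw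
  obtain ⟨M, hM⟩ := hSc.exists_bound_of_continuousOn hgC
  have hM' : ∀ b, ‖toC b - toC P‖ = ρ → |g b| ≤ M := fun b hb => by
    have := hM (toC b) (mem_sphere_iff_norm.2 hb)
    rwa [toR_toC] at this
  have hex : ∀ n : ℕ, ∃ U : ℝ × ℝ → ℝ, ∃ h : ℝ × ℝ → ℝ, IsMSE U (eball P ρ) ∧
      (∀ b, ‖toC b - toC P‖ = ρ → Tendsto U (𝓝[eball P ρ] b) (𝓝 (h b))) ∧ ∀ b, ‖toC b - toC P‖ = ρ → |h b - g b| ≤ 1 / ((n : ℝ) + 1) := by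
    intro n
    obtain ⟨h, L, hL, hh⟩ := lip_approx hSc hSne hgC (ε := 1 / ((n : ℝ) + 1)) (by positivity)
    obtain ⟨U, hU, tU⟩ := disk_lip hL P hρ
    refine ⟨U, fun b => h (toC b), hU, tU, fun b hb => ?_⟩
    have := hh (toC b) (mem_sphere_iff_norm.2 hb)
    rwa [toR_toC] at this
  choose U h hU tU hh using hex
  have hone : ∀ n : ℕ, 1 / ((n : ℝ) + 1) ≤ 1 := fun n => by
    rw [div_le_one (by positivity)]; have : (0 : ℝ) ≤ n := Nat.cast_nonneg n; linarith
  have hcmp : ∀ m n, ∀ z ∈ eball P ρ, U m z ≤ U n z + (1 / ((m : ℝ) + 1) + 1 / ((n : ℝ) + 1)) := fun m n =>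
    disk_compare (hU m) (hU n) (tU m) (tU n) fun b hb => by
      have h1 := abs_le.1 (hh m b hb)
      have h2 := abs_le.1 (hh n b hb)
      linarith [h1.2, h2.1]
  have hup : ∀ n, ∀ z ∈ eball P ρ, |U n z| ≤ M + 1 := by
    intro n z hz
    have h1 := disk_compare (c := 0) (hU n) (isMSE_const (M + 1) _) (tU n) (h := fun _ => M + 1) (fun b _ => tendsto_const_nhds)
      (fun b hb => by
        have h1 := abs_le.1 (hh n b hb); have h2 := abs_le.1 (hM' b hb); have := hone n; linarith [h1.2, h2.2]) z hz
    have h2 := disk_compare (c := 0) (isMSE_const (-(M + 1)) _) (hU n) (g := fun _ => -(M + 1)) (fun b _ => tendsto_const_nhds) (tU n)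
      (fun b hb => by
        have h1 := abs_le.1 (hh n b hb); have h2 := abs_le.1 (hM' b hb); have := hone n; linarith [h1.1, h2.1]) z hz
    exact abs_le.2 ⟨by linarith, by linarith⟩
  have hlim0 : Tendsto (fun n : ℕ => 1 / ((n : ℝ) + 1)) atTop (𝓝 0) := tendsto_one_div_add_atTop_nhds_zero_nat
  have hcau : ∀ z ∈ eball P ρ, ∃ y, Tendsto (fun n => U n z) atTop (𝓝 y) := by
    intro z hz
    refine cauchySeq_tendsto_of_complete (cauchySeq_of_le_tendsto_0' (fun n : ℕ => 2 * (1 / ((n : ℝ) + 1))) ?_ ?_)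
    · intro m n hmn
      rw [Real.dist_eq]
      have h1 := hcmp m n z hz
      have h2 := hcmp n m z hz
      have h3 : 1 / ((n : ℝ) + 1) ≤ 1 / ((m : ℝ) + 1) := by gcongr
      exact abs_le.2 ⟨by linarith, by linarith⟩
    · simpa using hlim0.const_mul 2
  choose! W hW using hcau
  have hWU : ∀ n, ∀ z ∈ eball P ρ, |W z - U n z| ≤ 1 / ((n : ℝ) + 1) := by
    intro n z hz
    have t1 : Tendsto (fun m => |U m z - U n z|) atTop (𝓝 |W z - U n z|) := ((hW z hz).sub_const _).abs
    have t2 : Tendsto (fun m : ℕ => 1 / ((m : ℝ) + 1) + 1 / ((n : ℝ) + 1)) atTop (𝓝 (0 + 1 / ((n : ℝ) + 1))) := hlim0.add_const _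
    rw [zero_add] at t2
    refine le_of_tendsto_of_tendsto' t1 t2 fun m => ?_
    have h1 := hcmp m n z hz
    have h2 := hcmp n m z hz
    exact abs_le.2 ⟨by linarith, by linarith⟩
  refine ⟨W, mse_limit (hyperfilter ℕ) (isOpen_eball P ρ) hU hup fun z hz => (hW z hz).mono_left Nat.hyperfilter_le_atTop, fun b hb => ?_⟩
  rw [Metric.tendsto_nhds]
  intro ε hε
  obtain ⟨n, hn⟩ := (hlim0.eventually (eventually_lt_nhds (show (0 : ℝ) < ε / 3 by positivity))).exists
  have h1 := Metric.tendsto_nhds.1 (tU n b hb) (ε / 3) (by positivity)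
  filter_upwards [h1, self_mem_nhdsWithin] with z hz1 hz2
  have h2 := abs_le.1 (hWU n z hz2)
  have h3 := abs_le.1 (hh n b hb)
  rw [Real.dist_eq] at hz1 ⊢
  have h4 := abs_lt.1 hz1
  exact abs_lt.2 ⟨by linarith [h2.1, h3.1, h4.1], by linarith [h2.2, h3.2, h4.2]⟩

/-! ### Perron's method -/

/-- The comparison property: `v` lies below every solution that dominates it on the boundary. -/
def CompProp (Ω V : Set (ℝ × ℝ)) (v : ℝ × ℝ → ℝ) : Prop :=
  ∀ O : Set (ℝ × ℝ), IsOpen O → O ⊆ Ω → ∀ w : ℝ × ℝ → ℝ, IsMSE w O →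
    (∀ b ∈ frontier O \ V, ∀ ε > 0, ∀ᶠ z in 𝓝[O] b, v z ≤ w z + ε) → ∀ z ∈ O, v z ≤ w z

/-- Perron subsolutions. -/
structure SubSol (Ω V : Set (ℝ × ℝ)) (f : ℝ × ℝ → ℝ) (M : ℝ) (v : ℝ × ℝ → ℝ) : Prop where
  cont : ContinuousOn v Ω
  bdd : ∀ z ∈ Ω, |v z| ≤ M
  bdry : ∀ b ∈ frontier Ω \ V, ∀ ε > 0, ∀ᶠ z in 𝓝[Ω] b, v z ≤ f b + ε
  comp : CompProp Ω V v

lemma compProp_const {Ω V : Set (ℝ × ℝ)} (hbd : Bornology.IsBounded Ω) (hV : V.Finite) (hVd : Disjoint V Ω) (c : ℝ) :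
    CompProp Ω V (fun _ => c) := fun _ ho hO _ hw hb =>
  comparison ho (hbd.subset hO) hV (hVd.mono_right hO) (isMSE_const c _) hw hb

lemma SubSol.max {Ω V : Set (ℝ × ℝ)} {f : ℝ × ℝ → ℝ} {M : ℝ} {v w : ℝ × ℝ → ℝ} (hv : SubSol Ω V f M v)
    (hw : SubSol Ω V f M w) : SubSol Ω V f M (fun z => Max.max (v z) (w z)) where
  cont := fun z hz => ContinuousWithinAt.sup (hv.cont z hz) (hw.cont z hz)
  bdd := fun z hz => abs_le.2 ⟨(abs_le.1 (hv.bdd z hz)).1.trans (le_max_left _ _),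
    max_le (abs_le.1 (hv.bdd z hz)).2 (abs_le.1 (hw.bdd z hz)).2⟩
  bdry := fun b hb ε hε => by
    filter_upwards [hv.bdry b hb ε hε, hw.bdry b hb ε hε] with z h1 h2 using max_le h1 h2
  comp := fun O ho hO u hu hb z hz => by
    refine max_le (hv.comp O ho hO u hu (fun b hb1 ε hε => ?_) z hz) (hw.comp O ho hO u hu (fun b hb1 ε hε => ?_) z hz)
    · filter_upwards [hb b hb1 ε hε] with z h1 using (le_max_left _ _).trans h1
    · filter_upwards [hb b hb1 ε hε] with z h1 using (le_max_right _ _).trans h1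

lemma SubSol.lift {Ω V : Set (ℝ × ℝ)} (ho : IsOpen Ω) (hbd : Bornology.IsBounded Ω) (hV : V.Finite) (hVd : Disjoint V Ω)
    {f : ℝ × ℝ → ℝ} {M : ℝ} {v : ℝ × ℝ → ℝ} (hv : SubSol Ω V f M v)
    {P : ℝ × ℝ} {ρ : ℝ} (hρ : 0 < ρ) (hP : {z | ‖toC z - toC P‖ ≤ ρ} ⊆ Ω) :
    ∃ v', SubSol Ω V f M v' ∧ (∀ z ∈ Ω, v z ≤ v' z) ∧ IsMSE v' (eball P ρ) := by
  classical
  have hcl : IsClosed {z : ℝ × ℝ | ‖toC z - toC P‖ ≤ ρ} :=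
    isClosed_le ((continuous_toC.sub continuous_const).norm) continuous_const
  have hBo := isOpen_eball P ρ
  have hBΩ : eball P ρ ⊆ Ω := fun z hz => hP (mem_eball.1 hz).le
  have hsΩ : ∀ b, ‖toC b - toC P‖ = ρ → b ∈ Ω := fun b hb => hP hb.le
  have hvat : ∀ z ∈ Ω, ContinuousAt v z := fun z hz => hv.cont.continuousAt (ho.mem_nhds hz)
  obtain ⟨U, hU, tU⟩ := disk_cont (g := v) P hρ (hv.cont.mono fun b hb => hsΩ b hb)
  have hvU : ∀ z ∈ eball P ρ, v z ≤ U z := by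
    refine hv.comp _ hBo hBΩ U hU fun b hb ε hε => ?_
    have hb1 := frontier_eball hb.1
    have h1 := ((hvat b (hsΩ b hb1)).tendsto.mono_left (nhdsWithin_le_nhds (s := eball P ρ))).eventually
      (eventually_lt_nhds (show v b < v b + ε / 2 by linarith))
    have h2 := (tU b hb1).eventually (eventually_gt_nhds (show v b - ε / 2 < v b by linarith))
    filter_upwards [h1, h2] with z h3 h4
    linarith
  have hUM : ∀ z ∈ eball P ρ, U z ≤ M := by
    intro z hz
    have := disk_compare (c := 0) hU (isMSE_const M _) tU (h := fun _ => M) (fun _ _ => tendsto_const_nhds)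
      (fun b hb => by have := (abs_le.1 (hv.bdd b (hsΩ b hb))).2; linarith) z hz
    linarith
  set v' : ℝ × ℝ → ℝ := fun z => if z ∈ eball P ρ then U z else v z with hv'
  have e1 : ∀ z ∈ eball P ρ, v' z = U z := fun z hz => if_pos hz
  have e2 : ∀ z, z ∉ eball P ρ → v' z = v z := fun z hz => if_neg hz
  have hle : ∀ z, v z ≤ v' z := fun z => by
    by_cases hz : z ∈ eball P ρ
    · rw [e1 z hz]; exact hvU z hz
    · rw [e2 z hz]
  have hout : ∀ z, ¬ ‖toC z - toC P‖ ≤ ρ → v' =ᶠ[𝓝 z] v := fun z hz => by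
    filter_upwards [hcl.isOpen_compl.mem_nhds hz] with y hy
    exact e2 y fun h => hy (mem_eball.1 h).le
  refine ⟨v', ⟨?_, ?_, ?_, ?_⟩, fun z _ => hle z, hU.congr hBo fun z hz => e1 z hz⟩
  · intro z hz
    refine ContinuousAt.continuousWithinAt ?_
    rcases lt_trichotomy ‖toC z - toC P‖ ρ with h | h | h
    · have hzB : z ∈ eball P ρ := mem_eball.2 h
      refine ContinuousAt.congr ((hU.1.continuousOn).continuousAt (hBo.mem_nhds hzB)) ?_
      filter_upwards [hBo.mem_nhds hzB] with y hy using (e1 y hy).symm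
    · have hzB : z ∉ eball P ρ := fun hh => (mem_eball.1 hh).ne h
      rw [ContinuousAt, e2 z hzB, ← nhdsWithin_univ, ← union_compl_self (eball P ρ), nhdsWithin_union, tendsto_sup]
      constructor
      · refine (tU z h).congr' ?_
        filter_upwards [self_mem_nhdsWithin] with y hy using (e1 y hy).symm
      · refine Tendsto.congr' ?_ ((hvat z hz).tendsto.mono_left nhdsWithin_le_nhds)
        filter_upwards [self_mem_nhdsWithin] with y hy using (e2 y hy).symm
    · exact (hvat z hz).congr (hout z (not_le.2 h)).symm
  · intro z hz
    refine abs_le.2 ⟨(abs_le.1 (hv.bdd z hz)).1.trans (hle z), ?_⟩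
    by_cases h : z ∈ eball P ρ
    · rw [e1 z h]; exact hUM z h
    · rw [e2 z h]; exact (abs_le.1 (hv.bdd z hz)).2
  · intro b hb ε hε
    have hbΩ : b ∉ Ω := by have := hb.1; rw [ho.frontier_eq] at this; exact this.2
    filter_upwards [hv.bdry b hb ε hε, nhdsWithin_le_nhds (hout b fun h => hbΩ (hP h))] with z h1 h2
    rwa [h2]
  · intro O hOo hOΩ w hw hb
    have h1 : ∀ z ∈ O, v z ≤ w z := hv.comp O hOo hOΩ w hw fun b hb1 ε hε => by
      filter_upwards [hb b hb1 ε hε] with z hz using (hle z).trans hz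
    have h2 : ∀ z ∈ O ∩ eball P ρ, U z ≤ w z := by
      refine comparison (hOo.inter hBo) (hbd.subset (inter_subset_left.trans hOΩ)) hV
        (hVd.mono_right (inter_subset_left.trans hOΩ)) (hU.mono inter_subset_right) (hw.mono inter_subset_left) ?_
      intro b hb1 ε hε
      have hfr := hb1.1
      rw [(hOo.inter hBo).frontier_eq] at hfr
      by_cases hbB : b ∈ eball P ρ
      · have hbO : b ∈ frontier O := by
          rw [hOo.frontier_eq]
          exact ⟨closure_mono inter_subset_left hfr.1, fun h => hfr.2 ⟨h, hbB⟩⟩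
        filter_upwards [nhdsWithin_mono b inter_subset_left (hb b ⟨hbO, hb1.2⟩ ε hε), self_mem_nhdsWithin] with z hz hz2
        rwa [e1 z hz2.2] at hz
      · have hbs : ‖toC b - toC P‖ = ρ := by
          apply frontier_eball
          rw [hBo.frontier_eq]
          exact ⟨closure_mono inter_subset_right hfr.1, hbB⟩
        have t1 := ((hvat b (hsΩ b hbs)).tendsto.mono_left (nhdsWithin_le_nhds (s := O ∩ eball P ρ))).eventually
          (eventually_gt_nhds (show v b - ε / 2 < v b by linarith))
        have t2 := ((tU b hbs).mono_left (nhdsWithin_mono b (inter_subset_right (s := O)))).eventually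
          (eventually_lt_nhds (show v b < v b + ε / 2 by linarith))
        filter_upwards [t1, t2, self_mem_nhdsWithin] with z h3 h4 h5
        have := h1 z h5.1
        linarith
    intro z hz
    by_cases h : z ∈ eball P ρ
    · rw [e1 z h]; exact h2 z ⟨hz, h⟩
    · rw [e2 z h]; exact h1 z hz

/-- The Perron function. -/
noncomputable def perron (Ω V : Set (ℝ × ℝ)) (f : ℝ × ℝ → ℝ) (M : ℝ) (z : ℝ × ℝ) : ℝ :=
  sSup {y | ∃ v, SubSol Ω V f M v ∧ y = v z}

lemma SubSol.le_perron {Ω V : Set (ℝ × ℝ)} {f : ℝ × ℝ → ℝ} {M : ℝ} {v : ℝ × ℝ → ℝ} (hv : SubSol Ω V f M v) {z : ℝ × ℝ} (hz : z ∈ Ω) :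
    v z ≤ perron Ω V f M z :=
  le_csSup ⟨M, by rintro _ ⟨w, hw, rfl⟩; exact (abs_le.1 (hw.bdd z hz)).2⟩ ⟨v, hv, rfl⟩

lemma perron_le {Ω V : Set (ℝ × ℝ)} {f : ℝ × ℝ → ℝ} {M : ℝ} {v : ℝ × ℝ → ℝ} (hv : SubSol Ω V f M v) {z : ℝ × ℝ} {c : ℝ}
    (h : ∀ v, SubSol Ω V f M v → v z ≤ c) : perron Ω V f M z ≤ c :=
  csSup_le ⟨_, v, hv, rfl⟩ (by rintro _ ⟨w, hw, rfl⟩; exact h w hw)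

theorem perron_mse {Ω V : Set (ℝ × ℝ)} (ho : IsOpen Ω) (hbd : Bornology.IsBounded Ω) (hV : V.Finite) (hVd : Disjoint V Ω)
    {f : ℝ × ℝ → ℝ} {M : ℝ} {v0 : ℝ × ℝ → ℝ} (hv0 : SubSol Ω V f M v0) : IsMSE (perron Ω V f M) Ω := by
  refine isMSE_of_pt ho fun z0 hz0 => ?_
  obtain ⟨r, hr, hrΩ⟩ := exists_eball_subset (ho.mem_nhds hz0)
  set ρ := r / 2 with hρdef
  have hρ : 0 < ρ := by positivity
  have hP : {z | ‖toC z - toC z0‖ ≤ ρ} ⊆ Ω := fun z hz => hrΩ (mem_eball.2 (lt_of_le_of_lt hz (by linarith)))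
  have hBΩ : eball z0 ρ ⊆ Ω := fun z hz => hP (mem_eball.1 hz).le
  suffices h : IsMSE (perron Ω V f M) (eball z0 ρ) from
    (isMSE_iff (isOpen_eball z0 ρ)).1 h z0 (mem_eball_self hρ)
  set q := TopologicalSpace.denseSeq (ℝ × ℝ) with hq
  have hex : ∀ k n : ℕ, ∃ v, SubSol Ω V f M v ∧ (q k ∈ Ω → perron Ω V f M (q k) - 1 / ((n : ℝ) + 1) ≤ v (q k)) := by
    intro k n
    by_cases hk : q k ∈ Ω
    · have hlt : perron Ω V f M (q k) - 1 / ((n : ℝ) + 1) < perron Ω V f M (q k) := by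
        have : 0 < 1 / ((n : ℝ) + 1) := by positivity
        linarith
      obtain ⟨_, ⟨v, hv, rfl⟩, hy⟩ := exists_lt_of_lt_csSup (s := {y | ∃ v, SubSol Ω V f M v ∧ y = v (q k)}) ⟨_, v0, hv0, rfl⟩ hlt
      exact ⟨v, hv, fun _ => hy.le⟩
    · exact ⟨v0, hv0, fun h => absurd h hk⟩
  choose a ha ha2 using hex
  have hlift : ∀ v : {v // SubSol Ω V f M v}, ∃ v' : {v // SubSol Ω V f M v}, (∀ z ∈ Ω, v.1 z ≤ v'.1 z) ∧ IsMSE v'.1 (eball z0 ρ) := by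
    intro v
    obtain ⟨v', h1, h2, h3⟩ := v.2.lift ho hbd hV hVd hρ hP
    exact ⟨⟨v', h1⟩, h2, h3⟩
  choose L hL1 hL2 using hlift
  set b : ℕ → {v // SubSol Ω V f M v} := fun m => ⟨a m.unpair.1 m.unpair.2, ha _ _⟩ with hb
  set W : ℕ → {v // SubSol Ω V f M v} := fun m => Nat.rec (L (b 0)) (fun m w => L ⟨_, w.2.max (b (m + 1)).2⟩) m with hW
  have hWs : ∀ m, W (m + 1) = L ⟨_, (W m).2.max (b (m + 1)).2⟩ := fun m => rfl
  have hWm : ∀ m, IsMSE (W m).1 (eball z0 ρ) := by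
    intro m
    cases m with
    | zero => exact hL2 _
    | succ m => rw [hWs]; exact hL2 _
  have hWb : ∀ m, ∀ z ∈ Ω, (b m).1 z ≤ (W m).1 z := by
    intro m z hz
    cases m with
    | zero => exact hL1 _ z hz
    | succ m => rw [hWs]; exact (le_max_right _ _).trans (hL1 ⟨_, (W m).2.max (b (m + 1)).2⟩ z hz)
  have hWmono : ∀ z ∈ Ω, Monotone fun m => (W m).1 z := fun z hz => monotone_nat_of_le_succ fun m => by
    rw [hWs]; exact (le_max_left _ _).trans (hL1 ⟨_, (W m).2.max (b (m + 1)).2⟩ z hz)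
  have hlim : ∀ z ∈ Ω, Tendsto (fun m => (W m).1 z) atTop (𝓝 (⨆ m, (W m).1 z)) := fun z hz =>
    tendsto_atTop_ciSup (hWmono z hz) ⟨M, by rintro _ ⟨m, rfl⟩; exact (abs_le.1 ((W m).2.bdd z hz)).2⟩
  have hWlim : IsMSE (fun z => ⨆ m, (W m).1 z) (eball z0 ρ) :=
    mse_limit (hyperfilter ℕ) (isOpen_eball z0 ρ) hWm (M := M) (fun m z hz => (W m).2.bdd z (hBΩ hz))
      fun z hz => (hlim z (hBΩ hz)).mono_left Nat.hyperfilter_le_atTop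
  have hle : ∀ z ∈ eball z0 ρ, (⨆ m, (W m).1 z) ≤ perron Ω V f M z := fun z hz =>
    ciSup_le fun m => (W m).2.le_perron (hBΩ hz)
  have hqk : ∀ k, q k ∈ eball z0 ρ → perron Ω V f M (q k) ≤ ⨆ m, (W m).1 (q k) := by
    intro k hk
    have hkΩ := hBΩ hk
    have hstep : ∀ n : ℕ, perron Ω V f M (q k) - 1 / ((n : ℝ) + 1) ≤ ⨆ m, (W m).1 (q k) := by
      intro n
      have h1 := ha2 k n hkΩ
      have h2 := hWb (Nat.pair k n) (q k) hkΩ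
      have h3 : (W (Nat.pair k n)).1 (q k) ≤ ⨆ m, (W m).1 (q k) :=
        le_ciSup (f := fun m => (W m).1 (q k)) ⟨M, by rintro _ ⟨m, rfl⟩; exact (abs_le.1 ((W m).2.bdd _ hkΩ)).2⟩ _
      simp only [hb, Nat.unpair_pair] at h2
      linarith
    have t : Tendsto (fun n : ℕ => perron Ω V f M (q k) - 1 / ((n : ℝ) + 1)) atTop (𝓝 (perron Ω V f M (q k) - 0)) :=
      tendsto_const_nhds.sub tendsto_one_div_add_atTop_nhds_zero_nat
    rw [sub_zero] at t
    exact le_of_tendsto' t hstep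
  have hge : ∀ z ∈ eball z0 ρ, perron Ω V f M z ≤ ⨆ m, (W m).1 z := by
    intro z hz
    refine perron_le hv0 fun v hv => ?_
    by_contra hcon
    rw [not_le] at hcon
    have c1 : ContinuousAt v z := hv.cont.continuousAt (ho.mem_nhds (hBΩ hz))
    have c2 : ContinuousAt (fun z => ⨆ m, (W m).1 z) z := hWlim.1.continuousOn.continuousAt ((isOpen_eball z0 ρ).mem_nhds hz)
    have hev := (c2.tendsto.eventually_lt c1.tendsto hcon).and ((isOpen_eball z0 ρ).mem_nhds hz)
    obtain ⟨O, hO, hOo, hzO⟩ := eventually_nhds_iff.1 hev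
    obtain ⟨_, hyO, ⟨k, rfl⟩⟩ := (TopologicalSpace.denseRange_denseSeq (ℝ × ℝ)).inter_open_nonempty O hOo ⟨z, hzO⟩
    obtain ⟨h1, h2⟩ := hO _ hyO
    have h3 := hqk k h2
    have h4 := hv.le_perron (hBΩ h2)
    linarith
  exact hWlim.congr (isOpen_eball z0 ρ) fun z hz => le_antisymm (hge z hz) (hle z hz)

/-! ### Boundary behaviour via barriers -/

/-- Barrier at a boundary point. -/
def HasBarrier (Ω : Set (ℝ × ℝ)) (b : ℝ × ℝ) : Prop :=
  ∀ N ∈ 𝓝 b, ∀ K : ℝ, ∃ (R O : Set (ℝ × ℝ)) (w : ℝ × ℝ → ℝ), IsOpen R ∧ b ∈ R ∧ R ⊆ N ∧ IsOpen O ∧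
    closure (Ω ∩ R) ⊆ O ∧ IsMSE w O ∧ w b = 0 ∧ (∀ z ∈ closure (Ω ∩ R), 0 ≤ w z) ∧
    ∀ c ∈ closure (Ω ∩ R), c ∉ R → K ≤ w c

lemma perron_boundary {Ω V : Set (ℝ × ℝ)} (ho : IsOpen Ω) (hbd : Bornology.IsBounded Ω) (hV : V.Finite)
    (hVd : Disjoint V Ω) {f : ℝ × ℝ → ℝ} {M : ℝ} (hfM : ∀ c ∈ frontier Ω \ V, |f c| ≤ M) (hM : 0 ≤ M)
    (hbase : SubSol Ω V f M fun _ => -M)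
    {b : ℝ × ℝ} (hb : b ∈ frontier Ω \ V) (hfc : ContinuousWithinAt f (frontier Ω \ V) b) (hbar : HasBarrier Ω b) :
    Tendsto (perron Ω V f M) (𝓝[Ω] b) (𝓝 (f b)) := by
  classical
  have key : ∀ ε > 0, ∀ᶠ z in 𝓝[Ω] b, |perron Ω V f M z - f b| ≤ 2 * ε := by
    intro ε hε
    have hN : {c | c ∈ frontier Ω \ V → |f c - f b| < ε} ∈ 𝓝 b := by
      have := Metric.tendsto_nhds.1 hfc.tendsto ε hε
      rw [eventually_nhdsWithin_iff] at this
      filter_upwards [this] with c hc h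
      exact hc h
    obtain ⟨R, O, w, hRo, hbR, hRN, hOo, hcO, hw, hwb, hw0, hwK⟩ := hbar _ hN (2 * M)
    have hwc : ∀ z ∈ O, ContinuousAt w z := fun z hz => hw.1.continuousOn.continuousAt (hOo.mem_nhds hz)
    have hRΩO : Ω ∩ R ⊆ O := subset_closure.trans hcO
    have hbcl : b ∈ closure (Ω ∩ R) := by
      have := hb.1
      have h1 : b ∈ closure Ω := frontier_subset_closure this
      rw [inter_comm]
      exact hRo.inter_closure ⟨hbR, h1⟩
    have hfb := abs_le.1 (hfM b hb)
    have hfR : ∀ c ∈ R, c ∈ frontier Ω \ V → |f c - f b| < ε := fun c hc => hRN hc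
    -- upper bound
    have hup : ∀ z ∈ Ω ∩ R, perron Ω V f M z ≤ w z + (f b + ε) := by
      intro z hz
      refine perron_le hbase fun v hv => ?_
      refine hv.comp (Ω ∩ R) (ho.inter hRo) inter_subset_left (fun z => w z + (f b + ε))
        ((hw.mono hRΩO).add_const _) ?_ z hz
      intro c hc ε' hε'
      have hfr := hc.1
      rw [(ho.inter hRo).frontier_eq] at hfr
      by_cases hcR : c ∈ R
      · have hcΩ : c ∈ frontier Ω \ V := by
          refine ⟨?_, hc.2⟩
          rw [ho.frontier_eq]
          exact ⟨closure_mono inter_subset_left hfr.1, fun h => hfr.2 ⟨h, hcR⟩⟩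
        have h1 := abs_lt.1 (hfR c hcR hcΩ)
        filter_upwards [nhdsWithin_mono c inter_subset_left (hv.bdry c hcΩ ε' hε'), self_mem_nhdsWithin] with y hy hy2
        have := hw0 y (subset_closure hy2)
        linarith
      · have h1 := hwK c hfr.1 hcR
        have h2 := (hwc c (hcO hfr.1)).tendsto.eventually (eventually_gt_nhds (show 2 * M - ε < w c by linarith))
        filter_upwards [nhdsWithin_le_nhds h2, self_mem_nhdsWithin] with y hy hy2
        have := (abs_le.1 (hv.bdd y hy2.1)).2
        linarith
    -- lower bound
    set v0 : ℝ × ℝ → ℝ := fun z => if z ∈ R then max (-M) (f b - ε - w z) else -M with hv0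
    have e1 : ∀ z ∈ R, v0 z = max (-M) (f b - ε - w z) := fun z hz => if_pos hz
    have e2 : ∀ z, z ∉ R → v0 z = -M := fun z hz => if_neg hz
    have hge : ∀ z, -M ≤ v0 z := fun z => by
      by_cases hz : z ∈ R
      · rw [e1 z hz]; exact le_max_left _ _
      · rw [e2 z hz]
    have hge2 : ∀ z ∈ R, f b - ε - w z ≤ v0 z := fun z hz => by
      rw [e1 z hz]; exact le_max_right _ _
    have hout : ∀ c, c ∉ R → ∀ᶠ z in 𝓝[Ω] c, v0 z = -M := by
      intro c hc
      by_cases hcl : c ∈ closure (Ω ∩ R)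
      · have h1 := hwK c hcl hc
        have h2 := (hwc c (hcO hcl)).tendsto.eventually (eventually_gt_nhds (show 2 * M - ε < w c by linarith))
        filter_upwards [nhdsWithin_le_nhds h2] with y hy
        by_cases hyR : y ∈ R
        · rw [e1 y hyR]
          exact max_eq_left (by linarith)
        · exact e2 y hyR
      · filter_upwards [nhdsWithin_le_nhds (isClosed_closure.isOpen_compl.mem_nhds hcl), self_mem_nhdsWithin] with y hy hy2
        exact e2 y fun h => hy (subset_closure ⟨hy2, h⟩)
    have hsub : SubSol Ω V f M v0 := by
      refine ⟨?_, ?_, ?_, ?_⟩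
      · intro z hz
        by_cases hzR : z ∈ R
        · have hcz := hwc z (hRΩO ⟨hz, hzR⟩)
          have : ContinuousAt (fun z => max (-M) (f b - ε - w z)) z :=
            ContinuousAt.sup continuousAt_const (continuousAt_const.sub hcz)
          refine (this.congr ?_).continuousWithinAt
          filter_upwards [hRo.mem_nhds hzR] with y hy using (e1 y hy).symm
        · refine ContinuousWithinAt.congr_of_eventuallyEq (f := fun _ => -M) continuousWithinAt_const (hout z hzR) (e2 z hzR)
      · intro z hz
        refine abs_le.2 ⟨hge z, ?_⟩
        by_cases hzR : z ∈ R
        · rw [e1 z hzR]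
          have := hw0 z (subset_closure ⟨hz, hzR⟩)
          exact max_le (by linarith) (by linarith)
        · rw [e2 z hzR]; linarith
      · intro c hc ε' hε'
        have hfcM := abs_le.1 (hfM c hc)
        by_cases hcR : c ∈ R
        · have h1 := abs_lt.1 (hfR c hcR hc)
          filter_upwards [nhdsWithin_le_nhds (hRo.mem_nhds hcR), self_mem_nhdsWithin] with y hy hy2
          rw [e1 y hy]
          have := hw0 y (subset_closure ⟨hy2, hy⟩)
          exact max_le (by linarith) (by linarith)
        · filter_upwards [hout c hcR] with y hy
          rw [hy]; linarith
      · intro O' hO' hOΩ w1 hw1 hb1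
        have h1 : ∀ z ∈ O', -M ≤ w1 z := by
          refine compProp_const hbd hV hVd (-M) O' hO' hOΩ w1 hw1 fun c hc ε' hε' => ?_
          filter_upwards [hb1 c hc ε' hε'] with y hy using (hge y).trans hy
        have hneg : IsMSE (fun z => f b - ε - w z) (O' ∩ R) := by
          have h3 : O' ∩ R ⊆ O := (inter_subset_inter_left R hOΩ).trans hRΩO
          have h2 := ((hw.mono h3).neg).add_const (f b - ε)
          exact h2.congr (hO'.inter hRo) fun z _ => by show f b - ε - w z = -w z + (f b - ε); ring
        have h2 : ∀ z ∈ O' ∩ R, f b - ε - w z ≤ w1 z := by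
          refine comparison (hO'.inter hRo) (hbd.subset (inter_subset_left.trans hOΩ)) hV
            (hVd.mono_right (inter_subset_left.trans hOΩ)) hneg (hw1.mono inter_subset_left) ?_
          intro c hc ε' hε'
          have hfr := hc.1
          rw [(hO'.inter hRo).frontier_eq] at hfr
          by_cases hcR : c ∈ R
          · have hcO' : c ∈ frontier O' := by
              rw [hO'.frontier_eq]
              exact ⟨closure_mono inter_subset_left hfr.1, fun h => hfr.2 ⟨h, hcR⟩⟩
            filter_upwards [nhdsWithin_mono c inter_subset_left (hb1 c ⟨hcO', hc.2⟩ ε' hε'), self_mem_nhdsWithin] with y hy hy2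
            exact (hge2 y hy2.2).trans hy
          · filter_upwards [nhdsWithin_mono c (inter_subset_left.trans hOΩ) (hout c hcR), self_mem_nhdsWithin] with y hy hy2
            have h3 := hge2 y hy2.2
            have h4 := h1 y hy2.1
            linarith
        intro z hz
        by_cases hzR : z ∈ R
        · rw [e1 z hzR]; exact max_le (h1 z hz) (h2 z ⟨hz, hzR⟩)
        · rw [e2 z hzR]; exact h1 z hz
    have hwε := (hwc b (hcO hbcl)).tendsto.eventually (eventually_lt_nhds (show w b < ε by rw [hwb]; exact hε))
    filter_upwards [nhdsWithin_le_nhds hwε, nhdsWithin_le_nhds (hRo.mem_nhds hbR), self_mem_nhdsWithin] with z h1 h2 h3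
    have h4 := hup z ⟨h3, h2⟩
    have h5 := (hge2 z h2).trans (hsub.le_perron h3)
    exact abs_le.2 ⟨by linarith, by linarith⟩
  rw [Metric.tendsto_nhds]
  intro ε hε
  filter_upwards [key (ε / 4) (by positivity)] with z hz
  rw [Real.dist_eq]
  linarith

/-! ### Scherk barriers -/

lemma isMSE_sep {O : Set (ℝ × ℝ)} (ho : IsOpen O) {c s x0 y0 : ℝ} (hcs : c ^ 2 + s ^ 2 = 1)
    {F F1 F2 G G1 G2 : ℝ → ℝ} {X Y : ℝ × ℝ → ℝ}
    (hX : X = fun z => -s * z.1 + c * z.2 + x0) (hY : Y = fun z => c * z.1 + s * z.2 + y0)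
    (hF : ∀ z ∈ O, HasDerivAt F (F1 (X z)) (X z)) (hF1 : ∀ z ∈ O, HasDerivAt F1 (F2 (X z)) (X z))
    (hG : ∀ z ∈ O, HasDerivAt G (G1 (Y z)) (Y z)) (hG1 : ∀ z ∈ O, HasDerivAt G1 (G2 (Y z)) (Y z))
    (hsm : ContDiffOn ℝ 2 (fun z => F (X z) + G (Y z)) O)
    (hode : ∀ z ∈ O, F2 (X z) * (1 + G1 (Y z) ^ 2) + G2 (Y z) * (1 + F1 (X z) ^ 2) = 0) :
    IsMSE (fun z => F (X z) + G (Y z)) O := by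
  have hX1 : ∀ z : ℝ × ℝ, HasDerivAt (fun t => X (t, z.2)) (-s) z.1 := fun z => by
    rw [hX]; simpa using (((hasDerivAt_id z.1).const_mul (-s)).add_const (c * z.2)).add_const x0
  have hX2 : ∀ z : ℝ × ℝ, HasDerivAt (fun t => X (z.1, t)) c z.2 := fun z => by
    rw [hX]; simpa using (((hasDerivAt_id z.2).const_mul c).const_add (-s * z.1)).add_const x0
  have hY1 : ∀ z : ℝ × ℝ, HasDerivAt (fun t => Y (t, z.2)) c z.1 := fun z => by
    rw [hY]; simpa using (((hasDerivAt_id z.1).const_mul c).add_const (s * z.2)).add_const y0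
  have hY2 : ∀ z : ℝ × ℝ, HasDerivAt (fun t => Y (z.1, t)) s z.2 := fun z => by
    rw [hY]; simpa using (((hasDerivAt_id z.2).const_mul s).const_add (c * z.1)).add_const y0
  set u : ℝ × ℝ → ℝ := fun z => F (X z) + G (Y z) with hu
  have gen1 : ∀ (A A1 B B1 : ℝ → ℝ) (α β : ℝ), ∀ z : ℝ × ℝ, HasDerivAt A (A1 (X z)) (X z) → HasDerivAt B (B1 (Y z)) (Y z) →
      HasDerivAt (fun t => α * A (X (t, z.2)) + β * B (Y (t, z.2))) (α * (A1 (X z) * -s) + β * (B1 (Y z) * c)) z.1 := by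
    intro A A1 B B1 α β z hA hB
    have h1 : HasDerivAt (fun t => A (X (t, z.2))) (A1 (X z) * -s) z.1 :=
      HasDerivAt.comp z.1 (h₂ := A) (h := fun t => X (t, z.2)) hA (hX1 z)
    have h2 : HasDerivAt (fun t => B (Y (t, z.2))) (B1 (Y z) * c) z.1 :=
      HasDerivAt.comp z.1 (h₂ := B) (h := fun t => Y (t, z.2)) hB (hY1 z)
    exact (h1.const_mul α).add (h2.const_mul β)
  have gen2 : ∀ (A A1 B B1 : ℝ → ℝ) (α β : ℝ), ∀ z : ℝ × ℝ, HasDerivAt A (A1 (X z)) (X z) → HasDerivAt B (B1 (Y z)) (Y z) →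
      HasDerivAt (fun t => α * A (X (z.1, t)) + β * B (Y (z.1, t))) (α * (A1 (X z) * c) + β * (B1 (Y z) * s)) z.2 := by
    intro A A1 B B1 α β z hA hB
    have h1 : HasDerivAt (fun t => A (X (z.1, t))) (A1 (X z) * c) z.2 :=
      HasDerivAt.comp z.2 (h₂ := A) (h := fun t => X (z.1, t)) hA (hX2 z)
    have h2 : HasDerivAt (fun t => B (Y (z.1, t))) (B1 (Y z) * s) z.2 :=
      HasDerivAt.comp z.2 (h₂ := B) (h := fun t => Y (z.1, t)) hB (hY2 z)
    exact (h1.const_mul α).add (h2.const_mul β)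
  have p1 : ∀ z ∈ O, pd1 u z = -s * F1 (X z) + c * G1 (Y z) := by
    intro z hz
    have := (gen1 F F1 G G1 1 1 z (hF z hz) (hG z hz)).deriv
    simp only [one_mul] at this
    rw [pd1, hu, this]; ring
  have p2 : ∀ z ∈ O, pd2 u z = c * F1 (X z) + s * G1 (Y z) := by
    intro z hz
    have := (gen2 F F1 G G1 1 1 z (hF z hz) (hG z hz)).deriv
    simp only [one_mul] at this
    rw [pd2, hu, this]; ring
  have n1 : ∀ z ∈ O, ∀ᶠ t in 𝓝 z.1, (t, z.2) ∈ O := fun z hz =>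
    (Continuous.prodMk_left z.2).continuousAt.eventually (ho.mem_nhds (x := (z.1, z.2)) hz)
  have n2 : ∀ z ∈ O, ∀ᶠ t in 𝓝 z.2, (z.1, t) ∈ O := fun z hz =>
    (Continuous.prodMk_right z.1).continuousAt.eventually (ho.mem_nhds (x := (z.1, z.2)) hz)
  refine ⟨hsm, fun z hz => ?_⟩
  have q11 : pd1 (pd1 u) z = -s * (F2 (X z) * -s) + c * (G2 (Y z) * c) := by
    rw [pd1, Filter.EventuallyEq.deriv_eq (f := fun t => -s * F1 (X (t, z.2)) + c * G1 (Y (t, z.2)))]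
    · exact (gen1 F1 F2 G1 G2 (-s) c z (hF1 z hz) (hG1 z hz)).deriv
    · filter_upwards [n1 z hz] with t ht using p1 _ ht
  have q12 : pd2 (pd1 u) z = -s * (F2 (X z) * c) + c * (G2 (Y z) * s) := by
    rw [pd2, Filter.EventuallyEq.deriv_eq (f := fun t => -s * F1 (X (z.1, t)) + c * G1 (Y (z.1, t)))]
    · exact (gen2 F1 F2 G1 G2 (-s) c z (hF1 z hz) (hG1 z hz)).deriv
    · filter_upwards [n2 z hz] with t ht using p1 _ ht
  have q22 : pd2 (pd2 u) z = c * (F2 (X z) * c) + s * (G2 (Y z) * s) := by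
    rw [pd2, Filter.EventuallyEq.deriv_eq (f := fun t => c * F1 (X (z.1, t)) + s * G1 (Y (z.1, t)))]
    · exact (gen2 F1 F2 G1 G2 c s z (hF1 z hz) (hG1 z hz)).deriv
    · filter_upwards [n2 z hz] with t ht using p2 _ ht
  rw [q11, q12, q22, p1 z hz, p2 z hz]
  have h := hode z hz
  generalize F1 (X z) = f1 at *
  generalize F2 (X z) = f2 at *
  generalize G1 (Y z) = g1 at *
  generalize G2 (Y z) = g2 at *
  clear * - h hcs
  have hc : c ^ 2 = 1 - s ^ 2 := by linarith
  grind

lemma hasDerivAt_logcos {l x : ℝ} (hl : 0 < l) (hx : 0 < cos (x / l)) :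
    HasDerivAt (fun x => -l * log (cos (x / l))) (tan (x / l)) x := by
  have h1 : HasDerivAt (fun x : ℝ => x / l) (1 / l) x := (hasDerivAt_id x).div_const l
  have h2 := ((h1.cos).log hx.ne').const_mul (-l)
  refine h2.congr_deriv ?_
  rw [tan_eq_sin_div_cos]
  field_simp

lemma hasDerivAt_tandiv {l x : ℝ} (hx : 0 < cos (x / l)) :
    HasDerivAt (fun x => tan (x / l)) ((1 + tan (x / l) ^ 2) * (1 / l)) x := by
  have h1 : HasDerivAt (fun x : ℝ => x / l) (1 / l) x := (hasDerivAt_id x).div_const l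
  have h2 := HasDerivAt.comp x (h₂ := tan) (h := fun x : ℝ => x / l) (Real.hasDerivAt_tan hx.ne') h1
  refine h2.congr_deriv ?_
  rw [tan_eq_sin_div_cos]
  have := sin_sq_add_cos_sq (x / l)
  congr 1
  field_simp
  linarith

lemma scherk_mse {O : Set (ℝ × ℝ)} (ho : IsOpen O) {c s x0 y0 l A : ℝ} (hcs : c ^ 2 + s ^ 2 = 1) (hl : 0 < l)
    {X Y : ℝ × ℝ → ℝ}
    (hX : X = fun z => -s * z.1 + c * z.2 + x0) (hY : Y = fun z => c * z.1 + s * z.2 + y0)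
    (hXO : ∀ z ∈ O, 0 < cos (X z / l)) (hYO : ∀ z ∈ O, 0 < cos (Y z / l)) :
    IsMSE (fun z => -l * log (cos (X z / l)) + (l * log (cos (Y z / l)) + A)) O := by
  refine isMSE_sep ho hcs (F := fun x => -l * log (cos (x / l))) (F1 := fun x => tan (x / l))
    (F2 := fun x => (1 + tan (x / l) ^ 2) * (1 / l)) (G := fun x => l * log (cos (x / l)) + A)
    (G1 := fun x => -tan (x / l)) (G2 := fun x => -((1 + tan (x / l) ^ 2) * (1 / l))) hX hY
    (fun z hz => hasDerivAt_logcos hl (hXO z hz)) (fun z hz => hasDerivAt_tandiv (hXO z hz))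
    (fun z hz => ?_) (fun z hz => (hasDerivAt_tandiv (hYO z hz)).neg) ?_ ?_
  · have := ((hasDerivAt_logcos hl (hYO z hz)).neg).add_const A
    refine this.congr_of_eventuallyEq (Eventually.of_forall fun x => ?_)
    simp
  · have cX : ContDiff ℝ 2 X := by rw [hX]; fun_prop
    have cY : ContDiff ℝ 2 Y := by rw [hY]; fun_prop
    intro z hz
    refine ContDiffAt.contDiffWithinAt ?_
    have h1 : ContDiffAt ℝ 2 (fun z => log (cos (X z / l))) z :=
      ((cX.div_const l).cos.contDiffAt).log (hXO z hz).ne'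
    have h2 : ContDiffAt ℝ 2 (fun z => log (cos (Y z / l))) z :=
      ((cY.div_const l).cos.contDiffAt).log (hYO z hz).ne'
    exact (contDiffAt_const.mul h1).add ((contDiffAt_const.mul h2).add contDiffAt_const)
  · intro z hz
    ring

lemma logcos_facts {l a x : ℝ} (ha0 : 0 < a) (ha : a < π / 2) (hl : 0 < l) (hx : |x| ≤ l * a) :
    0 < cos (x / l) ∧ cos a ≤ cos (x / l) := by
  have h1 : |x / l| ≤ a := by
    rw [abs_div, abs_of_pos hl, div_le_iff₀ hl]; linarith
  have h2 := abs_le.1 h1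
  refine ⟨cos_pos_of_mem_Ioo ⟨by linarith, by linarith⟩, ?_⟩
  rw [← cos_abs (x / l)]
  exact cos_le_cos_of_nonneg_of_le_pi (abs_nonneg _) (by linarith [pi_pos]) h1

lemma hasBarrier_of_halfplane {Ω : Set (ℝ × ℝ)} {b : ℝ × ℝ} {ε c s : ℝ} (hε : 0 < ε) (hcs : c ^ 2 + s ^ 2 = 1)
    (h : ∀ z ∈ Ω ∩ eball b ε, 0 ≤ c * (z.1 - b.1) + s * (z.2 - b.2)) : HasBarrier Ω b := by
  intro N hN K
  obtain ⟨ρ, hρ, hρN⟩ := exists_eball_subset (Filter.inter_mem hN ((isOpen_eball b ε).mem_nhds (mem_eball_self hε)))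
  obtain ⟨l, hl, hlρ⟩ : ∃ l > 0, 4 * l = ρ := ⟨ρ / 4, by positivity, by ring⟩
  obtain ⟨a, ha0, ha, hcos⟩ : ∃ a, 0 < a ∧ a < π / 2 ∧ cos a = rexp (-(|K| + 1) / l) := by
    have hneg : -(|K| + 1) / l < 0 := div_neg_of_neg_of_pos (by linarith [abs_nonneg K]) hl
    have he := Real.exp_lt_one_iff.2 hneg
    have hp := exp_pos (-(|K| + 1) / l)
    exact ⟨arccos (rexp (-(|K| + 1) / l)), arccos_pos.2 he, arccos_lt_pi_div_two.2 hp,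
      cos_arccos (by linarith) he.le⟩
  have hcosp : 0 < cos a := by rw [hcos]; exact exp_pos _
  have hA : K ≤ -(l * log (cos a)) := by
    rw [hcos, log_exp]
    field_simp
    linarith [le_abs_self K]
  have hlog0 : log (cos a) ≤ 0 := log_nonpos hcosp.le (cos_le_one a)
  obtain ⟨X, hX⟩ : ∃ X : ℝ × ℝ → ℝ, X = fun z => -s * z.1 + c * z.2 + (s * b.1 - c * b.2) := ⟨_, rfl⟩
  obtain ⟨Y, hY⟩ : ∃ Y : ℝ × ℝ → ℝ, Y = fun z => c * z.1 + s * z.2 + (-c * b.1 - s * b.2 - a * l) := ⟨_, rfl⟩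
  have cX : Continuous X := by rw [hX]; fun_prop
  have cY : Continuous Y := by rw [hY]; fun_prop
  have hXb : X b = 0 := by rw [hX]; ring
  have hYb : Y b = -(a * l) := by rw [hY]; ring
  have hpi : π < 4 := pi_lt_four
  set R : Set (ℝ × ℝ) := {z | |X z| < l * a ∧ -(l * (π / 2)) < Y z ∧ Y z < 0} with hR
  set O : Set (ℝ × ℝ) := {z | |X z| < l * (π / 2) ∧ |Y z| < l * (π / 2)} with hO
  have hla : l * a < l * (π / 2) := by gcongr
  have hla0 : 0 < l * a := by positivity
  have hRo : IsOpen R := (isOpen_lt cX.abs continuous_const).inter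
    ((isOpen_lt continuous_const cY).inter (isOpen_lt cY continuous_const))
  have hOo : IsOpen O := (isOpen_lt cX.abs continuous_const).inter (isOpen_lt cY.abs continuous_const)
  have hRball : R ⊆ eball b ρ := by
    rintro z ⟨h1, h2, h3⟩
    have h4 := abs_lt.1 h1
    have e : (z.1 - b.1) ^ 2 + (z.2 - b.2) ^ 2 = X z ^ 2 + (Y z + a * l) ^ 2 := by
      rw [hX, hY]; grind
    show Real.sqrt ((z.1 - b.1) ^ 2 + (z.2 - b.2) ^ 2) < ρ
    rw [e, Real.sqrt_lt' hρ, ← hlρ]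
    have hl2 : l * (π / 2) < l * 2 := by gcongr; linarith
    have b1 : X z ^ 2 < (2 * l) ^ 2 := sq_lt_sq' (by linarith) (by linarith)
    have b2 : (Y z + a * l) ^ 2 < (2 * l) ^ 2 := sq_lt_sq' (by nlinarith) (by nlinarith)
    nlinarith
  have hsub : closure (Ω ∩ R) ⊆ {z | |X z| ≤ l * a ∧ -(l * a) ≤ Y z ∧ Y z ≤ 0} := by
    refine closure_minimal ?_ ((isClosed_le cX.abs continuous_const).inter
      ((isClosed_le continuous_const cY).inter (isClosed_le cY continuous_const)))
    rintro z ⟨hz, hzR⟩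
    have h1 := h z ⟨hz, (hρN (hRball hzR)).2⟩
    refine ⟨hzR.1.le, ?_, hzR.2.2.le⟩
    have : Y z = c * (z.1 - b.1) + s * (z.2 - b.2) - l * a := by rw [hY]; ring
    linarith
  refine ⟨R, O, fun z => -l * log (cos (X z / l)) + (l * log (cos (Y z / l)) + -(l * log (cos a))), hRo,
    ?_, hRball.trans (hρN.trans inter_subset_left), hOo, ?_, ?_, ?_, ?_, ?_⟩
  · refine ⟨by rw [hXb]; simpa using hla0, by rw [hYb]; linarith, by rw [hYb]; linarith⟩
  · intro z hz
    obtain ⟨h1, h2, h3⟩ := hsub hz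
    exact ⟨h1.trans_lt hla, (abs_le.2 ⟨h2, by linarith⟩ : |Y z| ≤ l * a).trans_lt hla⟩
  · have hp : ∀ x : ℝ, |x| < l * (π / 2) → 0 < cos (x / l) := by
      intro x hx
      have h1 : |x / l| < π / 2 := by rw [abs_div, abs_of_pos hl, div_lt_iff₀ hl]; linarith
      have h2 := abs_lt.1 h1
      exact cos_pos_of_mem_Ioo ⟨by linarith, by linarith⟩
    exact scherk_mse hOo hcs hl hX hY (fun z hz => hp _ hz.1) (fun z hz => hp _ hz.2)
  · have : -(a * l) / l = -a := by field_simp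
    simp only [hXb, hYb, this, zero_div, cos_zero, log_one, cos_neg]
    ring
  · intro z hz
    obtain ⟨h1, h2, h3⟩ := hsub hz
    obtain ⟨x1, x2⟩ := logcos_facts ha0 ha hl h1
    obtain ⟨y1, y2⟩ := logcos_facts ha0 ha hl (abs_le.2 ⟨h2, by linarith⟩ : |Y z| ≤ l * a)
    have t1 : log (cos (X z / l)) ≤ 0 := log_nonpos x1.le (cos_le_one _)
    have t2 : log (cos a) ≤ log (cos (Y z / l)) := log_le_log hcosp y2
    simp only
    nlinarith
  · intro z hz hzR
    obtain ⟨h1, h2, h3⟩ := hsub hz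
    obtain ⟨x1, x2⟩ := logcos_facts ha0 ha hl h1
    obtain ⟨y1, y2⟩ := logcos_facts ha0 ha hl (abs_le.2 ⟨h2, by linarith⟩ : |Y z| ≤ l * a)
    have t1 : log (cos (X z / l)) ≤ 0 := log_nonpos x1.le (cos_le_one _)
    have t2 : log (cos a) ≤ log (cos (Y z / l)) := log_le_log hcosp y2
    simp only
    rcases h1.lt_or_eq with hx | hx
    · have hy : Y z = 0 := by
        by_contra hne
        exact hzR ⟨hx, by linarith, lt_of_le_of_ne h3 hne⟩
      rw [hy]
      simp only [zero_div, cos_zero, log_one]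
      nlinarith
    · have : cos (X z / l) = cos a := by
        rw [← cos_abs, abs_div, abs_of_pos hl, hx]; congr 1; field_simp
      rw [this]
      nlinarith

lemma hasBarrier_of_convex {Ω : Set (ℝ × ℝ)} (ho : IsOpen Ω) {b : ℝ × ℝ} {ε : ℝ} (hb : b ∈ frontier Ω) (hε : 0 < ε)
    (hc : Convex ℝ (Ω ∩ eball b ε)) : HasBarrier Ω b := by
  rw [ho.frontier_eq] at hb
  obtain ⟨φ, hφ⟩ := geometric_hahn_banach_open_point hc (ho.inter (isOpen_eball b ε)) (fun h => hb.2 h.1)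
  obtain ⟨o, ho1, ho2⟩ := mem_closure_iff.1 hb.1 _ (isOpen_eball b ε) (mem_eball_self hε)
  have hφe : ∀ z : ℝ × ℝ, φ z = z.1 * φ (1, 0) + z.2 * φ (0, 1) := fun z => by
    have : z = z.1 • ((1, 0) : ℝ × ℝ) + z.2 • ((0, 1) : ℝ × ℝ) := by ext <;> simp
    conv_lhs => rw [this]
    rw [map_add, map_smul, map_smul]; rfl
  obtain ⟨α, hα⟩ : ∃ α, α = φ (1, 0) := ⟨_, rfl⟩
  obtain ⟨β, hβ⟩ : ∃ β, β = φ (0, 1) := ⟨_, rfl⟩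
  rw [← hα, ← hβ] at hφe
  have hpos : 0 < α ^ 2 + β ^ 2 := by
    by_contra hcon
    have h1 : α = 0 := by nlinarith [sq_nonneg α, sq_nonneg β]
    have h2 : β = 0 := by nlinarith [sq_nonneg α, sq_nonneg β]
    have := hφ o ⟨ho2, ho1⟩
    rw [hφe, hφe b, h1, h2] at this
    simp at this
  set r := Real.sqrt (α ^ 2 + β ^ 2) with hr
  have hrp : 0 < r := Real.sqrt_pos.2 hpos
  have hr2 : r ^ 2 = α ^ 2 + β ^ 2 := Real.sq_sqrt hpos.le
  refine hasBarrier_of_halfplane (c := -α / r) (s := -β / r) hε (by field_simp; linarith) fun z hz => ?_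
  have := hφ z hz
  rw [hφe, hφe b] at this
  have e : -α / r * (z.1 - b.1) + -β / r * (z.2 - b.2) = (b.1 * α + b.2 * β - (z.1 * α + z.2 * β)) / r := by
    field_simp; ring
  rw [e]
  exact div_nonneg (by linarith) hrp.le

/-! ### Local structure of the boundary along an arc -/

lemma bdry_inj {Ω : Set (ℝ × ℝ)} (ho : IsOpen Ω) {b : ℝ × ℝ} {ε : ℝ} (hb : b ∈ frontier Ω) (hε : 0 < ε)
    (hc : Convex ℝ (Ω ∩ eball b ε)) : ∃ (d : ℝ × ℝ) (δ : ℝ), 0 < δ ∧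
      ∀ p ∈ frontier Ω ∩ Metric.ball b δ, ∀ q ∈ frontier Ω ∩ Metric.ball b δ,
        d.1 * p.2 - d.2 * p.1 = d.1 * q.2 - d.2 * q.1 → p = q := by
  have hbΩ : b ∉ Ω := by rw [ho.frontier_eq] at hb; exact hb.2
  have hKo := ho.inter (isOpen_eball b ε)
  set K := Ω ∩ eball b ε with hK
  obtain ⟨o, ho1, ho2⟩ := mem_closure_iff.1 (frontier_subset_closure hb) _ (isOpen_eball b ε) (mem_eball_self hε)
  have hoK : o ∈ K := ⟨ho2, ho1⟩
  obtain ⟨δ1, hδ1, hδK⟩ := Metric.isOpen_iff.1 hKo o hoK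
  obtain ⟨δ2, hδ2, hδb⟩ := Metric.isOpen_iff.1 (isOpen_eball b ε) b (mem_eball_self hε)
  set d := b - o with hd
  have hd0 : d ≠ 0 := fun h => hbΩ (by rw [sub_eq_zero.1 h]; exact ho2)
  have hdn : 0 < ‖d‖ := norm_pos_iff.2 hd0
  obtain ⟨δ, hδ, l1, l2, l3⟩ : ∃ δ > 0, δ ≤ δ1 ∧ δ ≤ δ2 ∧ 2 * δ ≤ ‖d‖ :=
    ⟨min (min δ1 δ2) (‖d‖ / 2), by positivity, (min_le_left _ _).trans (min_le_left _ _),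
      (min_le_left _ _).trans (min_le_right _ _), by linarith [min_le_right (min δ1 δ2) (‖d‖ / 2)]⟩
  refine ⟨d, δ, hδ, ?_⟩
  have key : ∀ p ∈ frontier Ω ∩ Metric.ball b δ, ∀ q ∈ frontier Ω ∩ Metric.ball b δ, ∀ τ : ℝ, 0 < τ → p - q = τ • d → False := by
    intro p hp q hq τ hτ hpq
    have hτ1 : τ < 1 := by
      have h1 : ‖p - q‖ < 2 * δ := by
        have := dist_triangle_right p q b
        rw [dist_eq_norm] at this
        have h2 := Metric.mem_ball.1 hp.2
        have h3 := Metric.mem_ball.1 hq.2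
        linarith
      rw [hpq, norm_smul, Real.norm_of_nonneg hτ.le] at h1
      by_contra hcon
      nlinarith
    have hqΩ : q ∉ Ω := by have := hq.1; rw [ho.frontier_eq] at this; exact this.2
    have hpcl : p ∈ closure K := by
      rw [hK, inter_comm]
      exact (isOpen_eball b ε).inter_closure ⟨hδb (Metric.ball_subset_ball l2 hp.2), frontier_subset_closure hp.1⟩
    have ho' : o + (p - b) ∈ interior K := by
      rw [hKo.interior_eq]
      apply hδK
      have := Metric.mem_ball.1 hp.2
      rw [dist_eq_norm] at this
      rw [Metric.mem_ball, dist_eq_norm, add_sub_cancel_left]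
      linarith
    have hqe : q = (1 - τ) • p + τ • (o + (p - b)) := by
      have : q = p - τ • d := by rw [← hpq]; abel
      rw [this, hd]
      module
    have := hc.combo_closure_interior_mem_interior hpcl ho' (show (0:ℝ) ≤ 1 - τ by linarith) hτ (by ring)
    rw [← hqe] at this
    exact hqΩ (interior_subset this).1
  intro p hp q hq h
  by_contra hne
  obtain ⟨τ, hτ⟩ : ∃ τ : ℝ, p - q = τ • d := by
    by_cases h1 : d.1 = 0
    · have h2 : d.2 ≠ 0 := fun h2 => hd0 (Prod.ext h1 h2)
      refine ⟨(p.2 - q.2) / d.2, Prod.ext ?_ ?_⟩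
      · simp only [Prod.fst_sub, Prod.smul_fst, smul_eq_mul, h1, mul_zero]
        rw [h1] at h
        have : d.2 * (p.1 - q.1) = 0 := by linarith
        exact (mul_eq_zero.1 this).resolve_left h2
      · simp only [Prod.snd_sub, Prod.smul_snd, smul_eq_mul]
        field_simp
    · refine ⟨(p.1 - q.1) / d.1, Prod.ext ?_ ?_⟩
      · simp only [Prod.fst_sub, Prod.smul_fst, smul_eq_mul]
        field_simp
      · simp only [Prod.snd_sub, Prod.smul_snd, smul_eq_mul]
        field_simp
        linarith
  rcases lt_trichotomy τ 0 with h0 | h0 | h0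
  · exact key q hq p hp (-τ) (by linarith) (by rw [neg_smul, ← hτ]; abel)
  · rw [h0, zero_smul, sub_eq_zero] at hτ
    exact hne hτ
  · exact key p hp q hq τ h0 hτ

lemma arc_nbhd {Ω C : Set (ℝ × ℝ)} (ho : IsOpen Ω) (hC : IsC1Arc C) (hCf : C ⊆ frontier Ω) {b : ℝ × ℝ} (hb : b ∈ C)
    {ε : ℝ} (hε : 0 < ε) (hc : Convex ℝ (Ω ∩ eball b ε)) : ∀ᶠ z in 𝓝 b, z ∈ frontier Ω → z ∈ C := by
  obtain ⟨γ, hγ, hinj, -, rfl⟩ := hC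
  obtain ⟨t0, ht0, rfl⟩ := hb
  obtain ⟨d, δ, hδ, hd⟩ := bdry_inj ho (hCf ⟨t0, ht0, rfl⟩) hε hc
  set pr : ℝ × ℝ → ℝ := fun p => d.1 * p.2 - d.2 * p.1 with hpr
  have cpr : Continuous pr := by fun_prop
  have cγ := hγ.continuous
  have hev : ∀ᶠ t in 𝓝 t0, γ t ∈ Metric.ball (γ t0) δ ∧ t ∈ Ioo (0:ℝ) 1 :=
    (cγ.continuousAt.eventually (Metric.ball_mem_nhds _ hδ)).and (isOpen_Ioo.mem_nhds ht0)
  obtain ⟨η, hη, hball⟩ := Metric.eventually_nhds_iff.1 hev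
  set t1 := t0 - η / 2
  set t2 := t0 + η / 2
  have h10 : t1 < t0 := by simp only [t1]; linarith
  have h02 : t0 < t2 := by simp only [t2]; linarith
  have hI : ∀ t ∈ Icc t1 t2, γ t ∈ Metric.ball (γ t0) δ ∧ t ∈ Ioo (0:ℝ) 1 := fun t ht => hball (by
    rw [Real.dist_eq, abs_lt]
    have := ht.1
    have := ht.2
    simp only [t1, t2] at *
    constructor <;> linarith)
  have hF : ∀ t ∈ Icc t1 t2, γ t ∈ frontier Ω ∩ Metric.ball (γ t0) δ := fun t ht =>
    ⟨hCf ⟨t, (hI t ht).2, rfl⟩, (hI t ht).1⟩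
  have hinj2 : InjOn (fun t => pr (γ t)) (Icc t1 t2) := fun s hs t ht hst =>
    hinj (Ioo_subset_Icc_self (hI s hs).2) (Ioo_subset_Icc_self (hI t ht).2) (hd _ (hF s hs) _ (hF t ht) hst)
  have ccomp : ContinuousOn (fun t => pr (γ t)) (Icc t1 t2) := (cpr.comp cγ).continuousOn
  have m1 : t1 ∈ Icc t1 t2 := ⟨le_rfl, by linarith⟩
  have m0 : t0 ∈ Icc t1 t2 := ⟨h10.le, h02.le⟩
  have m2 : t2 ∈ Icc t1 t2 := ⟨by linarith, le_rfl⟩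
  have himg : (fun t => pr (γ t)) '' Icc t1 t2 ∈ 𝓝 (pr (γ t0)) := by
    rcases ccomp.strictMonoOn_of_injOn_Icc' (h10.trans h02).le hinj2 with hm | hm
    · exact mem_of_superset (Icc_mem_nhds (hm m1 m0 h10) (hm m0 m2 h02))
        (intermediate_value_Icc (h10.trans h02).le ccomp)
    · exact mem_of_superset (Icc_mem_nhds (hm m0 m2 h02) (hm m1 m0 h10))
        (intermediate_value_Icc' (h10.trans h02).le ccomp)
  filter_upwards [Metric.ball_mem_nhds (γ t0) hδ, cpr.continuousAt.preimage_mem_nhds himg] with z hz1 hz2 hz3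
  obtain ⟨t, ht, hte⟩ := hz2
  rw [← hd _ (hF t ht) z ⟨hz3, hz1⟩ hte]
  exact ⟨t, (hI t ht).2, rfl⟩

/-- Dirichlet problem with bounded continuous data: if `Ω` is a bounded open set whose
boundary consists of finitely many disjoint open convex C¹ arcs `C₁,…,C_n` together with
a finite set of vertices, and `f₁,…,f_n` are bounded continuous functions on the arcs,
then there is a unique solution of the minimal surfaces equation on `Ω` which is
continuous up to the arcs and equals `fᵢ` on `Cᵢ`. -/
theorem dirichlet_bounded_data
    (Ω : Set (ℝ × ℝ)) (hΩo : IsOpen Ω) (hΩb : Bornology.IsBounded Ω) (hΩne : Ω.Nonempty)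
    (n : ℕ) (C : Fin n → Set (ℝ × ℝ))
    (hC1 : ∀ i, IsC1Arc (C i))
    (hconv : ∀ i, LocallyConvexAlong Ω (C i))
    (hdisj : ∀ i i', i ≠ i' → Disjoint (C i) (C i'))
    (V : Set (ℝ × ℝ)) (hVfin : V.Finite) (hVdisj : ∀ i, Disjoint (C i) V)
    (hbd : frontier Ω = (⋃ i, C i) ∪ V)
    (f : Fin n → ℝ × ℝ → ℝ)
    (hfc : ∀ i, ContinuousOn (f i) (C i))
    (hfb : ∀ i, ∃ M : ℝ, ∀ z ∈ C i, |f i z| ≤ M) :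
    ∃ u : ℝ × ℝ → ℝ,
      (IsMSE u Ω ∧ ContinuousOn u (Ω ∪ ⋃ i, C i) ∧ ∀ i, EqOn u (f i) (C i)) ∧
      ∀ v : ℝ × ℝ → ℝ,
        (IsMSE v Ω ∧ ContinuousOn v (Ω ∪ ⋃ i, C i) ∧ ∀ i, EqOn v (f i) (C i)) →
        EqOn v u Ω := by

  classical
  have hVΩ : Disjoint V Ω := by
    rw [Set.disjoint_left]
    intro z hz hzΩ
    have : z ∈ frontier Ω := by rw [hbd]; exact Or.inr hz
    rw [hΩo.frontier_eq] at this
    exact this.2 hzΩ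
  have hCf : ∀ i, C i ⊆ frontier Ω := fun i z hz => by
    rw [hbd]; exact Or.inl (mem_iUnion.2 ⟨i, hz⟩)
  have hCΩ : ∀ i, ∀ z ∈ C i, z ∉ Ω := fun i z hz => by
    have := hCf i hz
    rw [hΩo.frontier_eq] at this
    exact this.2
  have hfr : frontier Ω \ V = ⋃ i, C i := by
    rw [hbd]
    ext z
    constructor
    · rintro ⟨h1 | h1, h2⟩
      · exact h1
      · exact absurd h1 h2
    · intro h
      refine ⟨Or.inl h, fun h2 => ?_⟩
      obtain ⟨i, hi⟩ := mem_iUnion.1 h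
      exact Set.disjoint_left.1 (hVdisj i) hi h2
  set g : ℝ × ℝ → ℝ := fun z => if h : ∃ i, z ∈ C i then f h.choose z else 0 with hg
  have hgi : ∀ i, ∀ z ∈ C i, g z = f i z := by
    intro i z hz
    have h : ∃ i, z ∈ C i := ⟨i, hz⟩
    have h1 : g z = f h.choose z := dif_pos h
    have h2 : h.choose = i := by
      by_contra hne
      exact Set.disjoint_left.1 (hdisj _ _ hne) h.choose_spec hz
    rw [h1, h2]
  choose B hB using hfb
  set M : ℝ := ∑ i, |B i| with hM
  have hM0 : 0 ≤ M := Finset.sum_nonneg fun i _ => abs_nonneg _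
  have hgM : ∀ c ∈ frontier Ω \ V, |g c| ≤ M := by
    intro c hc
    rw [hfr] at hc
    obtain ⟨i, hi⟩ := mem_iUnion.1 hc
    rw [hgi i c hi]
    exact (hB i c hi).trans ((le_abs_self _).trans
      (Finset.single_le_sum (f := fun i => |B i|) (fun i _ => abs_nonneg _) (Finset.mem_univ i)))
  have hgc : ∀ i, ∀ b ∈ C i, ContinuousWithinAt g (⋃ i, C i) b := by
    intro i b hb
    obtain ⟨ε, hε, hc⟩ := hconv i b hb
    have hev := arc_nbhd hΩo (hC1 i) (hCf i) hb hε hc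
    have h1 : ContinuousWithinAt g (C i) b := (hfc i b hb).congr (hgi i) (hgi i b hb)
    refine h1.mono_of_mem_nhdsWithin ?_
    filter_upwards [nhdsWithin_le_nhds hev, self_mem_nhdsWithin] with z hz1 hz2
    obtain ⟨j, hj⟩ := mem_iUnion.1 hz2
    exact hz1 (hCf j hj)
  have hbase : SubSol Ω V g M fun _ => -M :=
    ⟨continuousOn_const, fun z _ => by rw [abs_neg, abs_of_nonneg hM0],
      fun b hb ε hε => Eventually.of_forall fun z => by linarith [(abs_le.1 (hgM b hb)).1],
      compProp_const hΩb hVfin hVΩ _⟩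
  have hperron := perron_mse hΩo hΩb hVfin hVΩ hbase
  have htend : ∀ i, ∀ b ∈ C i, Tendsto (perron Ω V g M) (𝓝[Ω] b) (𝓝 (g b)) := by
    intro i b hb
    obtain ⟨ε, hε, hc⟩ := hconv i b hb
    have hbf : b ∈ frontier Ω \ V := by rw [hfr]; exact mem_iUnion.2 ⟨i, hb⟩
    exact perron_boundary hΩo hΩb hVfin hVΩ hgM hM0 hbase hbf (by rw [hfr]; exact hgc i b hb)
      (hasBarrier_of_convex hΩo (hCf i hb) hε hc)
  set u : ℝ × ℝ → ℝ := fun z => if z ∈ Ω then perron Ω V g M z else g z with hu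
  have u1 : ∀ z ∈ Ω, u z = perron Ω V g M z := fun z hz => if_pos hz
  have u2 : ∀ z, z ∉ Ω → u z = g z := fun z hz => if_neg hz
  have huM : IsMSE u Ω := hperron.congr hΩo u1
  have huc : ContinuousOn u (Ω ∪ ⋃ i, C i) := by
    rintro z (hz | hz)
    · exact (huM.1.continuousOn.continuousAt (hΩo.mem_nhds hz)).continuousWithinAt
    · obtain ⟨i, hi⟩ := mem_iUnion.1 hz
      rw [continuousWithinAt_union]
      constructor
      · rw [ContinuousWithinAt, u2 z (hCΩ i z hi)]
        refine (htend i z hi).congr' ?_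
        filter_upwards [self_mem_nhdsWithin] with y hy using (u1 y hy).symm
      · refine (hgc i z hi).congr (fun y hy => ?_) (u2 z (hCΩ i z hi))
        obtain ⟨j, hj⟩ := mem_iUnion.1 hy
        exact u2 y (hCΩ j y hj)
  have hue : ∀ i, EqOn u (f i) (C i) := fun i z hz => by
    rw [u2 z (hCΩ i z hz), hgi i z hz]
  have huniq : ∀ v w : ℝ × ℝ → ℝ, (IsMSE v Ω ∧ ContinuousOn v (Ω ∪ ⋃ i, C i) ∧ ∀ i, EqOn v (f i) (C i)) →
      (IsMSE w Ω ∧ ContinuousOn w (Ω ∪ ⋃ i, C i) ∧ ∀ i, EqOn w (f i) (C i)) → ∀ z ∈ Ω, v z ≤ w z := by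
    rintro v w ⟨hv1, hv2, hv3⟩ ⟨hw1, hw2, hw3⟩
    refine comparison hΩo hΩb hVfin hVΩ hv1 hw1 fun b hb ε hε => ?_
    rw [hfr] at hb
    obtain ⟨i, hi⟩ := mem_iUnion.1 hb
    have t1 := ((hv2 b (Or.inr hb)).mono subset_union_left).tendsto
    have t2 := ((hw2 b (Or.inr hb)).mono subset_union_left).tendsto
    rw [hv3 i hi] at t1
    rw [hw3 i hi] at t2
    filter_upwards [t1.eventually (eventually_lt_nhds (show f i b < f i b + ε / 2 by linarith)),
      t2.eventually (eventually_gt_nhds (show f i b - ε / 2 < f i b by linarith))] with z h1 h2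
    linarith
  exact ⟨u, ⟨huM, huc, hue⟩, fun v hv z hz =>
    le_antisymm (huniq v u hv ⟨huM, huc, hue⟩ z hz) (huniq u v ⟨huM, huc, hue⟩ hv z hz)⟩
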